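/- Let d, m ≥ 1, r⃗ ∈ (0,∞)^m, q_0 ∈ (0,∞), and let T be an m-linear operator defined on m-tuples of functions in L^∞_c(ℝ^d), with values in measurable functions on ℝ^d, such that for all f_j ∈ L^∞_c(ℝ^d) there exists a sparse collection 𝒮 of cubes with |T(f⃗)(x)| ≤ C_T (∑_{Q∈𝒮} (∏_{j=1}^m ⟨f_j⟩_{r_j,Q})^{q_0} 1_Q(x))^{1/q_0} for a.e. x, for some fixed C_T ≥ 0. Let p⃗, t⃗ ∈ (0,∞]^m with r_j < p_j and r_j < t_j for all j, and with p < ∞ and t < ∞, where 1/p := ∑_j 1/p_j, 1/t := ∑_j 1/t_j, 1/r := ∑_j 1/r_j, and let w⃗ ∈ A_{p⃗,(r⃗,∞)} with w := ∏_j w_j. Then there is a constant C depending only on d, m, p⃗, q_0, r⃗, t⃗ such that for all simple, bounded, boundedly supported f_j : ℝ^d × ℕ → ℂ: ‖ ‖T̃(f⃗)(x,·)‖_{ℓ^t} ‖_{L^p_w(ℝ^d,dx)} ≤ C · C_T · [w⃗]_{p⃗,(r⃗,∞)}^γ · ∏_{j=1}^m ‖ ‖f_j(x,·)‖_{ℓ^{t_j}}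 ‖_{L^{p_j}_{w_j}(ℝ^d,dx)}, where T̃(f⃗)(x,k) := T(f_1(·,k),…,f_m(·,k))(x) is the coordinatewise tensor extension, and γ = max{ max_{1≤j≤m} (1/r_j)/(1/r_j − 1/p_j), p/q_0 } if t ∈ [q_0,∞), while γ = max{ max_{1≤j≤m} (1/r_j)/(1/r_j − 1/p_j), p/t } if t ∈ (r, q_0]. -/

import Mathlib

open MeasureTheory ENNReal

noncomputable section

structure Cube (d : ℕ) where
  corner : Fin d → ℝ
  side : ℝ
  side_pos : 0 < side

namespace Cube
def set {d : ℕ} (Q : Cube d) : Set (Fin d → ℝ) :=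
  {x | ∀ i, Q.corner i ≤ x i ∧ x i < Q.corner i + Q.side}
def vol {d : ℕ} (Q : Cube d) : ℝ≥0∞ := volume Q.set
def IsDyadic {d : ℕ} (Q : Cube d) : Prop :=
  ∃ (k : ℤ) (n : Fin d → ℤ), Q.side = (2:ℝ) ^ (-k) ∧ ∀ i, Q.corner i = (2:ℝ) ^ (-k) * (n i : ℝ)
end Cube

def IsSparse {d : ℕ} (S : Set (Cube d)) : Prop :=
  ∃ E : Cube d → Set (Fin d → ℝ),
    (∀ Q ∈ S, MeasurableSet (E Q) ∧ E Q ⊆ Q.set ∧ Q.vol ≤ 2 * volume (E Q)) ∧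
    S.PairwiseDisjoint E

def eNorm {α : Type*} [MeasurableSpace α] (p : ℝ≥0∞) (μ : Measure α) (F : α → ℝ≥0∞) : ℝ≥0∞ :=
  if p = ∞ then essSup F μ else (∫⁻ x, F x ^ p.toReal ∂μ) ^ (1 / p.toReal)

def nn {α : Type*} (f : α → ℂ) : α → ℝ≥0∞ := fun x => (‖f x‖₊ : ℝ≥0∞)

def avg {d : ℕ} (r : ℝ≥0∞) (F : (Fin d → ℝ) → ℝ≥0∞) (Q : Cube d) : ℝ≥0∞ :=
  if r = ∞ then essSup F (volume.restrict Q.set)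
  else ((∫⁻ x in Q.set, F x ^ r.toReal) / Q.vol) ^ (1 / r.toReal)

def maximal {d k : ℕ} (r : Fin k → ℝ≥0∞) (F : Fin k → (Fin d → ℝ) → ℝ≥0∞)
    (x : Fin d → ℝ) : ℝ≥0∞ :=
  ⨆ (Q : Cube d) (_ : x ∈ Q.set), ∏ j, avg (r j) (F j) Q

def maximalX {d k : ℕ} (r : Fin k → ℝ≥0∞) (ρ : ℝ≥0∞) (F : Fin k → (Fin d → ℝ) → ℝ≥0∞)
    (G : (Fin d → ℝ) → ℝ≥0∞) (x : Fin d → ℝ) : ℝ≥0∞ :=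
  ⨆ (Q : Cube d) (_ : x ∈ Q.set), (∏ j, avg (r j) (F j) Q) * avg ρ G Q

def wNorm {d : ℕ} (p : ℝ≥0∞) (w : (Fin d → ℝ) → ℝ) (F : (Fin d → ℝ) → ℝ≥0∞) : ℝ≥0∞ :=
  eNorm p volume (fun x => F x * ENNReal.ofReal (w x))

def aConst {d m : ℕ} (p r : Fin m → ℝ≥0∞) (s : ℝ≥0∞)
    (w : Fin m → (Fin d → ℝ) → ℝ) : ℝ≥0∞ :=
  ⨆ Q : Cube d,
    (∏ j, avg ((r j)⁻¹ - (p j)⁻¹)⁻¹ (fun x => ENNReal.ofReal (w j x)⁻¹) Q) *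
      avg ((∑ j, (p j)⁻¹) - s⁻¹)⁻¹ (fun x => ENNReal.ofReal (∏ j, w j x)) Q

def latAvg {d : ℕ} {Ω : Type*} (r : ℝ≥0∞) (f : (Fin d → ℝ) → Ω → ℂ) (Q : Cube d) (ω : Ω) : ℝ≥0∞ :=
  ((∫⁻ y in Q.set, (‖f y ω‖₊ : ℝ≥0∞) ^ r.toReal) / Q.vol) ^ (1 / r.toReal)

def latMax {d m : ℕ} {Ω : Type*} (r : Fin m → ℝ≥0∞) (D : Finset (Cube d))
    (f : Fin m → (Fin d → ℝ) → Ω → ℂ) (x : Fin d → ℝ) (ω : Ω) : ℝ≥0∞ :=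
  ⨆ Q ∈ D, ⨆ (_ : x ∈ Cube.set Q), ∏ j, latAvg (r j) (f j) Q ω

def latMaxX {d m : ℕ} {Ω : Type*} (r : Fin m → ℝ≥0∞) (ρ : ℝ≥0∞) (D : Finset (Cube d))
    (f : Fin m → (Fin d → ℝ) → Ω → ℂ) (g : (Fin d → ℝ) → Ω → ℂ)
    (x : Fin d → ℝ) (ω : Ω) : ℝ≥0∞ :=
  ⨆ Q ∈ D, ⨆ (_ : x ∈ Cube.set Q), (∏ j, latAvg (r j) (f j) Q ω) * latAvg ρ g Q ω

def MemLinftyC {d : ℕ} (f : (Fin d → ℝ) → ℂ) : Prop :=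
  Measurable f ∧ (∃ M : ℝ, ∀ x, ‖f x‖ ≤ M) ∧ Bornology.IsBounded (Function.support f)

def SimpleLinftyC {d : ℕ} (f : (Fin d → ℝ) → ℂ) : Prop :=
  Measurable f ∧ (Set.range f).Finite ∧ Bornology.IsBounded (Function.support f)

def PairSimple {d : ℕ} {Ω : Type*} [MeasurableSpace Ω] (f : (Fin d → ℝ) → Ω → ℂ) : Prop :=
  Measurable (Function.uncurry f) ∧ (Set.range (Function.uncurry f)).Finite ∧
    ∃ B : Set (Fin d → ℝ), Bornology.IsBounded B ∧ ∀ x ∉ B, ∀ ω, f x ω = 0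

def VecSimple {d : ℕ} {Ω : Type*} [MeasurableSpace Ω] (f : (Fin d → ℝ) → Ω → ℂ) : Prop :=
  ∃ (N : ℕ) (A : Fin N → Set (Fin d → ℝ)) (ξ : Fin N → Ω → ℂ),
    (∀ i, MeasurableSet (A i)) ∧ (∀ i, Bornology.IsBounded (A i)) ∧
    (∀ i, Measurable (ξ i)) ∧ (∃ M : ℝ, ∀ i ω, ‖ξ i ω‖ ≤ M) ∧
    ∀ x ω, f x ω = ∑ i, (A i).indicator (fun _ => ξ i ω) x

/-! Basic inequalities -/

lemma finset_rpow_sum_le {ι : Type*} (s : Finset ι) (a : ι → ℝ≥0∞) {θ : ℝ} (h0 : 0 < θ)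
    (h1 : θ ≤ 1) : (∑ i ∈ s, a i) ^ θ ≤ ∑ i ∈ s, a i ^ θ := by
  classical
  induction s using Finset.induction_on with
  | empty => simp [h0]
  | insert i s hi ih =>
    rw [Finset.sum_insert hi, Finset.sum_insert hi]
    exact (ENNReal.rpow_add_le_add_rpow _ _ h0.le h1).trans (by gcongr)

lemma tsum_rpow_le_tsum {ι : Type*} (a : ι → ℝ≥0∞) {θ : ℝ} (h0 : 0 < θ)
    (h1 : θ ≤ 1) : (∑' i, a i) ^ θ ≤ ∑' i, a i ^ θ := by
  rw [ENNReal.tsum_eq_iSup_sum]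
  have : (⨆ s : Finset ι, ∑ i ∈ s, a i) ^ θ = ⨆ s : Finset ι, (∑ i ∈ s, a i) ^ θ :=
    (ENNReal.orderIsoRpow θ h0).map_iSup _
  rw [this]
  exact iSup_le fun s => (finset_rpow_sum_le s a h0 h1).trans (ENNReal.sum_le_tsum s)

lemma lq_embedding {ι : Type*} (b : ι → ℝ≥0∞) {q q₀ : ℝ} (hq : 0 < q)
    (h1 : q ≤ q₀) : (∑' i, b i ^ q₀) ^ (1 / q₀) ≤ (∑' i, b i ^ q) ^ (1 / q) := by
  have hq0 : 0 < q₀ := hq.trans_le h1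
  have := tsum_rpow_le_tsum (fun i => b i ^ q₀) (θ := q / q₀) (by positivity)
    ((div_le_one hq0).2 h1)
  simp only [← ENNReal.rpow_mul] at this
  rw [show q₀ * (q / q₀) = q by field_simp] at this
  calc _ = ((∑' i, b i ^ q₀) ^ (q / q₀)) ^ (1 / q) := by
        rw [← ENNReal.rpow_mul]; congr 1; field_simp
    _ ≤ _ := by gcongr

lemma sum_rpow_crude {ι : Type*} (s : Finset ι) (x : ι → ℝ≥0∞) {θ : ℝ} (hθ : 0 < θ) :
    (∑ i ∈ s, x i) ^ θ ≤ (s.card : ℝ≥0∞) ^ θ * ∑ i ∈ s, x i ^ θ := by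
  classical
  rcases s.eq_empty_or_nonempty with rfl | hs
  · simp [hθ]
  obtain ⟨i, hi, hmax⟩ := s.exists_max_image x hs
  calc (∑ i ∈ s, x i) ^ θ ≤ ((s.card : ℝ≥0∞) * x i) ^ θ := by
        gcongr
        simpa using Finset.sum_le_card_nsmul s x (x i) hmax
    _ = (s.card : ℝ≥0∞) ^ θ * x i ^ θ := ENNReal.mul_rpow_of_nonneg _ _ hθ.le
    _ ≤ _ := by
        gcongr
        exact Finset.single_le_sum (f := fun i => x i ^ θ) (fun _ _ => zero_le) hi

/-- multi-Hölder in bound form, with possibly infinite exponents. -/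
lemma holder_bound {α ι : Type*} [MeasurableSpace α] (μ : Measure α) [Fintype ι]
    (p : ι → ℝ≥0∞) (hp : ∀ j, p j ≠ 0) (P : ℝ) (hP : 0 < P)
    (hPp : P⁻¹ = ∑ j, ((p j)⁻¹).toReal)
    (φ : ι → α → ℝ≥0∞) (hφ : ∀ j, Measurable (φ j)) (N : ι → ℝ≥0∞)
    (h1 : ∀ j, p j ≠ ∞ → ∫⁻ x, φ j x ^ (p j).toReal ∂μ ≤ N j ^ (p j).toReal)
    (h2 : ∀ j, p j = ∞ → ∀ᵐ x ∂μ, φ j x ≤ N j) :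
    ∫⁻ x, ∏ j, φ j x ^ P ∂μ ≤ ∏ j, N j ^ P := by
  classical
  set c : ℝ≥0∞ := ∏ j, if p j = ∞ then N j ^ P else 1 with hc
  have hppos : ∀ j, p j ≠ ∞ → 0 < (p j).toReal := fun j hj => ENNReal.toReal_pos (hp j) hj
  have hae : ∀ᵐ x ∂μ, ∏ j, φ j x ^ P ≤
      c * ∏ j, (φ j x ^ (p j).toReal) ^ (P * ((p j)⁻¹).toReal) := by
    have : ∀ᵐ x ∂μ, ∀ j, p j = ∞ → φ j x ≤ N j := by
      rw [ae_all_iff]; intro j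
      by_cases hj : p j = ∞
      · filter_upwards [h2 j hj] with x hx _ using hx
      · simp [hj]
    filter_upwards [this] with x hx
    rw [hc, ← Finset.prod_mul_distrib]
    refine Finset.prod_le_prod' fun j _ => ?_
    by_cases hj : p j = ∞
    · simp only [hj, if_true, inv_top, toReal_zero, mul_zero, rpow_zero, mul_one]
      exact ENNReal.rpow_le_rpow (hx j hj) hP.le
    · simp only [hj, if_false, one_mul]
      rw [← ENNReal.rpow_mul, ENNReal.toReal_inv]
      have := hppos j hj
      rw [show (p j).toReal * (P * (p j).toReal⁻¹) = P by field_simp]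
  calc _ ≤ ∫⁻ x, c * ∏ j, (φ j x ^ (p j).toReal) ^ (P * ((p j)⁻¹).toReal) ∂μ :=
        lintegral_mono_ae hae
    _ = c * ∫⁻ x, ∏ j, (φ j x ^ (p j).toReal) ^ (P * ((p j)⁻¹).toReal) ∂μ := by
        rw [lintegral_const_mul]
        exact Finset.measurable_prod _ fun j _ => ((hφ j).pow_const _).pow_const _
    _ ≤ c * ∏ j, (∫⁻ x, φ j x ^ (p j).toReal ∂μ) ^ (P * ((p j)⁻¹).toReal) := by
        gcongr
        apply ENNReal.lintegral_prod_norm_pow_le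
        · exact fun j _ => ((hφ j).pow_const _).aemeasurable
        · rw [← Finset.mul_sum, ← hPp, mul_inv_cancel₀ hP.ne']
        · intro j _; positivity
    _ ≤ _ := by
        rw [hc, ← Finset.prod_mul_distrib]
        refine Finset.prod_le_prod' fun j _ => ?_
        by_cases hj : p j = ∞
        · simp [hj]
        · simp only [hj, if_false, one_mul]
          refine (ENNReal.rpow_le_rpow (h1 j hj) (by positivity)).trans ?_
          rw [← ENNReal.rpow_mul, ENNReal.toReal_inv]
          have := hppos j hj
          rw [show (p j).toReal * (P * (p j).toReal⁻¹) = P by field_simp]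

lemma holder_bound_finset {ι κ : Type*} [Fintype ι] (I : Finset κ)
    (p : ι → ℝ≥0∞) (hp : ∀ j, p j ≠ 0) (P : ℝ) (hP : 0 < P)
    (hPp : P⁻¹ = ∑ j, ((p j)⁻¹).toReal)
    (φ : ι → κ → ℝ≥0∞) (N : ι → ℝ≥0∞)
    (h1 : ∀ j, p j ≠ ∞ → ∑ i ∈ I, φ j i ^ (p j).toReal ≤ N j ^ (p j).toReal)
    (h2 : ∀ j, p j = ∞ → ∀ i ∈ I, φ j i ≤ N j) :
    ∑ i ∈ I, ∏ j, φ j i ^ P ≤ ∏ j, N j ^ P := by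
  letI : MeasurableSpace I := ⊤
  have := holder_bound (Measure.count : Measure I) p hp P hP hPp (fun j i => φ j i)
    (fun j => measurable_from_top) N ?_ ?_
  · rw [lintegral_count, tsum_fintype] at this
    rwa [← Finset.sum_coe_sort I (fun i => ∏ j, φ j i ^ P)]
  · intro j hj
    rw [lintegral_count, tsum_fintype, Finset.sum_coe_sort I (fun i => φ j i ^ (p j).toReal)]
    exact h1 j hj
  · intro j hj
    exact Filter.Eventually.of_forall fun i => h2 j hj i i.2

/-! exponential parametrisation of positive finite extended reals -/

def ee (l : ℝ) : ℝ≥0∞ := ENNReal.ofReal (Real.exp l)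

lemma ee_add (a b : ℝ) : ee (a + b) = ee a * ee b := by
  simp [ee, Real.exp_add, ENNReal.ofReal_mul, Real.exp_nonneg]

lemma ee_rpow (a s : ℝ) : ee a ^ s = ee (a * s) := by
  rw [ee, ENNReal.ofReal_rpow_of_pos (Real.exp_pos _), ee, Real.exp_mul]

lemma ee_div (a b : ℝ) : ee a / ee b = ee (a - b) := by
  rw [ee, ee, ← ENNReal.ofReal_div_of_pos (Real.exp_pos _), ee, Real.exp_sub]

lemma ee_prod {ι : Type*} (s : Finset ι) (a : ι → ℝ) : ∏ i ∈ s, ee (a i) = ee (∑ i ∈ s, a i) := by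
  simp only [ee]
  rw [Real.exp_sum, ENNReal.ofReal_prod_of_nonneg fun i _ => (Real.exp_pos _).le]

lemma ee_le {a b : ℝ} : ee a ≤ ee b ↔ a ≤ b := by
  rw [ee, ee, ENNReal.ofReal_le_ofReal_iff (Real.exp_pos _).le, Real.exp_le_exp]

lemma exists_ee {x : ℝ≥0∞} (h0 : x ≠ 0) (h1 : x ≠ ∞) : ∃ l, x = ee l :=
  ⟨Real.log x.toReal, by rw [ee, Real.exp_log (ENNReal.toReal_pos h0 h1), ENNReal.ofReal_toReal h1]⟩

lemma ee_ne_zero (l : ℝ) : ee l ≠ 0 := by simp [ee, Real.exp_pos]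
lemma ee_ne_top (l : ℝ) : ee l ≠ ∞ := by simp [ee]

/-! Minkowski integral inequality -/

lemma minkowski_aux {X κ : Type*} [MeasurableSpace X] (μ : Measure X) (s : Finset κ)
    (g : κ → X → ℝ≥0∞) (hg : ∀ k, Measurable (g k)) {u : ℝ} (hu : 1 ≤ u) :
    (∑ k ∈ s, (∫⁻ x, g k x ∂μ) ^ u) ^ (1 / u) ≤
      ∫⁻ x, (∑ k ∈ s, g k x ^ u) ^ (1 / u) ∂μ := by
  classical
  have hu0 : 0 < u := by linarith
  by_cases htop : ∫⁻ x, (∑ k ∈ s, g k x ^ u) ^ (1 / u) ∂μ = ∞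
  · rw [htop]; exact le_top
  induction s using Finset.induction_on with
  | empty => simp [hu0]
  | insert i s hi ih =>
    rcases hu.eq_or_lt with rfl | hu1
    · simp [lintegral_finsetSum', lintegral_finsetSum, hg]
    have hpq : u.HolderConjugate (u / (u - 1)) := Real.HolderConjugate.conjExponent hu1
    set s' := insert i s
    set b : κ → ℝ≥0∞ := fun k => ∫⁻ x, g k x ∂μ with hb
    set v := u / (u - 1)
    set B := ∑ k ∈ s', b k ^ u with hB
    have hbfin : ∀ k ∈ s', b k ≠ ∞ := by
      intro k hk
      refine ne_top_of_le_ne_top htop (lintegral_mono fun x => ?_)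
      calc g k x = (g k x ^ u) ^ (1 / u) := by rw [← ENNReal.rpow_mul]; simp [hu0.ne']
        _ ≤ _ := by
          gcongr
          exact Finset.single_le_sum (f := fun k => g k x ^ u) (fun _ _ => zero_le) hk
    have hBfin : B ≠ ∞ := by
      rw [hB]
      exact (ENNReal.sum_ne_top).2 fun k hk => ENNReal.rpow_ne_top_of_nonneg hu0.le (hbfin k hk)
    have key : B ≤ B ^ (1 / v) * ∫⁻ x, (∑ k ∈ s', g k x ^ u) ^ (1 / u) ∂μ := by
      calc B = ∑ k ∈ s', b k ^ (u - 1) * ∫⁻ x, g k x ∂μ := by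
            refine Finset.sum_congr rfl fun k hk => ?_
            by_cases h0 : b k = 0
            · change _ = _ * b k
              simp [h0, hu0]
            change _ = _ * b k
            nth_rewrite 3 [← ENNReal.rpow_one (b k)]
            rw [← ENNReal.rpow_add _ _ h0 (hbfin k hk)]; congr 1; ring
        _ = ∫⁻ x, ∑ k ∈ s', b k ^ (u - 1) * g k x ∂μ := by
            rw [lintegral_finsetSum]
            · refine Finset.sum_congr rfl fun k hk => ?_
              rw [lintegral_const_mul _ (hg k)]
            · exact fun k _ => (hg k).const_mul _
        _ ≤ ∫⁻ x, B ^ (1 / v) * (∑ k ∈ s', g k x ^ u) ^ (1 / u) ∂μ := by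
            refine lintegral_mono fun x => ?_
            refine (ENNReal.inner_le_Lp_mul_Lq s' _ _ hpq.symm).trans_eq ?_
            congr 2
            refine Finset.sum_congr rfl fun k hk => ?_
            rw [← ENNReal.rpow_mul]; congr 1
            have : u - 1 ≠ 0 := by linarith
            simp only [v]; field_simp
        _ = _ := by
            rw [lintegral_const_mul]
            exact (Finset.measurable_sum _ fun k _ => (hg k).pow_const _).pow_const _
    by_cases hB0 : B = 0
    · rw [hB0]; simp [hu0]
    have hBv : B ^ (1 / v) ≠ 0 := by simp [hB0, hBfin]
    have hBv' : B ^ (1 / v) ≠ ∞ := ENNReal.rpow_ne_top_of_nonneg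
      (by have := hpq.symm.pos; positivity) hBfin
    have h3 : B = B ^ (1 / v) * B ^ (1 / u) := by
      rw [← ENNReal.rpow_add _ _ hB0 hBfin]
      have := hpq.symm.inv_add_inv_eq_one
      simp only [one_div, this, ENNReal.rpow_one]
    rw [h3] at key
    nth_rewrite 2 [← h3] at key
    exact (ENNReal.mul_le_mul_iff_right hBv hBv').1 key

/-! Nested families and the Carleson embedding -/

def NestedOn {X ι : Type*} (I : Finset ι) (R : ι → Set X) : Prop :=
  ∀ i ∈ I, ∀ j ∈ I, R i ⊆ R j ∨ R j ⊆ R i ∨ Disjoint (R i) (R j)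

lemma exists_disjoint_sub {X ι : Type*} (I : Finset ι) (R : ι → Set X) (h : NestedOn I R) :
    ∃ J : Finset ι, J ⊆ I ∧ (J : Set ι).PairwiseDisjoint R ∧
      (⋃ i ∈ I, R i) = ⋃ i ∈ J, R i := by
  classical
  induction I using Finset.induction_on with
  | empty => exact ⟨∅, by simp, by simp, rfl⟩
  | insert a I ha ih =>
    obtain ⟨J, hJI, hJd, hJu⟩ := ih fun i hi j hj =>
      h i (Finset.mem_insert_of_mem hi) j (Finset.mem_insert_of_mem hj)
    by_cases hc : ∃ i ∈ J, R a ⊆ R i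
    · obtain ⟨i, hi, hai⟩ := hc
      refine ⟨J, hJI.trans (Finset.subset_insert _ _), hJd, ?_⟩
      rw [Finset.set_biUnion_insert, hJu]
      apply Set.union_eq_right.2
      exact hai.trans (Set.subset_biUnion_of_mem (u := R) hi)
    · push Not at hc
      refine ⟨insert a (J.filter fun i => Disjoint (R i) (R a)), ?_, ?_, ?_⟩
      · exact Finset.insert_subset_insert _ ((Finset.filter_subset _ _).trans hJI)
      · rw [Finset.coe_insert]
        apply Set.PairwiseDisjoint.insert
        · exact hJd.subset (by intro i; simp; tauto)
        · intro j hj _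
          simp at hj
          exact hj.2.symm
      · rw [Finset.set_biUnion_insert, Finset.set_biUnion_insert, hJu]
        apply Set.Subset.antisymm
        · apply Set.union_subset Set.subset_union_left
          intro x hx
          simp only [Set.mem_iUnion] at hx
          obtain ⟨i, hi, hx⟩ := hx
          rcases h a (Finset.mem_insert_self _ _) i (Finset.mem_insert_of_mem (hJI hi)) with h1 | h1 | h1
          · exact absurd h1 (hc i hi)
          · exact Or.inl (h1 hx)
          · right
            simp only [Set.mem_iUnion]
            exact ⟨i, by simp [hi, h1.symm], hx⟩
        · apply Set.union_subset_union_right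
          apply Set.biUnion_subset_biUnion_left
          exact Finset.coe_subset.2 (Finset.filter_subset _ _)

lemma measure_biUnion_le_of_nested {X ι : Type*} [MeasurableSpace X] (μ ν : Measure X)
    (I : Finset ι) (R : ι → Set X) (h : NestedOn I R) (hm : ∀ i ∈ I, MeasurableSet (R i))
    (hle : ∀ i ∈ I, μ (R i) ≤ ν (R i)) : μ (⋃ i ∈ I, R i) ≤ ν (⋃ i ∈ I, R i) := by
  obtain ⟨J, hJI, hJd, hJu⟩ := exists_disjoint_sub I R h
  rw [hJu, measure_biUnion_finset hJd fun i hi => hm i (hJI hi),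
    measure_biUnion_finset hJd fun i hi => hm i (hJI hi)]
  exact Finset.sum_le_sum fun i hi => hle i (hJI hi)

lemma layer_finite {e c : ℝ} (he : 0 < e) (hc : 0 ≤ c) :
    ∫⁻ l in Set.Ioc (0:ℝ) c, ENNReal.ofReal (l ^ (e - 1)) = ENNReal.ofReal (c ^ e / e) := by
  rw [← ofReal_integral_eq_lintegral_ofReal]
  · rw [← intervalIntegral.integral_of_le hc, integral_rpow (Or.inl (by linarith))]
    congr 1
    simp [he.ne']
  · exact (intervalIntegrable_iff_integrableOn_Ioc_of_le hc).1
      (intervalIntegral.intervalIntegrable_rpow' (by linarith))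
  · refine (ae_restrict_iff' measurableSet_Ioc).2 (Filter.Eventually.of_forall fun x hx => ?_)
    exact Real.rpow_nonneg hx.1.le _

def lay (e : ℝ) (c : ℝ≥0∞) (l : ℝ) : ℝ≥0∞ :=
  if ENNReal.ofReal l < c then ENNReal.ofReal (l ^ (e - 1)) else 0

lemma layer_le {e : ℝ} (he : 0 < e) (c : ℝ≥0∞) :
    ∫⁻ l in Set.Ioi (0:ℝ), lay e c l ≤ c ^ e / ENNReal.ofReal e := by
  by_cases hc : c = ∞
  · simp [hc, he, ENNReal.top_div]
  calc _ = ∫⁻ l, (Set.Ioi (0:ℝ)).indicator (lay e c) l := by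
        rw [lintegral_indicator measurableSet_Ioi]
    _ ≤ ∫⁻ l, (Set.Ioc (0:ℝ) c.toReal).indicator (fun l => ENNReal.ofReal (l ^ (e - 1))) l := by
        refine lintegral_mono fun l => ?_
        by_cases hl : 0 < l
        · simp only [Set.indicator, Set.mem_Ioi, hl, if_true, Set.mem_Ioc, true_and, lay]
          split_ifs with h1 h2
          · exact le_rfl
          · exact absurd (ENNReal.ofReal_le_iff_le_toReal hc |>.1 h1.le) h2
          · exact zero_le
          · exact zero_le
        · simp [Set.indicator, hl]
    _ = ENNReal.ofReal (c.toReal ^ e / e) := by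
        rw [lintegral_indicator measurableSet_Ioc, layer_finite he ENNReal.toReal_nonneg]
    _ = _ := by
        rw [ENNReal.ofReal_div_of_pos he, ← ENNReal.ofReal_rpow_of_nonneg toReal_nonneg he.le,
          ENNReal.ofReal_toReal hc]

lemma le_layer {e : ℝ} (he : 0 < e) (c : ℝ≥0∞) :
    c ^ e ≤ ENNReal.ofReal e * ∫⁻ l in Set.Ioi (0:ℝ), lay e c l := by
  have fin : ∀ b : ℝ, 0 ≤ b → ENNReal.ofReal b ≤ c →
      ENNReal.ofReal b ^ e ≤ ENNReal.ofReal e * ∫⁻ l in Set.Ioi (0:ℝ), lay e c l := by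
    intro b hb hbc
    have : ∫⁻ l in Set.Ioo (0:ℝ) b, ENNReal.ofReal (l ^ (e - 1)) ≤
        ∫⁻ l in Set.Ioi (0:ℝ), lay e c l := by
      calc _ ≤ ∫⁻ l in Set.Ioo (0:ℝ) b, lay e c l := by
            refine setLIntegral_mono' measurableSet_Ioo fun l hl => ?_
            have : ENNReal.ofReal l < c :=
              lt_of_lt_of_le ((ENNReal.ofReal_lt_ofReal_iff (hl.1.trans hl.2)).2 hl.2) hbc
            simp [lay, this]
        _ ≤ _ := lintegral_mono_set fun l hl => hl.1
    rw [setLIntegral_congr Ioo_ae_eq_Ioc, layer_finite he hb] at this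
    calc _ = ENNReal.ofReal e * ENNReal.ofReal (b ^ e / e) := by
          rw [← ENNReal.ofReal_mul he.le, ENNReal.ofReal_rpow_of_nonneg hb he.le]
          congr 1; field_simp
      _ ≤ _ := by gcongr
  by_cases hc : c = ∞
  · have : ∀ n : ℕ, ((n : ℝ≥0∞)) ^ e ≤ ENNReal.ofReal e * ∫⁻ l in Set.Ioi (0:ℝ), lay e c l := by
      intro n
      have := fin n (by positivity) (by simp [hc])
      simpa using this
    have h2 := iSup_le this
    refine le_trans ?_ h2
    have h3 : (⨆ n : ℕ, (n : ℝ≥0∞)) ^ e = ⨆ n : ℕ, (n : ℝ≥0∞) ^ e :=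
      (ENNReal.orderIsoRpow e he).map_iSup _
    rw [← h3, ENNReal.iSup_natCast, hc]
  · have := fin c.toReal toReal_nonneg (by rw [ENNReal.ofReal_toReal hc])
    rwa [ENNReal.ofReal_toReal hc] at this

lemma lay_measurable (e : ℝ) : Measurable (fun z : ℝ≥0∞ × ℝ => lay e z.1 z.2) := by
  unfold lay
  refine Measurable.ite ?_ ?_ measurable_const
  · exact measurableSet_lt (by fun_prop) (by fun_prop)
  · exact ENNReal.measurable_ofReal.comp ((measurable_snd).pow_const _)

def carC (u : ℝ) : ℝ≥0∞ := ENNReal.ofReal u * (2 * (2 ^ (u - 1) / ENNReal.ofReal (u - 1)))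

lemma carC_ne_top {u : ℝ} (hu : 1 < u) : carC u ≠ ∞ := by
  unfold carC
  refine ENNReal.mul_ne_top ofReal_ne_top (ENNReal.mul_ne_top (by simp) ?_)
  refine ENNReal.div_ne_top (ENNReal.rpow_ne_top_of_nonneg (by linarith) (by simp)) ?_
  simp; linarith

theorem carleson {X ι : Type*} [MeasurableSpace X] (ν : Measure X) [SFinite ν] {u : ℝ} (hu : 1 < u)
    (I : Finset ι) (R E : ι → Set X) (hnest : NestedOn I R)
    (hR : ∀ i ∈ I, MeasurableSet (R i)) (hE : ∀ i ∈ I, MeasurableSet (E i))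
    (hER : ∀ i ∈ I, E i ⊆ R i) (hdisj : (I : Set ι).PairwiseDisjoint E)
    (h0 : ∀ i ∈ I, ν (R i) ≠ 0) (htop : ∀ i ∈ I, ν (R i) ≠ ∞)
    (h : X → ℝ≥0∞) (hh : Measurable h) :
    ∑ i ∈ I, ((∫⁻ x in R i, h x ∂ν) / ν (R i)) ^ u * ν (E i) ≤ carC u * ∫⁻ x, h x ^ u ∂ν := by
  classical
  set c : ι → ℝ≥0∞ := fun i => (∫⁻ x in R i, h x ∂ν) / ν (R i) with hc
  have hu0 : 0 < u := by linarith
  -- weak type estimate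
  have weak : ∀ l : ℝ, 0 < l → ∑ i ∈ I, (if ENNReal.ofReal l < c i then ν (E i) else 0) ≤
      (ENNReal.ofReal l)⁻¹ * (2 * ∫⁻ x, (if ENNReal.ofReal l < 2 * h x then h x else 0) ∂ν) := by
    intro l hl
    set a := ENNReal.ofReal l with ha
    have ha0 : a ≠ 0 := by simp [ha, hl]
    have hat : a ≠ ∞ := by simp [ha]
    set hl' : X → ℝ≥0∞ := fun x => if a < 2 * h x then h x else 0 with hgdef
    have hlm : Measurable hl' :=
      Measurable.ite (measurableSet_lt measurable_const (hh.const_mul _)) hh measurable_const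
    set J := I.filter fun i => a < c i with hJ
    have hJI : J ⊆ I := Finset.filter_subset _ _
    rw [← Finset.sum_filter, ← measure_biUnion_finset (hdisj.subset (Finset.coe_subset.2 hJI))
      fun i hi => hE i (hJI hi)]
    have h1 : ν (⋃ i ∈ J, E i) ≤ ν (⋃ i ∈ J, R i) :=
      measure_mono (Set.biUnion_mono le_rfl fun i hi => hER i (hJI hi))
    refine h1.trans ?_
    have h2 := measure_biUnion_le_of_nested (a • ν) (2 • ν.withDensity hl') J R
      (fun i hi j hj => hnest i (hJI hi) j (hJI hj)) (fun i hi => hR i (hJI hi)) ?_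
    · rw [← ENNReal.mul_le_iff_le_inv ha0 hat]
      refine le_trans (by simpa using h2) ?_
      refine mul_le_mul' le_rfl ?_
      · calc _ ≤ (ν.withDensity hl') Set.univ := measure_mono (Set.subset_univ _)
          _ = _ := by rw [withDensity_apply _ MeasurableSet.univ, Measure.restrict_univ]
    · intro i hi
      have hiI := hJI hi
      have hai : a < c i := (Finset.mem_filter.1 hi).2
      simp only [Measure.smul_apply, smul_eq_mul, nsmul_eq_mul, Nat.cast_ofNat]
      rw [withDensity_apply _ (hR i hiI)]
      have h3 : a * ν (R i) ≤ ∫⁻ x in R i, h x ∂ν := by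
        have := (ENNReal.le_div_iff_mul_le (Or.inl (h0 i hiI)) (Or.inl (htop i hiI))).1 hai.le
        exact this
      have h4 : ∫⁻ x in R i, h x ∂ν ≤ ∫⁻ x in R i, hl' x ∂ν + a / 2 * ν (R i) := by
        calc _ ≤ ∫⁻ x in R i, (hl' x + a / 2) ∂ν := by
              refine lintegral_mono fun x => ?_
              simp only [hgdef]
              split_ifs with hx
              · exact le_self_add
              · rw [zero_add, ENNReal.le_div_iff_mul_le (by simp) (by simp), mul_comm]
                exact not_lt.1 hx
          _ = _ := by
              rw [lintegral_add_left hlm, lintegral_const]; simp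
      have h5 : a * ν (R i) = a / 2 * ν (R i) + a / 2 * ν (R i) := by
        rw [← add_mul, ENNReal.add_halves]
      have hfin : a / 2 * ν (R i) ≠ ∞ :=
        ENNReal.mul_ne_top (ENNReal.div_ne_top hat (by simp)) (htop i hiI)
      have h6 : a / 2 * ν (R i) ≤ ∫⁻ x in R i, hl' x ∂ν := by
        have := h3.trans h4
        rw [h5] at this
        exact (ENNReal.add_le_add_iff_right hfin).1 this
      calc a * ν (R i) = 2 * (a / 2 * ν (R i)) := by rw [h5, two_mul]
        _ ≤ _ := by gcongr
  -- layer cake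
  calc ∑ i ∈ I, c i ^ u * ν (E i)
      ≤ ∑ i ∈ I, (ENNReal.ofReal u * ∫⁻ l in Set.Ioi (0:ℝ), lay u (c i) l) * ν (E i) := by
        gcongr with i hi; exact le_layer hu0 _
    _ = ENNReal.ofReal u * ∫⁻ l in Set.Ioi (0:ℝ), ∑ i ∈ I, lay u (c i) l * ν (E i) := by
        rw [lintegral_finsetSum, Finset.mul_sum]
        · refine Finset.sum_congr rfl fun i hi => ?_
          rw [lintegral_mul_const, mul_assoc]
          exact (lay_measurable u).comp (measurable_const.prodMk measurable_id)
        · intro i _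
          exact ((lay_measurable u).comp (measurable_const.prodMk measurable_id)).mul_const _
    _ ≤ ENNReal.ofReal u * ∫⁻ l in Set.Ioi (0:ℝ), ∫⁻ x, 2 * (lay (u - 1) (2 * h x) l * h x) ∂ν := by
        refine mul_le_mul' le_rfl ?_
        refine setLIntegral_mono' measurableSet_Ioi fun l (hl : 0 < l) => ?_
        have hl1 : l ^ (u - 1) = l ^ (u - 1 - 1) * l := by
          rw [← Real.rpow_add_one hl.ne']; congr 1; ring
        have hm : Measurable fun x => (if ENNReal.ofReal l < 2 * h x then h x else 0) :=
          Measurable.ite (measurableSet_lt measurable_const (hh.const_mul _)) hh measurable_const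
        calc ∑ i ∈ I, lay u (c i) l * ν (E i)
            = ENNReal.ofReal (l ^ (u - 1)) *
              ∑ i ∈ I, (if ENNReal.ofReal l < c i then ν (E i) else 0) := by
              rw [Finset.mul_sum]
              refine Finset.sum_congr rfl fun i _ => ?_
              simp only [lay]; split_ifs <;> simp
          _ ≤ ENNReal.ofReal (l ^ (u - 1)) * ((ENNReal.ofReal l)⁻¹ *
                (2 * ∫⁻ x, (if ENNReal.ofReal l < 2 * h x then h x else 0) ∂ν)) := by
              gcongr; exact weak l hl
          _ = ENNReal.ofReal (l ^ (u - 1 - 1)) *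
                (2 * ∫⁻ x, (if ENNReal.ofReal l < 2 * h x then h x else 0) ∂ν) := by
              rw [hl1, ENNReal.ofReal_mul (by positivity), ← mul_assoc, mul_assoc (ENNReal.ofReal (l ^ (u - 1 - 1))),
                ENNReal.mul_inv_cancel (by simp [hl]) (by simp), mul_one]
          _ = _ := by
              rw [← mul_assoc, ← lintegral_const_mul _ hm]
              refine lintegral_congr fun x => ?_
              simp only [lay]; split_ifs <;> ring
    _ = ENNReal.ofReal u * ∫⁻ x, 2 * ((∫⁻ l in Set.Ioi (0:ℝ), lay (u - 1) (2 * h x) l) * h x) ∂ν := by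
        congr 1
        rw [lintegral_lintegral_swap]
        · refine lintegral_congr fun x => ?_
          have : Measurable fun l => lay (u - 1) (2 * h x) l :=
            (lay_measurable _).comp (measurable_const.prodMk measurable_id)
          rw [lintegral_const_mul _ (this.mul_const _), lintegral_mul_const _ this]
        · refine Measurable.aemeasurable ?_
          refine Measurable.const_mul (Measurable.mul ?_ (hh.comp measurable_snd)) _
          exact (lay_measurable _).comp (((hh.comp measurable_snd).const_mul 2).prodMk measurable_fst)
    _ ≤ ENNReal.ofReal u * ∫⁻ x, 2 * (2 ^ (u - 1) / ENNReal.ofReal (u - 1)) * h x ^ u ∂ν := by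
        refine mul_le_mul' le_rfl ?_
        refine lintegral_mono fun x => ?_
        calc 2 * ((∫⁻ l in Set.Ioi (0:ℝ), lay (u - 1) (2 * h x) l) * h x)
            ≤ 2 * (((2 * h x) ^ (u - 1) / ENNReal.ofReal (u - 1)) * h x) := by
              gcongr; exact layer_le (by linarith) _
          _ = 2 * (2 ^ (u - 1) / ENNReal.ofReal (u - 1)) * (h x ^ (u - 1) * h x) := by
              rw [ENNReal.mul_rpow_of_nonneg _ _ (by linarith), div_eq_mul_inv, div_eq_mul_inv]; ring
          _ = _ := by
              congr 1
              nth_rewrite 2 [← ENNReal.rpow_one (h x)]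
              rw [← ENNReal.rpow_add_of_nonneg _ _ (by linarith) zero_le_one]; congr 1; ring
    _ = _ := by
        rw [lintegral_const_mul _ (hh.pow_const _), carC]; ring

/-! The scalar weighted sparse bound -/

def avgS {X : Type*} [MeasurableSpace X] (μ : Measure X) (r : ℝ) (F : X → ℝ≥0∞) (R : Set X) : ℝ≥0∞ :=
  ((∫⁻ x in R, F x ^ r ∂μ) / μ R) ^ (1 / r)

lemma numeric_bound {m : ℕ} (r e θ : Fin m → ℝ) (hr : ∀ j, 0 < r j) (he : ∀ j, 0 < e j)
    (hre : ∀ j, 1 / r j = 1 / e j + θ j) {P q γ : ℝ} (hP : 0 < P) (hq : 0 < q) (hqP : q ≤ P)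
    (hθ : ∑ j, θ j = 1 / P) (hγ1 : ∀ j, e j / r j ≤ γ) (hγ2 : P / q ≤ γ)
    (V V' : Fin m → ℝ≥0∞) (W W' M M' A Λ : ℝ≥0∞)
    (hV0 : ∀ j, V' j ≠ 0) (hVt : ∀ j, V j ≠ ∞) (hVV : ∀ j, V' j ≤ V j)
    (hW0 : W' ≠ 0) (hWt : W ≠ ∞) (hWW : W' ≤ W) (hM0 : M ≠ 0) (hMt : M ≠ ∞) (hMt' : M' ≠ ∞)
    (hAt : A ≠ ∞) (hΛt : Λ ≠ ∞) (hMM : M ≤ Λ * M')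
    (h1 : (∏ j, (V j / M) ^ (1 / e j)) * (W / M) ^ (1 / P) ≤ A)
    (h2 : M' ^ (∑ j, 1 / r j) ≤ (∏ j, V' j ^ (1 / e j)) * W' ^ (1 / P)) :
    (∏ j, (V j / M) ^ (q / r j)) * W ≤
      Λ ^ (q * (γ - 1) * ∑ j, 1 / r j) * A ^ (γ * q) *
        ((∏ j, V' j ^ (q * θ j)) * W' ^ (1 - q / P)) := by
  have hΛ0 : Λ ≠ 0 := by rintro rfl; simp at hMM; exact hM0 hMM
  have hM'0 : M' ≠ 0 := by rintro rfl; simp at hMM; exact hM0 hMM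
  have hV'e : ∀ j, ∃ l, V' j = ee l := fun j =>
    exists_ee (hV0 j) (ne_top_of_le_ne_top (hVt j) (hVV j))
  have hVe : ∀ j, ∃ l, V j = ee l := fun j =>
    exists_ee (fun h => hV0 j (by simpa [h] using hVV j)) (hVt j)
  choose lV' hlV' using hV'e
  choose lV hlV using hVe
  obtain ⟨lW', rfl⟩ := exists_ee hW0 (ne_top_of_le_ne_top hWt hWW)
  obtain ⟨lW, rfl⟩ := exists_ee (fun h => hW0 (by simpa [h] using hWW)) hWt
  obtain ⟨lM, rfl⟩ := exists_ee hM0 hMt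
  obtain ⟨lM', rfl⟩ := exists_ee hM'0 hMt'
  obtain ⟨lΛ, rfl⟩ := exists_ee hΛ0 hΛt
  have hA0 : A ≠ 0 := by
    rintro rfl
    simp only [hlV, ee_div, ee_rpow, ee_prod, ← ee_add] at h1
    exact ee_ne_zero _ (le_antisymm h1 zero_le)
  obtain ⟨a, rfl⟩ := exists_ee hA0 hAt
  simp only [hlV, hlV', ee_div, ee_rpow, ee_prod, ← ee_add, ee_le] at *
  clear hV0 hVt hW0 hWt hM0 hMt hMt' hAt hΛt hΛ0 hM'0 hA0 hlV hlV'
  set ρ := ∑ j, 1 / r j with hρ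
  have hρ' : ρ = ∑ j, 1 / e j + 1 / P := by
    rw [hρ, ← hθ, ← Finset.sum_add_distrib]; exact Finset.sum_congr rfl fun j _ => hre j
  have hρ0 : 0 ≤ ρ := Finset.sum_nonneg fun j _ => (one_div_pos.2 (hr j)).le
  have hγ1' : 1 ≤ γ := le_trans ((one_le_div hq).2 hqP) hγ2
  -- the key linear inequality
  have k1 : ∀ j, θ j * (lV j - lV' j) ≤ (γ - 1) * ((lV j - lV' j) * (1 / e j)) := by
    intro j
    have : θ j ≤ (γ - 1) * (1 / e j) := by
      have h3 := hγ1 j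
      have h4 := he j
      have h5 : e j / r j = 1 + e j * θ j := by
        have := hre j
        rw [div_eq_mul_one_div, this]; field_simp
      rw [h5] at h3
      rw [mul_one_div, le_div_iff₀ h4]; linarith
    nlinarith [hVV j]
  have k2 : (1 / q - 1 / P) * (lW - lW') ≤ (γ - 1) * ((lW - lW') * (1 / P)) := by
    have : 1 / q - 1 / P ≤ (γ - 1) * (1 / P) := by
      have : 1 / q = P / q * (1 / P) := by field_simp
      rw [this]
      have : 0 < 1 / P := by positivity
      nlinarith
    nlinarith
  have k3 : ∑ j, θ j * (lV j - lV' j) ≤ (γ - 1) * ∑ j, (lV j - lV' j) * (1 / e j) := by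
    rw [Finset.mul_sum]; exact Finset.sum_le_sum fun j _ => k1 j
  have e1 : ∑ j, (lV j - lM) * (1 / e j) = ∑ j, lV j * (1 / e j) - lM * ∑ j, 1 / e j := by
    rw [Finset.mul_sum, ← Finset.sum_sub_distrib]; exact Finset.sum_congr rfl fun j _ => by ring
  have e2 : ∑ j, (lV j - lV' j) * (1 / e j) = ∑ j, lV j * (1 / e j) - ∑ j, lV' j * (1 / e j) := by
    rw [← Finset.sum_sub_distrib]; exact Finset.sum_congr rfl fun j _ => by ring
  have e3 : ∑ j, (lV j - lM) * (q / r j) = q * (∑ j, lV j * (1 / e j) + ∑ j, θ j * lV j - lM * ρ) := by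
    rw [hρ, Finset.mul_sum, ← Finset.sum_add_distrib, ← Finset.sum_sub_distrib, Finset.mul_sum]
    refine Finset.sum_congr rfl fun j _ => ?_
    rw [div_eq_mul_one_div q, hre j]; ring
  have e4 : ∑ j, θ j * (lV j - lV' j) = ∑ j, θ j * lV j - ∑ j, θ j * lV' j := by
    rw [← Finset.sum_sub_distrib]; exact Finset.sum_congr rfl fun j _ => by ring
  have e5 : ∑ j, lV' j * (q * θ j) = q * ∑ j, θ j * lV' j := by
    rw [Finset.mul_sum]; exact Finset.sum_congr rfl fun j _ => by ring
  rw [e1] at h1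
  rw [e3, e5]
  rw [e2, e4] at k3
  set S1 := ∑ j, lV j * (1 / e j)
  set S1' := ∑ j, lV' j * (1 / e j)
  set T1 := ∑ j, θ j * lV j
  set T1' := ∑ j, θ j * lV' j
  set ε := ∑ j, 1 / e j
  have hMρ : (lM - lΛ) * ρ ≤ lM' * ρ := by apply mul_le_mul_of_nonneg_right _ hρ0; linarith
  have k4 : S1 - S1' + (lW - lW') * (1 / P) ≤ a + ρ * lΛ := by
    rw [hρ'] at hMρ h2 ⊢; nlinarith
  have k5 : (γ - 1) * (S1 - S1' + (lW - lW') * (1 / P)) ≤ (γ - 1) * (a + ρ * lΛ) :=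
    mul_le_mul_of_nonneg_left k4 (by linarith)
  have k6 : (S1 + T1 - lM * ρ) + lW * (1 / q) ≤
      lΛ * ((γ - 1) * ρ) + a * γ + (T1' + lW' * (1 / q - 1 / P)) := by
    rw [hρ'] at *; nlinarith
  have k7 := mul_le_mul_of_nonneg_left k6 hq.le
  have f1 : q * (lW * (1 / q)) = lW := by field_simp
  have f2 : q * (lW' * (1 / q - 1 / P)) = lW' * (1 - q / P) := by field_simp
  rw [mul_add, f1, mul_add, mul_add q T1', f2] at k7
  nlinarith

def expE {m : ℕ} (r : Fin m → ℝ) (p : Fin m → ℝ≥0∞) (j : Fin m) : ℝ :=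
  (1 / r j - ((p j)⁻¹).toReal)⁻¹

def Dj (r : ℝ) (p : ℝ≥0∞) : ℝ≥0∞ := if p = ∞ then 1 else carC (p.toReal / r) ^ (1 / p.toReal)

def Dq (s : ℝ) : ℝ≥0∞ := if s = 1 then 1 else carC (s / (s - 1)) ^ (1 - 1 / s)

def sC {m : ℕ} (r : Fin m → ℝ) (p : Fin m → ℝ≥0∞) (P q γ : ℝ) (Λ : ℝ≥0∞) : ℝ≥0∞ :=
  (Λ ^ (q * (γ - 1) * ∑ j, 1 / r j)) ^ (1 / q) * (∏ j, Dj (r j) (p j)) * Dq (P / q) ^ (1 / q)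

lemma theta_lt {m : ℕ} (r : Fin m → ℝ) (p : Fin m → ℝ≥0∞) (hr : ∀ j, 0 < r j)
    (hrp : ∀ j, ENNReal.ofReal (r j) < p j) (j : Fin m) : ((p j)⁻¹).toReal < 1 / r j := by
  have h1 : (p j)⁻¹ < (ENNReal.ofReal (r j))⁻¹ := ENNReal.inv_lt_inv.2 (hrp j)
  have h2 : (ENNReal.ofReal (r j))⁻¹ ≠ ∞ := by simp [hr j]
  have := (ENNReal.toReal_lt_toReal (ne_top_of_lt h1) h2).2 h1
  rw [ENNReal.toReal_inv (ENNReal.ofReal _), ENNReal.toReal_ofReal (hr j).le] at this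
  rw [one_div]; exact this

lemma expE_pos {m : ℕ} (r : Fin m → ℝ) (p : Fin m → ℝ≥0∞) (hr : ∀ j, 0 < r j)
    (hrp : ∀ j, ENNReal.ofReal (r j) < p j) (j : Fin m) : 0 < expE r p j := by
  have := theta_lt r p hr hrp j
  unfold expE
  rw [inv_pos]; linarith

lemma expE_eq {m : ℕ} (r : Fin m → ℝ) (p : Fin m → ℝ≥0∞) (j : Fin m) : 1 / r j = 1 / expE r p j + ((p j)⁻¹).toReal := by
  unfold expE; rw [one_div, one_div, inv_inv]; ring

lemma p_ne_zero {m : ℕ} (r : Fin m → ℝ) (p : Fin m → ℝ≥0∞) (hrp : ∀ j, ENNReal.ofReal (r j) < p j) (j : Fin m) : p j ≠ 0 := ne_zero_of_lt (hrp j)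

lemma u_gt {m : ℕ} (r : Fin m → ℝ) (p : Fin m → ℝ≥0∞) (hr : ∀ j, 0 < r j)
    (hrp : ∀ j, ENNReal.ofReal (r j) < p j) (j : Fin m) (hj : p j ≠ ∞) : 1 < (p j).toReal / r j := by
  rw [one_lt_div (hr j)]
  have := (ENNReal.toReal_lt_toReal (by simp) hj).2 (hrp j)
  rwa [ENNReal.toReal_ofReal (hr j).le] at this

lemma Dj_ne_top {m : ℕ} (r : Fin m → ℝ) (p : Fin m → ℝ≥0∞) (hr : ∀ j, 0 < r j)
    (hrp : ∀ j, ENNReal.ofReal (r j) < p j) (j : Fin m) : Dj (r j) (p j) ≠ ∞ := by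
  unfold Dj
  split_ifs with h
  · simp
  · exact ENNReal.rpow_ne_top_of_nonneg (by positivity) (carC_ne_top (u_gt r p hr hrp j h))

lemma Dq_ne_top {s : ℝ} (hs : 1 ≤ s) : Dq s ≠ ∞ := by
  unfold Dq
  split_ifs with h
  · simp
  · have hs1 : 1 < s := lt_of_le_of_ne hs (Ne.symm h)
    refine ENNReal.rpow_ne_top_of_nonneg ?_ (carC_ne_top ?_)
    · rw [sub_nonneg, div_le_one (by linarith)]; exact hs
    · rw [one_lt_div (by linarith)]; linarith

lemma sC_ne_top {m : ℕ} (r : Fin m → ℝ) (p : Fin m → ℝ≥0∞) (hr : ∀ j, 0 < r j)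
    (hrp : ∀ j, ENNReal.ofReal (r j) < p j) {P q γ : ℝ} {Λ : ℝ≥0∞} (hq : 0 < q) (hqP : q ≤ P) (hγ2 : P / q ≤ γ)
    (hΛ : Λ ≠ ∞) : sC r p P q γ Λ ≠ ∞ := by
  have h1 : 1 ≤ P / q := (one_le_div hq).2 hqP
  unfold sC
  refine ENNReal.mul_ne_top (ENNReal.mul_ne_top ?_ ?_) ?_
  · refine ENNReal.rpow_ne_top_of_nonneg (by positivity) (ENNReal.rpow_ne_top_of_nonneg ?_ hΛ)
    refine mul_nonneg (mul_nonneg hq.le (by linarith)) ?_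
    exact Finset.sum_nonneg fun j _ => (one_div_pos.2 (hr j)).le
  · exact ENNReal.prod_ne_top fun j _ => Dj_ne_top r p hr hrp j
  · exact ENNReal.rpow_ne_top_of_nonneg (by positivity) (Dq_ne_top h1)

lemma absorb {X B : ℝ≥0∞} {s : ℝ} (hs : 0 < s) (hX : X ≠ ∞) (h : X ≤ B * X ^ (1 - 1 / s)) :
    X ≤ B ^ s := by
  rcases eq_or_ne X 0 with rfl | h0
  · exact zero_le
  have h1 : X ^ (1 / s) ≤ B := by
    have e : X = X ^ (1 / s) * X ^ (1 - 1 / s) := by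
      rw [← ENNReal.rpow_add _ _ h0 hX]; simp
    have h2 : X ^ (1 - 1 / s) ≠ 0 := by
      simp [ENNReal.rpow_eq_zero_iff, h0, hX]
    have h3 : X ^ (1 - 1 / s) ≠ ∞ := by
      simp [ENNReal.rpow_eq_top_iff, h0, hX]
    rw [e] at h
    rw [← e] at h
    have h' : X ^ (1 / s) * X ^ (1 - 1 / s) ≤ B * X ^ (1 - 1 / s) := by rw [← e]; exact h
    exact (ENNReal.mul_le_mul_iff_left h2 h3).1 h'
  calc X = (X ^ (1 / s)) ^ s := by rw [← ENNReal.rpow_mul, one_div_mul_cancel hs.ne', ENNReal.rpow_one]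
    _ ≤ B ^ s := ENNReal.rpow_le_rpow h1 hs.le

lemma sparse_dual {X ι : Type*} [MeasurableSpace X] (ν : Measure X) [SFinite ν] {s : ℝ} (hs : 1 ≤ s)
    (I : Finset ι) (R E : ι → Set X) (hnest : NestedOn I R)
    (hR : ∀ i ∈ I, MeasurableSet (R i)) (hE : ∀ i ∈ I, MeasurableSet (E i))
    (hER : ∀ i ∈ I, E i ⊆ R i) (hdisj : (I : Set ι).PairwiseDisjoint E)
    (h0 : ∀ i ∈ I, ν (R i) ≠ 0) (htop : ∀ i ∈ I, ν (R i) ≠ ∞)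
    (a b : ι → ℝ≥0∞) (ha : ∀ i ∈ I, a i ≠ ∞) (K : ℝ≥0∞)
    (hab : ∀ i ∈ I, a i * ν (R i) ≤ b i * ν (E i) ^ (1 - 1 / s))
    (hb : ∑ i ∈ I, b i ^ s ≤ K ^ s) :
    ∫⁻ x, (∑ i ∈ I, (R i).indicator (fun _ => a i) x) ^ s ∂ν ≤ (Dq s * K) ^ s := by
  classical
  have hs0 : 0 < s := by linarith
  have hind : ∀ i ∈ I, Measurable ((R i).indicator (fun _ => a i)) := fun i hi =>
    measurable_const.indicator (hR i hi)
  rcases eq_or_lt_of_le hs with rfl | hs1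
  · simp only [ENNReal.rpow_one, Dq, if_true, one_mul] at *
    rw [lintegral_finsetSum _ (fun i hi => hind i hi)]
    refine le_trans (Finset.sum_le_sum fun i hi => ?_) hb
    rw [lintegral_indicator_const (hR i hi)]
    simpa using hab i hi
  set Sf : X → ℝ≥0∞ := fun x => ∑ i ∈ I, (R i).indicator (fun _ => a i) x with hSf
  have hSfm : Measurable Sf := Finset.measurable_sum _ fun i hi => hind i hi
  set Y := ∫⁻ x, Sf x ^ s ∂ν with hY
  have hYt : Y ≠ ∞ := by
    have : Y ≤ ∫⁻ x, (I.card : ℝ≥0∞) ^ s * ∑ i ∈ I, (R i).indicator (fun _ => a i ^ s) x ∂ν := by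
      refine lintegral_mono fun x => (sum_rpow_crude _ _ hs0).trans ?_
      refine mul_le_mul' le_rfl (Finset.sum_le_sum fun i hi => ?_)
      by_cases hx : x ∈ R i <;> simp [hx, hs0]
    refine ne_top_of_le_ne_top ?_ this
    have hm : ∀ i ∈ I, Measurable ((R i).indicator (fun _ => a i ^ s)) := fun i hi =>
      measurable_const.indicator (hR i hi)
    rw [lintegral_const_mul _ (Finset.measurable_sum _ fun i hi => hm i hi),
      lintegral_finsetSum _ (fun i hi => hm i hi)]
    refine ENNReal.mul_ne_top (ENNReal.rpow_ne_top_of_nonneg hs0.le (by simp)) ?_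
    refine ENNReal.sum_ne_top.2 fun i hi => ?_
    rw [lintegral_indicator_const (hR i hi)]
    exact ENNReal.mul_ne_top (ENNReal.rpow_ne_top_of_nonneg hs0.le (ha i hi)) (htop i hi)
  have hconj : s.HolderConjugate (s / (s - 1)) := (Real.holderConjugate_iff_eq_conjExponent hs1).2 rfl
  set s' := s / (s - 1) with hs'
  have hs1' : 1 < s' := hconj.symm.lt
  have hinv : 1 - 1 / s = 1 / s' := by
    rw [hs']; field_simp
  refine absorb hs0 hYt ?_
  have hpt : ∀ x, Sf x ^ s = ∑ i ∈ I, (R i).indicator (fun x => a i * Sf x ^ (s - 1)) x := by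
    intro x
    have : Sf x ^ s = Sf x * Sf x ^ (s - 1) := by
      nth_rewrite 2 [← ENNReal.rpow_one (Sf x)]
      rw [← ENNReal.rpow_add_of_nonneg _ _ zero_le_one (by linarith)]; congr 1; ring
    rw [this]
    nth_rewrite 1 [hSf]
    rw [Finset.sum_mul]
    refine Finset.sum_congr rfl fun i hi => ?_
    by_cases hx : x ∈ R i <;> simp [hx]
  set G : ι → ℝ≥0∞ := fun i => (∫⁻ x in R i, Sf x ^ (s - 1) ∂ν) / ν (R i) with hG
  calc Y = ∑ i ∈ I, a i * ∫⁻ x in R i, Sf x ^ (s - 1) ∂ν := by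
        rw [hY]; simp_rw [hpt]
        rw [lintegral_finsetSum _ (fun i hi => ((hSfm.pow_const _).const_mul _).indicator (hR i hi))]
        refine Finset.sum_congr rfl fun i hi => ?_
        rw [lintegral_indicator (hR i hi), lintegral_const_mul _ (hSfm.pow_const _)]
    _ = ∑ i ∈ I, a i * ν (R i) * G i := by
        refine Finset.sum_congr rfl fun i hi => ?_
        rw [hG, mul_assoc, ENNReal.mul_div_cancel (h0 i hi) (htop i hi)]
    _ ≤ ∑ i ∈ I, b i * (ν (E i) ^ (1 / s') * G i) := by
        refine Finset.sum_le_sum fun i hi => ?_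
        rw [← mul_assoc, ← hinv]
        exact mul_le_mul' (hab i hi) le_rfl
    _ ≤ (∑ i ∈ I, b i ^ s) ^ (1 / s) * (∑ i ∈ I, (ν (E i) ^ (1 / s') * G i) ^ s') ^ (1 / s') :=
        ENNReal.inner_le_Lp_mul_Lq _ _ _ hconj
    _ ≤ K * (carC s' * Y) ^ (1 / s') := by
        refine mul_le_mul' ?_ (ENNReal.rpow_le_rpow ?_ (by positivity))
        · calc (∑ i ∈ I, b i ^ s) ^ (1 / s) ≤ (K ^ s) ^ (1 / s) :=
                ENNReal.rpow_le_rpow hb (by positivity)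
            _ = K := by rw [← ENNReal.rpow_mul, mul_one_div_cancel hs0.ne', ENNReal.rpow_one]
        · have := carleson ν hs1' I R E hnest hR hE hER hdisj h0 htop (fun x => Sf x ^ (s - 1))
            (hSfm.pow_const _)
          have e2 : (s - 1) * s' = s := by rw [hs']; field_simp [show s - 1 ≠ 0 by linarith]
          simp only [← ENNReal.rpow_mul, e2] at this
          refine le_trans (le_of_eq (Finset.sum_congr rfl fun i hi => ?_)) this
          rw [ENNReal.mul_rpow_of_nonneg _ _ (by positivity), ← ENNReal.rpow_mul,
            one_div_mul_cancel (by positivity), ENNReal.rpow_one, mul_comm]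
    _ = Dq s * K * Y ^ (1 - 1 / s) := by
        rw [Dq, if_neg hs1.ne', hinv, ENNReal.mul_rpow_of_nonneg _ _ (by positivity)]; ring

lemma holder_one {X : Type*} [MeasurableSpace X] (μ : Measure X) {m : ℕ} (e : Fin m → ℝ)
    (he : ∀ j, 0 < e j) {P : ℝ} (hP : 0 < P) (v : Fin m → X → ℝ≥0∞) (W : X → ℝ≥0∞)
    (hv : ∀ j, Measurable (v j)) (hW : Measurable W)
    (h1 : ∀ x, (∏ j, v j x ^ (1 / e j)) * W x ^ (1 / P) = 1) (E : Set X) :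
    μ E ^ (∑ j, 1 / e j + 1 / P) ≤
      (∏ j, (∫⁻ x in E, v j x ∂μ) ^ (1 / e j)) * (∫⁻ x in E, W x ∂μ) ^ (1 / P) := by
  set ρ := ∑ j, 1 / e j + 1 / P with hρ
  have hρ0 : 0 < ρ := by
    have : 0 ≤ ∑ j, 1 / e j := Finset.sum_nonneg fun j _ => (one_div_pos.2 (he j)).le
    have : 0 < 1 / P := by positivity
    linarith
  have key := ENNReal.lintegral_mul_prod_norm_pow_le (μ := μ.restrict E) Finset.univ (g := W)
    (f := v) hW.aemeasurable (fun j _ => (hv j).aemeasurable) (1 / P / ρ)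
    (p := fun j => 1 / e j / ρ) (by rw [← Finset.sum_div, ← add_div, add_comm, div_self hρ0.ne'])
    (by positivity) (fun j _ => div_nonneg (one_div_pos.2 (he j)).le hρ0.le)
  have e1 : ∀ x, W x ^ (1 / P / ρ) * ∏ j, v j x ^ (1 / e j / ρ) = 1 := by
    intro x
    have := congrArg (fun z : ℝ≥0∞ => z ^ (1 / ρ)) (h1 x)
    simp only [ENNReal.one_rpow] at this
    rw [ENNReal.mul_rpow_of_nonneg _ _ (by positivity),
      ← ENNReal.prod_rpow_of_nonneg (by positivity)] at this
    rw [mul_comm, ← this]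
    simp only [← ENNReal.rpow_mul, mul_one_div]
  simp only [e1] at key
  rw [lintegral_one, Measure.restrict_apply_univ] at key
  have := ENNReal.rpow_le_rpow key hρ0.le
  rw [ENNReal.mul_rpow_of_nonneg _ _ hρ0.le, ← ENNReal.prod_rpow_of_nonneg hρ0.le] at this
  simp only [← ENNReal.rpow_mul, div_mul_cancel₀ _ hρ0.ne'] at this
  rwa [mul_comm] at this

/-- single function Carleson part -/
lemma phi_bound {X ι : Type*} [MeasurableSpace X] (μ : Measure X) [SFinite μ]
    (I : Finset ι) (R E : ι → Set X) (hnest : NestedOn I R)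
    (hR : ∀ i ∈ I, MeasurableSet (R i)) (hE : ∀ i ∈ I, MeasurableSet (E i))
    (hER : ∀ i ∈ I, E i ⊆ R i) (hdisj : (I : Set ι).PairwiseDisjoint E)
    {r : ℝ} (hr : 0 < r) {p : ℝ≥0∞} (hrp : ENNReal.ofReal r < p) {e : ℝ} (he : 0 < e)
    (hre : 1 / r = 1 / e + (p⁻¹).toReal)
    (v : X → ℝ≥0∞) (hv : Measurable v) (hv0 : ∀ x, v x ≠ 0) (hvt : ∀ x, v x ≠ ∞)
    (hVt : ∀ i ∈ I, ∫⁻ x in R i, v x ∂μ ≠ ∞) (hV0 : ∀ i ∈ I, ∫⁻ x in R i, v x ∂μ ≠ 0)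
    (F : X → ℝ≥0∞) (hF : Measurable F) (N : ℝ≥0∞)
    (h1 : p ≠ ∞ → ∫⁻ x, (F x * v x ^ (-(1 / e))) ^ p.toReal ∂μ ≤ N ^ p.toReal)
    (h2 : p = ∞ → ∀ᵐ x ∂μ, F x * v x ^ (-(1 / e)) ≤ N) :
    (p ≠ ∞ → ∑ i ∈ I, (((∫⁻ x in R i, F x ^ r ∂μ) / ∫⁻ x in R i, v x ∂μ) ^ (1 / r) *
      (∫⁻ x in E i, v x ∂μ) ^ (p⁻¹).toReal) ^ p.toReal ≤ (Dj r p * N) ^ p.toReal) ∧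
    (p = ∞ → ∀ i ∈ I, ((∫⁻ x in R i, F x ^ r ∂μ) / ∫⁻ x in R i, v x ∂μ) ^ (1 / r) *
      (∫⁻ x in E i, v x ∂μ) ^ (p⁻¹).toReal ≤ Dj r p * N) := by
  constructor
  · intro hp
    have hp0 : 0 < p.toReal := ENNReal.toReal_pos (ne_zero_of_lt hrp) hp
    have hu : 1 < p.toReal / r := by
      rw [one_lt_div hr]
      have := (ENNReal.toReal_lt_toReal (by simp) hp).2 hrp
      rwa [ENNReal.toReal_ofReal hr.le] at this
    have hθ : (p⁻¹).toReal = 1 / p.toReal := by rw [ENNReal.toReal_inv, one_div]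
    set ν := μ.withDensity v with hν
    have hνs : ∀ s, MeasurableSet s → ν s = ∫⁻ x in s, v x ∂μ := fun s hs =>
      withDensity_apply _ hs
    have key := carleson ν hu I R E hnest hR hE hER hdisj
      (fun i hi => by rw [hνs _ (hR i hi)]; exact hV0 i hi)
      (fun i hi => by rw [hνs _ (hR i hi)]; exact hVt i hi)
      (fun x => F x ^ r * (v x)⁻¹) ((hF.pow_const _).mul hv.inv)
    have hhm : Measurable (fun x => F x ^ r * (v x)⁻¹) := (hF.pow_const _).mul hv.inv
    have e1 : ∀ i ∈ I, ∫⁻ x in R i, F x ^ r * (v x)⁻¹ ∂ν = ∫⁻ x in R i, F x ^ r ∂μ := by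
      intro i hi
      rw [hν, setLIntegral_withDensity_eq_setLIntegral_mul _ hv hhm (hR i hi)]
      refine lintegral_congr fun x => ?_
      simp only [Pi.mul_apply]
      rw [mul_comm, mul_assoc, ENNReal.inv_mul_cancel (hv0 x) (hvt x), mul_one]
    have e2 : ∫⁻ x, (F x ^ r * (v x)⁻¹) ^ (p.toReal / r) ∂ν =
        ∫⁻ x, (F x * v x ^ (-(1 / e))) ^ p.toReal ∂μ := by
      rw [hν, lintegral_withDensity_eq_lintegral_mul _ hv (hhm.pow_const _)]
      refine lintegral_congr fun x => ?_
      simp only [Pi.mul_apply]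
      rw [ENNReal.mul_rpow_of_nonneg _ _ (by positivity), ENNReal.mul_rpow_of_nonneg _ _ hp0.le,
        ← ENNReal.rpow_mul, ← ENNReal.rpow_mul, mul_div_cancel₀ _ hr.ne', mul_comm, mul_assoc]
      congr 1
      rw [← ENNReal.rpow_neg_one, ← ENNReal.rpow_mul]
      nth_rewrite 2 [← ENNReal.rpow_one (v x)]
      rw [← ENNReal.rpow_add _ _ (hv0 x) (hvt x)]
      congr 1
      have : 1 / e = 1 / r - 1 / p.toReal := by rw [hre, hθ]; ring
      rw [this]; field_simp; ring
    rw [e2] at key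
    calc _ = ∑ i ∈ I, ((∫⁻ x in R i, F x ^ r * (v x)⁻¹ ∂ν) / ν (R i)) ^ (p.toReal / r) * ν (E i) := by
          refine Finset.sum_congr rfl fun i hi => ?_
          rw [e1 i hi, hνs _ (hR i hi), hνs _ (hE i hi), ENNReal.mul_rpow_of_nonneg _ _ hp0.le,
            ← ENNReal.rpow_mul, ← ENNReal.rpow_mul, hθ, one_div_mul_cancel hp0.ne', ENNReal.rpow_one,
            one_div_mul_eq_div]
      _ ≤ carC (p.toReal / r) * N ^ p.toReal := key.trans (mul_le_mul' le_rfl (h1 hp))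
      _ = (Dj r p * N) ^ p.toReal := by
          rw [Dj, if_neg hp, ENNReal.mul_rpow_of_nonneg _ _ hp0.le, ← ENNReal.rpow_mul,
            one_div_mul_cancel hp0.ne', ENNReal.rpow_one]
  · intro hp i hi
    subst hp
    simp only [ENNReal.inv_top, ENNReal.toReal_zero, ENNReal.rpow_zero, mul_one, add_zero] at *
    simp only [Dj, if_true, one_mul]
    have er : e = r := by
      have := hre; field_simp at this; linarith
    subst er
    have h3 : ∫⁻ x in R i, F x ^ e ∂μ ≤ N ^ e * ∫⁻ x in R i, v x ∂μ := by
      rw [← lintegral_const_mul _ hv]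
      refine lintegral_mono_ae (ae_restrict_of_ae ?_)
      filter_upwards [h2 trivial] with x hx
      have := ENNReal.rpow_le_rpow hx hr.le
      rw [ENNReal.mul_rpow_of_nonneg _ _ hr.le, ← ENNReal.rpow_mul, neg_mul,
        one_div_mul_cancel hr.ne', ENNReal.rpow_neg_one, ← div_eq_mul_inv] at this
      rwa [ENNReal.div_le_iff (hv0 x) (hvt x)] at this
    calc _ ≤ (N ^ e) ^ (1 / e) := by
          refine ENNReal.rpow_le_rpow ?_ (by positivity)
          rw [ENNReal.div_le_iff (hV0 i hi) (hVt i hi)]; exact h3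
      _ = N := by rw [← ENNReal.rpow_mul, mul_one_div_cancel hr.ne', ENNReal.rpow_one]

theorem scalar_sparse {X ι : Type*} [MeasurableSpace X] (μ : Measure X) [SFinite μ]
    {m : ℕ} (r : Fin m → ℝ) (p : Fin m → ℝ≥0∞) (hr : ∀ j, 0 < r j)
    (hrp : ∀ j, ENNReal.ofReal (r j) < p j) {P q γ : ℝ} (hP : 0 < P) (hq : 0 < q) (hqP : q ≤ P)
    (hPp : ∑ j, ((p j)⁻¹).toReal = 1 / P)
    (hγ1 : ∀ j, expE r p j / r j ≤ γ) (hγ2 : P / q ≤ γ)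
    (I : Finset ι) (R E : ι → Set X) (hnest : NestedOn I R)
    (hR : ∀ i ∈ I, MeasurableSet (R i)) (hE : ∀ i ∈ I, MeasurableSet (E i))
    (hER : ∀ i ∈ I, E i ⊆ R i) (hdisj : (I : Set ι).PairwiseDisjoint E)
    (h0 : ∀ i ∈ I, μ (R i) ≠ 0) (htop : ∀ i ∈ I, μ (R i) ≠ ∞)
    {Λ : ℝ≥0∞} (hΛ : Λ ≠ ∞) (hRE : ∀ i ∈ I, μ (R i) ≤ Λ * μ (E i))
    (v : Fin m → X → ℝ≥0∞) (hv : ∀ j, Measurable (v j)) (hv0 : ∀ j x, v j x ≠ 0)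
    (hvt : ∀ j x, v j x ≠ ∞) (hVt : ∀ j, ∀ i ∈ I, ∫⁻ x in R i, v j x ∂μ ≠ ∞)
    (W : X → ℝ≥0∞) (hW : Measurable W) (hW0 : ∀ x, W x ≠ 0)
    (hWt : ∀ i ∈ I, ∫⁻ x in R i, W x ∂μ ≠ ∞)
    (hvW : ∀ x, (∏ j, v j x ^ (1 / expE r p j)) * W x ^ (1 / P) = 1)
    {A : ℝ≥0∞} (hAt : A ≠ ∞)
    (hA : ∀ i ∈ I, (∏ j, ((∫⁻ x in R i, v j x ∂μ) / μ (R i)) ^ (1 / expE r p j)) *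
      ((∫⁻ x in R i, W x ∂μ) / μ (R i)) ^ (1 / P) ≤ A)
    (F : Fin m → X → ℝ≥0∞) (hF : ∀ j, Measurable (F j)) (N : Fin m → ℝ≥0∞) (hN : ∀ j, N j ≠ ∞)
    (h1 : ∀ j, p j ≠ ∞ → ∫⁻ x, (F j x * v j x ^ (-(1 / expE r p j))) ^ (p j).toReal ∂μ ≤
      N j ^ (p j).toReal)
    (h2 : ∀ j, p j = ∞ → ∀ᵐ x ∂μ, F j x * v j x ^ (-(1 / expE r p j)) ≤ N j) :
    ∫⁻ x, (∑ i ∈ I, (R i).indicator (fun _ => ∏ j, avgS μ (r j) (F j) (R i) ^ q) x) ^ (P / q) * W x ∂μ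
      ≤ (sC r p P q γ Λ * A ^ γ * ∏ j, N j) ^ P := by
  set e := expE r p with he_def
  have he : ∀ j, 0 < e j := expE_pos r p hr hrp
  have hre : ∀ j, 1 / r j = 1 / e j + ((p j)⁻¹).toReal := expE_eq r p
  set θ : Fin m → ℝ := fun j => ((p j)⁻¹).toReal with hθ
  have hE0 : ∀ i ∈ I, μ (E i) ≠ 0 := fun i hi h => h0 i hi (by simpa [h] using hRE i hi)
  have pos : ∀ (g : X → ℝ≥0∞), Measurable g → (∀ x, g x ≠ 0) → ∀ i ∈ I,
      ∫⁻ x in E i, g x ∂μ ≠ 0 := by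
    intro g hg hg0 i hi h
    rw [lintegral_eq_zero_iff hg] at h
    have : (μ.restrict (E i)) Set.univ = 0 := by
      have h' : ∀ᵐ x ∂(μ.restrict (E i)), False := by
        filter_upwards [h] with x hx; exact hg0 x hx
      simpa [ae_iff] using h'
    rw [Measure.restrict_apply_univ] at this
    exact hE0 i hi this
  have mono : ∀ (g : X → ℝ≥0∞), ∀ i ∈ I, ∫⁻ x in E i, g x ∂μ ≤ ∫⁻ x in R i, g x ∂μ :=
    fun g i hi => lintegral_mono_set (hER i hi)
  have posR : ∀ (g : X → ℝ≥0∞), Measurable g → (∀ x, g x ≠ 0) → ∀ i ∈ I,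
      ∫⁻ x in R i, g x ∂μ ≠ 0 := fun g hg hg0 i hi h =>
    pos g hg hg0 i hi (le_antisymm (h ▸ mono g i hi) zero_le)
  set c : Fin m → ι → ℝ≥0∞ := fun j i =>
    (∫⁻ x in R i, F j x ^ r j ∂μ) / ∫⁻ x in R i, v j x ∂μ with hc
  set φ : Fin m → ι → ℝ≥0∞ := fun j i =>
    c j i ^ (1 / r j) * (∫⁻ x in E i, v j x ∂μ) ^ θ j with hφ
  have hφb := fun j => phi_bound μ I R E hnest hR hE hER hdisj (hr j) (hrp j) (he j) (hre j) (v j)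
    (hv j) (hv0 j) (hvt j) (hVt j) (posR _ (hv j) (hv0 j)) (F j) (hF j) (N j) (h1 j) (h2 j)
  have hDN : ∀ j, Dj (r j) (p j) * N j ≠ ∞ := fun j =>
    ENNReal.mul_ne_top (Dj_ne_top r p hr hrp j) (hN j)
  have hp0 : ∀ j, p j ≠ 0 := fun j => ne_zero_of_lt (hrp j)
  have hφt : ∀ j, ∀ i ∈ I, φ j i ≠ ∞ := by
    intro j i hi
    by_cases hp : p j = ∞
    · exact ne_top_of_le_ne_top (hDN j) ((hφb j).2 hp i hi)
    · have hp0 : 0 < (p j).toReal := ENNReal.toReal_pos (hp0 j) hp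
      have h3 : φ j i ^ (p j).toReal ≠ ∞ := by
        refine ne_top_of_le_ne_top (ENNReal.rpow_ne_top_of_nonneg hp0.le (hDN j)) ?_
        exact le_trans (Finset.single_le_sum (f := fun i => φ j i ^ (p j).toReal)
          (fun _ _ => zero_le) hi) ((hφb j).1 hp)
      intro h; rw [h, ENNReal.top_rpow_of_pos hp0] at h3; exact h3 rfl
  have hθ0 : ∀ j, 0 ≤ θ j := fun j => ENNReal.toReal_nonneg
  have hct : ∀ j, ∀ i ∈ I, c j i ≠ ∞ := by
    intro j i hi h
    apply hφt j i hi
    simp only [hφ, h]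
    rw [ENNReal.top_rpow_of_pos (one_div_pos.2 (hr j)), ENNReal.top_mul]
    simp [ENNReal.rpow_eq_zero_iff, pos _ (hv j) (hv0 j) i hi, not_lt.2 (hθ0 j)]
  have havg : ∀ j, ∀ i ∈ I, avgS μ (r j) (F j) (R i) ^ q =
      c j i ^ (q / r j) * ((∫⁻ x in R i, v j x ∂μ) / μ (R i)) ^ (q / r j) := by
    intro j i hi
    have hqr : 0 < q / r j := div_pos hq (hr j)
    rw [avgS, ← ENNReal.rpow_mul, one_div_mul_eq_div, ← ENNReal.mul_rpow_of_nonneg _ _ hqr.le, hc]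
    congr 1
    dsimp only
    rw [← mul_div_assoc, ENNReal.div_mul_cancel (posR _ (hv j) (hv0 j) i hi) (hVt j i hi)]
  set κ : ℝ≥0∞ := Λ ^ (q * (γ - 1) * ∑ j, 1 / r j) * A ^ (γ * q) with hκ
  have hρ : ∑ j, 1 / r j = ∑ j, 1 / e j + 1 / P := by
    rw [← hPp, ← Finset.sum_add_distrib]; exact Finset.sum_congr rfl fun j _ => hre j
  set ω := μ.withDensity W with hω
  have hωs : ∀ s, MeasurableSet s → ω s = ∫⁻ x in s, W x ∂μ := fun s hs => withDensity_apply _ hs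
  set a : ι → ℝ≥0∞ := fun i => ∏ j, avgS μ (r j) (F j) (R i) ^ q with ha
  have hat : ∀ i ∈ I, a i ≠ ∞ := by
    intro i hi
    refine ENNReal.prod_ne_top fun j _ => ?_
    have hqr : 0 < q / r j := div_pos hq (hr j)
    rw [havg j i hi]
    exact ENNReal.mul_ne_top (ENNReal.rpow_ne_top_of_nonneg hqr.le (hct j i hi))
      (ENNReal.rpow_ne_top_of_nonneg hqr.le (ENNReal.div_ne_top (hVt j i hi) (h0 i hi)))
  have hab : ∀ i ∈ I, a i * ω (R i) ≤ (κ * ∏ j, φ j i ^ q) * ω (E i) ^ (1 - 1 / (P / q)) := by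
    intro i hi
    rw [hωs _ (hR i hi), hωs _ (hE i hi), one_div_div]
    have nb := numeric_bound r e θ hr he hre hP hq hqP hPp hγ1 hγ2
      (fun j => ∫⁻ x in R i, v j x ∂μ) (fun j => ∫⁻ x in E i, v j x ∂μ) (∫⁻ x in R i, W x ∂μ)
      (∫⁻ x in E i, W x ∂μ) (μ (R i)) (μ (E i)) A Λ (fun j => pos _ (hv j) (hv0 j) i hi)
      (fun j => hVt j i hi) (fun j => mono _ i hi) (pos _ hW hW0 i hi) (hWt i hi) (mono _ i hi)
      (h0 i hi) (htop i hi) (ne_top_of_le_ne_top (htop i hi) (measure_mono (hER i hi))) hAt hΛ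
      (hRE i hi) (hA i hi) (by rw [hρ]; exact holder_one μ e he hP v W hv hW hvW (E i))
    have e1 : a i = (∏ j, c j i ^ (q / r j)) *
        ∏ j, ((∫⁻ x in R i, v j x ∂μ) / μ (R i)) ^ (q / r j) := by
      rw [← Finset.prod_mul_distrib]
      exact Finset.prod_congr rfl fun j _ => havg j i hi
    have e2 : ∏ j, φ j i ^ q = (∏ j, c j i ^ (q / r j)) *
        ∏ j, (∫⁻ x in E i, v j x ∂μ) ^ (q * θ j) := by
      rw [← Finset.prod_mul_distrib]
      refine Finset.prod_congr rfl fun j _ => ?_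
      rw [hφ, ENNReal.mul_rpow_of_nonneg _ _ hq.le, ← ENNReal.rpow_mul, ← ENNReal.rpow_mul,
        one_div_mul_eq_div, mul_comm q]
    rw [e1, e2, mul_assoc]
    refine (mul_le_mul' le_rfl nb).trans (le_of_eq ?_)
    rw [hκ]; ring
  have hs1 : 1 ≤ P / q := (one_le_div hq).2 hqP
  have hb : ∑ i ∈ I, (κ * ∏ j, φ j i ^ q) ^ (P / q) ≤
      (κ * ∏ j, (Dj (r j) (p j) * N j) ^ q) ^ (P / q) := by
    have hPq : 0 ≤ P / q := by positivity
    have e3 : ∀ ψ : Fin m → ℝ≥0∞, (κ * ∏ j, ψ j ^ q) ^ (P / q) = κ ^ (P / q) * ∏ j, ψ j ^ P := by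
      intro ψ
      rw [ENNReal.mul_rpow_of_nonneg _ _ hPq, ← ENNReal.prod_rpow_of_nonneg hPq]
      simp only [← ENNReal.rpow_mul, mul_div_cancel₀ _ hq.ne']
    rw [e3]
    simp_rw [e3]
    rw [← Finset.mul_sum]
    refine mul_le_mul' le_rfl ?_
    exact holder_bound_finset I p hp0 P hP (by rw [hPp, one_div]) φ _ (fun j => (hφb j).1)
      (fun j => (hφb j).2)
  have fin := sparse_dual ω hs1 I R E hnest hR hE hER hdisj
    (fun i hi => by rw [hωs _ (hR i hi)]; exact posR _ hW hW0 i hi)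
    (fun i hi => by rw [hωs _ (hR i hi)]; exact hWt i hi) a _ hat _ hab hb
  have hm : Measurable fun x => (∑ i ∈ I, (R i).indicator (fun _ => a i) x) ^ (P / q) :=
    (Finset.measurable_sum _ fun i hi => measurable_const.indicator (hR i hi)).pow_const _
  rw [hω, lintegral_withDensity_eq_lintegral_mul _ hW hm] at fin
  calc _ = ∫⁻ x, (W * fun x => (∑ i ∈ I, (R i).indicator (fun _ => a i) x) ^ (P / q)) x ∂μ := by
        refine lintegral_congr fun x => ?_
        rw [Pi.mul_apply, mul_comm]
    _ ≤ _ := fin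
    _ = _ := by
        have : (Dq (P / q) * (κ * ∏ j, (Dj (r j) (p j) * N j) ^ q)) =
            (sC r p P q γ Λ * A ^ γ * ∏ j, N j) ^ q := by
          have e4 : ∀ x : ℝ≥0∞, (x ^ (1 / q)) ^ q = x := fun x => by
            rw [← ENNReal.rpow_mul, one_div_mul_cancel hq.ne', ENNReal.rpow_one]
          rw [sC, hκ]
          simp only [ENNReal.mul_rpow_of_nonneg _ _ hq.le, e4, ← ENNReal.prod_rpow_of_nonneg hq.le]
          rw [← ENNReal.rpow_mul A, Finset.prod_mul_distrib]
          ring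
        rw [this, ← ENNReal.rpow_mul, mul_div_cancel₀ _ hq.ne']

open Classical in
/-- the members of `GG` inside `Q` containing `x` -/
def fam {X : Type*} (GG : Finset (Set X)) (Q : Set X) (x : X) : Finset (Set X) :=
  GG.filter (fun Q' => Q' ⊆ Q ∧ x ∈ Q')

lemma mem_fam {X : Type*} {GG : Finset (Set X)} {Q Q' : Set X} {x : X} :
    Q' ∈ fam GG Q x ↔ Q' ∈ GG ∧ Q' ⊆ Q ∧ x ∈ Q' := by
  simp [fam]

def stopE {X : Type*} (GG : Finset (Set X)) (n : Finset (Set X) → ℝ≥0∞) (A : Set X → ℝ≥0∞)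
    (Q : Set X) : Set X := {x | x ∈ Q ∧ n (fam GG Q x) ≤ A Q}

open Classical in
lemma exists_max_elt {X : Type*} (Pf : Finset (Set X)) {Q : Set X} (hQ : Q ∈ Pf) :
    ∃ Q1 ∈ Pf.filter (fun Q1 => ∀ Q' ∈ Pf, Q1 ⊆ Q' → Q' = Q1), Q ⊆ Q1 := by
  obtain ⟨Q1, hQ1, hmax⟩ := (Pf.filter (fun Q' => Q ⊆ Q')).exists_maximal ⟨Q, by simp [hQ]⟩
  simp only [Finset.mem_filter] at hQ1 hmax
  refine ⟨Q1, ?_, hQ1.2⟩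
  simp only [Finset.mem_filter]
  refine ⟨hQ1.1, fun Q' hQ' h => ?_⟩
  exact Set.Subset.antisymm (hmax ⟨hQ', hQ1.2.trans h⟩ h) h

open Classical in
lemma stop_union {X : Type*} (A : Set X → ℝ≥0∞) (E : Set X → Set X) (hE : ∀ Q, E Q ⊆ Q)
    (GG Pf : Finset (Set X)) (hdisj : ∀ Q ∈ Pf, ∀ Q' ∈ Pf, Q ≠ Q' → Disjoint Q Q')
    (f : Set X → X → ℝ≥0∞)
    (h : ∀ Q0 ∈ Pf, ∃ S ⊆ GG, (∀ Q ∈ S, Q ⊆ Q0) ∧ (S : Set (Set X)).PairwiseDisjoint E ∧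
      ∀ x ∈ Q0, f Q0 x ≤ ∑ Q ∈ S, Q.indicator (fun _ => A Q) x) :
    ∃ S ⊆ GG, (∀ Q ∈ S, ∃ Q0 ∈ Pf, Q ⊆ Q0) ∧ (S : Set (Set X)).PairwiseDisjoint E ∧
      ∀ Q0 ∈ Pf, ∀ x ∈ Q0, f Q0 x ≤ ∑ Q ∈ S, Q.indicator (fun _ => A Q) x := by
  choose! S hS1 hS2 hS3 hS4 using h
  refine ⟨Pf.biUnion S, ?_, ?_, ?_, ?_⟩
  · intro Q hQ
    obtain ⟨Q0, h0, h1⟩ := Finset.mem_biUnion.1 hQ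
    exact hS1 Q0 h0 h1
  · intro Q hQ
    obtain ⟨Q0, h0, h1⟩ := Finset.mem_biUnion.1 hQ
    exact ⟨Q0, h0, hS2 Q0 h0 Q h1⟩
  · intro Q hQ Q' hQ' hne
    obtain ⟨Q0, h0, h1⟩ := Finset.mem_biUnion.1 (Finset.mem_coe.1 hQ)
    obtain ⟨Q0', h0', h1'⟩ := Finset.mem_biUnion.1 (Finset.mem_coe.1 hQ')
    by_cases heq : Q0 = Q0'
    · subst heq
      exact hS3 Q0 h0 h1 h1' hne
    · exact (hdisj Q0 h0 Q0' h0' heq).mono ((hE Q).trans (hS2 Q0 h0 Q h1))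
        ((hE Q').trans (hS2 Q0' h0' Q' h1'))
  · intro Q0 h0 x hx
    exact (hS4 Q0 h0 x hx).trans (Finset.sum_le_sum_of_subset (Finset.subset_biUnion_of_mem S h0))

lemma n_chain {X : Type*} (GG : Finset (Set X))
    (hnest : ∀ Q ∈ GG, ∀ Q' ∈ GG, Q ⊆ Q' ∨ Q' ⊆ Q ∨ Disjoint Q Q')
    (n : Finset (Set X) → ℝ≥0∞) (hn0 : n ∅ = 0) (a : ℝ≥0∞) (x : X) (J : Finset (Set X))
    (hJ : J ⊆ GG) (hx : ∀ Q ∈ J, x ∈ Q)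
    (h : ∀ Q ∈ J, (∀ Q' ∈ J, Q ⊆ Q') → n J ≤ a) : n J ≤ a := by
  rcases J.eq_empty_or_nonempty with rfl | hne
  · rw [hn0]; exact zero_le
  obtain ⟨Q2, h2, hmin⟩ := J.exists_minimal hne
  refine h Q2 h2 fun Q' hQ' => ?_
  rcases hnest Q2 (hJ h2) Q' (hJ hQ') with h3 | h3 | h3
  · exact h3
  · exact hmin hQ' h3
  · exact absurd (hx Q' hQ') (Set.disjoint_left.1 h3 (hx Q2 h2))

open Classical in
lemma stop_local {X : Type*} (GG : Finset (Set X))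
    (hnest : ∀ Q ∈ GG, ∀ Q' ∈ GG, Q ⊆ Q' ∨ Q' ⊆ Q ∨ Disjoint Q Q')
    (n : Finset (Set X) → ℝ≥0∞) (hmono : ∀ J J', J ⊆ J' → n J ≤ n J')
    (hsub : ∀ J J', n (J ∪ J') ≤ n J + n J') (hn0 : n ∅ = 0) (A : Set X → ℝ≥0∞)
    (hne : ∀ Q ∈ GG, (stopE GG n A Q).Nonempty) (N : ℕ) :
    ∀ Q0 ∈ GG, (GG.filter (fun Q => Q ⊆ Q0)).card ≤ N →
      ∃ S ⊆ GG, (∀ Q ∈ S, Q ⊆ Q0) ∧ (S : Set (Set X)).PairwiseDisjoint (stopE GG n A) ∧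
        ∀ x ∈ Q0, n (fam GG Q0 x) ≤ ∑ Q ∈ S, Q.indicator (fun _ => A Q) x := by
  induction N with
  | zero =>
    intro Q0 hQ0 hc
    simp only [nonpos_iff_eq_zero, Finset.card_eq_zero, Finset.filter_eq_empty_iff] at hc
    exact absurd subset_rfl (hc hQ0)
  | succ N ih =>
    intro Q0 hQ0 hc
    set anc : Set X → Finset (Set X) := fun Q => GG.filter (fun Q' => Q ⊆ Q' ∧ Q' ⊆ Q0) with hanc
    set Pf0 := GG.filter (fun Q => Q ⊆ Q0 ∧ A Q0 < n (anc Q)) with hPf0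
    set Pf := Pf0.filter (fun Q1 => ∀ Q' ∈ Pf0, Q1 ⊆ Q' → Q' = Q1) with hPf
    have hEsub : ∀ Q, stopE GG n A Q ⊆ Q := fun Q x hx => hx.1
    have h1 : ∀ Q ∈ Pf0, Disjoint (stopE GG n A Q0) Q := by
      intro Q hQ
      simp only [hPf0, Finset.mem_filter] at hQ
      rw [Set.disjoint_left]
      intro x hx hxQ
      refine absurd hx.2 (not_le.2 (hQ.2.2.trans_le (hmono _ _ ?_)))
      intro Q' hQ'
      simp only [hanc, Finset.mem_filter] at hQ'
      exact mem_fam.2 ⟨hQ'.1, hQ'.2.2, hQ'.2.1 hxQ⟩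
    have h2 : ∀ Q ∈ Pf0, Q ≠ Q0 := by
      rintro Q hQ rfl
      obtain ⟨x, hx⟩ := hne Q hQ0
      exact Set.disjoint_left.1 (h1 Q hQ) hx hx.1
    have hPfsub : ∀ Q ∈ Pf, Q ∈ Pf0 := fun Q hQ => (Finset.mem_filter.1 hQ).1
    have hP0 : ∀ Q ∈ Pf0, Q ∈ GG ∧ Q ⊆ Q0 := fun Q hQ =>
      ⟨(Finset.mem_filter.1 hQ).1, (Finset.mem_filter.1 hQ).2.1⟩
    have hdisj : ∀ Q ∈ Pf, ∀ Q' ∈ Pf, Q ≠ Q' → Disjoint Q Q' := by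
      intro Q hQ Q' hQ' hne'
      rcases hnest Q (hP0 Q (hPfsub Q hQ)).1 Q' (hP0 Q' (hPfsub Q' hQ')).1 with h3 | h3 | h3
      · exact absurd ((Finset.mem_filter.1 hQ).2 Q' (hPfsub Q' hQ') h3).symm hne'
      · exact absurd ((Finset.mem_filter.1 hQ').2 Q (hPfsub Q hQ) h3) hne'
      · exact h3
    obtain ⟨S, hS1, hS2, hS3, hS4⟩ := stop_union A (stopE GG n A) hEsub GG Pf hdisj
      (fun Q x => n (fam GG Q x)) (fun Q hQ => by
        refine ih Q (hP0 Q (hPfsub Q hQ)).1 ?_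
        refine Nat.le_of_lt_succ (lt_of_lt_of_le (Finset.card_lt_card ?_) hc)
        refine (Finset.ssubset_iff_of_subset ?_).2 ⟨Q0, by simp [hQ0], ?_⟩
        · intro Q' hQ'
          simp only [Finset.mem_filter] at hQ' ⊢
          exact ⟨hQ'.1, hQ'.2.trans (hP0 Q (hPfsub Q hQ)).2⟩
        · simp only [Finset.mem_filter, not_and]
          intro _ h
          exact h2 Q (hPfsub Q hQ) (Set.Subset.antisymm (hP0 Q (hPfsub Q hQ)).2 h))
    have hQ0S : Q0 ∉ S := by
      intro h
      obtain ⟨Q1, hQ1, h3⟩ := hS2 Q0 h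
      exact h2 Q1 (hPfsub Q1 hQ1) (Set.Subset.antisymm (hP0 Q1 (hPfsub Q1 hQ1)).2 h3)
    have hSE : ∀ Q ∈ S, Disjoint (stopE GG n A Q0) (stopE GG n A Q) := by
      intro Q hQ
      obtain ⟨Q1, hQ1, h3⟩ := hS2 Q hQ
      exact (h1 Q1 (hPfsub Q1 hQ1)).mono_right ((hEsub Q).trans h3)
    -- bound of n on the ancestors
    have hnA : ∀ x ∈ Q0, ∀ J ⊆ fam GG Q0 x, (∀ Q ∈ J, Q ∉ Pf0) → n J ≤ A Q0 := by
      intro x hx J hJ hJ0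
      refine n_chain GG hnest n hn0 (A Q0) x J (fun Q hQ => (mem_fam.1 (hJ hQ)).1)
        (fun Q hQ => (mem_fam.1 (hJ hQ)).2.2) fun Q hQ hmin => ?_
      have h3 := hJ0 Q hQ
      have h4 := mem_fam.1 (hJ hQ)
      simp only [hPf0, Finset.mem_filter, not_and, not_lt] at h3
      refine (hmono _ _ ?_).trans (h3 h4.1 h4.2.1)
      intro Q' hQ'
      have h5 := mem_fam.1 (hJ hQ')
      simp only [hanc, Finset.mem_filter]
      exact ⟨h5.1, hmin Q' hQ', h5.2.1⟩
    refine ⟨insert Q0 S, ?_, ?_, ?_, ?_⟩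
    · exact Finset.insert_subset hQ0 hS1
    · intro Q hQ
      rcases Finset.mem_insert.1 hQ with rfl | hQ
      · exact subset_rfl
      · obtain ⟨Q1, hQ1, h3⟩ := hS2 Q hQ
        exact h3.trans (hP0 Q1 (hPfsub Q1 hQ1)).2
    · rw [Finset.coe_insert, Set.pairwiseDisjoint_insert_of_notMem (by simpa using hQ0S)]
      exact ⟨hS3, fun Q hQ => hSE Q hQ⟩
    · intro x hx
      rw [Finset.sum_insert hQ0S, Set.indicator_of_mem hx]
      by_cases hcase : ∃ Q1 ∈ Pf, x ∈ Q1
      · obtain ⟨Q1, hQ1, hxQ1⟩ := hcase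
        have hQ10 := hPfsub Q1 hQ1
        refine le_trans (hmono _ ((fam GG Q0 x).filter (fun Q => ¬ Q ⊆ Q1) ∪ fam GG Q1 x) ?_)
          ((hsub _ _).trans (add_le_add ?_ (hS4 Q1 hQ1 x hxQ1)))
        · intro Q hQ
          have h5 := mem_fam.1 hQ
          by_cases h6 : Q ⊆ Q1
          · exact Finset.mem_union_right _ (mem_fam.2 ⟨h5.1, h6, h5.2.2⟩)
          · exact Finset.mem_union_left _ (Finset.mem_filter.2 ⟨hQ, h6⟩)
        · refine hnA x hx _ (Finset.filter_subset _ _) fun Q hQ hQ0 => ?_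
          have h5 := mem_fam.1 (Finset.mem_filter.1 hQ).1
          rcases hnest Q h5.1 Q1 (hP0 Q1 hQ10).1 with h6 | h6 | h6
          · exact (Finset.mem_filter.1 hQ).2 h6
          · have := (Finset.mem_filter.1 hQ1).2 Q hQ0 h6
            exact (Finset.mem_filter.1 hQ).2 (this ▸ subset_rfl)
          · exact Set.disjoint_left.1 h6 h5.2.2 hxQ1
      · refine le_trans (hnA x hx _ subset_rfl fun Q hQ hQ0 => ?_) le_self_add
        obtain ⟨Q1, hQ1, h3⟩ := exists_max_elt Pf0 hQ0
        exact hcase ⟨Q1, hQ1, h3 (mem_fam.1 hQ).2.2⟩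

open Classical in
theorem stopping {X : Type*} (GG : Finset (Set X))
    (hnest : ∀ Q ∈ GG, ∀ Q' ∈ GG, Q ⊆ Q' ∨ Q' ⊆ Q ∨ Disjoint Q Q')
    (n : Finset (Set X) → ℝ≥0∞) (hmono : ∀ J J', J ⊆ J' → n J ≤ n J')
    (hsub : ∀ J J', n (J ∪ J') ≤ n J + n J') (hn0 : n ∅ = 0) (A : Set X → ℝ≥0∞)
    (hne : ∀ Q ∈ GG, (stopE GG n A Q).Nonempty) :
    ∃ S ⊆ GG, (S : Set (Set X)).PairwiseDisjoint (stopE GG n A) ∧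
        ∀ x, n (fam GG Set.univ x) ≤ ∑ Q ∈ S, Q.indicator (fun _ => A Q) x := by
  set Pf := GG.filter (fun Q1 => ∀ Q' ∈ GG, Q1 ⊆ Q' → Q' = Q1) with hPf
  have hsubP : ∀ Q ∈ Pf, Q ∈ GG := fun Q hQ => (Finset.mem_filter.1 hQ).1
  obtain ⟨S, hS1, hS2, hS3, hS4⟩ := stop_union A (stopE GG n A) (fun Q x hx => hx.1) GG Pf
    (by
      intro Q hQ Q' hQ' hne'
      rcases hnest Q (hsubP Q hQ) Q' (hsubP Q' hQ') with h3 | h3 | h3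
      · exact absurd ((Finset.mem_filter.1 hQ).2 Q' (hsubP Q' hQ') h3).symm hne'
      · exact absurd ((Finset.mem_filter.1 hQ').2 Q (hsubP Q hQ) h3) hne'
      · exact h3)
    (fun Q x => n (fam GG Q x))
    (fun Q hQ => stop_local GG hnest n hmono hsub hn0 A hne _ Q (hsubP Q hQ) le_rfl)
  refine ⟨S, hS1, hS3, fun x => ?_⟩
  rcases (fam GG Set.univ x).eq_empty_or_nonempty with h | ⟨Q, hQ⟩
  · rw [h, hn0]; exact zero_le
  have hQ' := mem_fam.1 hQ
  obtain ⟨Q1, hQ1, h3⟩ := exists_max_elt GG hQ'.1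
  refine le_trans (hmono _ _ ?_) (hS4 Q1 hQ1 x (h3 hQ'.2.2))
  intro Q2 hQ2
  have h4 := mem_fam.1 hQ2
  refine mem_fam.2 ⟨h4.1, ?_, h4.2.2⟩
  rcases hnest Q2 h4.1 Q1 (hsubP Q1 hQ1) with h6 | h6 | h6
  · exact h6
  · exact ((Finset.mem_filter.1 hQ1).2 Q2 h4.1 h6) ▸ subset_rfl
  · exact absurd (h3 hQ'.2.2) (Set.disjoint_left.1 h6 h4.2.2)

structure Grid {X : Type*} [MeasurableSpace X] (μ : Measure X) where
  C : ℤ → X → Set X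
  mem : ∀ n x, x ∈ C n x
  eq_of_mem : ∀ {n x y}, y ∈ C n x → C n y = C n x
  mono1 : ∀ n x, C (n + 1) x ⊆ C n x
  meas : ∀ n x, MeasurableSet (C n x)
  pos : ∀ n x, μ (C n x) ≠ 0
  fin : ∀ n x, μ (C n x) ≠ ∞
  D : ℝ≥0∞
  D_ne : D ≠ ∞
  doubling : ∀ n x, μ (C n x) ≤ D * μ (C (n + 1) x)
  ctb : ∀ n, (Set.range (C n)).Countable

namespace Grid
lemma mono {X : Type*} [MeasurableSpace X] {μ : Measure X} (G : Grid μ) {n n' : ℤ} (h : n ≤ n')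
    (x : X) : G.C n' x ⊆ G.C n x := by
  obtain ⟨l, rfl⟩ := Int.le.dest h
  induction l with
  | zero => simp
  | succ l ih =>
    have h2 := ih (by omega)
    have h3 := G.mono1 (n + l) x
    rw [show n + ((l + 1 : ℕ) : ℤ) = n + l + 1 by push_cast; ring]
    exact h3.trans h2

lemma eq_of_mem' {X : Type*} [MeasurableSpace X] {μ : Measure X} (G : Grid μ) {n n' : ℤ}
    (h : n ≤ n') {x y : X} (hy : y ∈ G.C n' x) : G.C n y = G.C n x :=
  G.eq_of_mem (G.mono h x hy)

lemma nest {X : Type*} [MeasurableSpace X] {μ : Measure X} (G : Grid μ) (n n' : ℤ) (x y : X) :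
    G.C n x ⊆ G.C n' y ∨ G.C n' y ⊆ G.C n x ∨ Disjoint (G.C n x) (G.C n' y) := by
  have key : ∀ (n n' : ℤ) (x y : X), n ≤ n' → G.C n' y ⊆ G.C n x ∨ Disjoint (G.C n x) (G.C n' y) := by
    intro n n' x y h
    by_cases hd : Disjoint (G.C n x) (G.C n' y)
    · exact Or.inr hd
    · left
      obtain ⟨z, hz1, hz2⟩ := Set.not_disjoint_iff.1 hd
      rw [← G.eq_of_mem hz2, ← G.eq_of_mem hz1]
      exact G.mono h z
  rcases le_total n n' with h | h
  · exact Or.inr (key n n' x y h)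
  · rcases key n' n y x h with h1 | h1
    · exact Or.inl h1
    · exact Or.inr (Or.inr h1.symm)

lemma level {X : Type*} [MeasurableSpace X] {μ : Measure X} (G : Grid μ) {n n0 : ℤ} {x x0 : X}
    (h : G.C n x ⊆ G.C n0 x0) : G.C n x = G.C (max n n0) x := by
  rcases le_total n0 n with h1 | h1
  · rw [max_eq_left h1]
  · rw [max_eq_right h1]
    have : G.C n0 x = G.C n0 x0 := G.eq_of_mem (h (G.mem n x))
    rw [this]
    exact Set.Subset.antisymm h (this ▸ G.mono h1 x)
end Grid

/-! partitions -/

structure IsPart {X : Type*} [MeasurableSpace X] (P : X → Set X) : Prop where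
  mem : ∀ x, x ∈ P x
  eq : ∀ {x y}, y ∈ P x → P y = P x
  meas : ∀ x, MeasurableSet (P x)
  ctb : (Set.range P).Countable

namespace IsPart
lemma biUnion {X : Type*} [MeasurableSpace X] {P : X → Set X} (hP : IsPart P) {U : Set X}
    (hU : ∀ x ∈ U, P x ⊆ U) : U = ⋃ A ∈ P '' U, A := by
  ext x
  simp only [Set.mem_iUnion, Set.mem_image, exists_prop]
  constructor
  · intro hx; exact ⟨P x, ⟨x, hx, rfl⟩, hP.mem x⟩
  · rintro ⟨_, ⟨y, hy, rfl⟩, hx⟩; exact hU y hy hx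

lemma measU {X : Type*} [MeasurableSpace X] {P : X → Set X} (hP : IsPart P) {U : Set X}
    (hU : ∀ x ∈ U, P x ⊆ U) : MeasurableSet U := by
  rw [hP.biUnion hU]
  refine MeasurableSet.biUnion (hP.ctb.mono (Set.image_subset_range _ _)) ?_
  rintro _ ⟨y, hy, rfl⟩
  exact hP.meas y

lemma measurable_of {X Y : Type*} [MeasurableSpace X] [MeasurableSpace Y] {P : X → Set X}
    (hP : IsPart P) (g : Set X → Y) : Measurable (fun x => g (P x)) := by
  intro B _
  refine hP.measU fun x hx y hy => ?_
  simp only [Set.mem_preimage] at *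
  rwa [hP.eq hy]

lemma lintegral_le {X : Type*} [MeasurableSpace X] {μ : Measure X} {P : X → Set X} (hP : IsPart P)
    {U : Set X} (hU : ∀ x ∈ U, P x ⊆ U) (ψ φ : X → ℝ≥0∞)
    (h : ∀ x ∈ U, ∫⁻ y in P x, ψ y ∂μ ≤ ∫⁻ y in P x, φ y ∂μ) :
    ∫⁻ y in U, ψ y ∂μ ≤ ∫⁻ y in U, φ y ∂μ := by
  have hc : (P '' U).Countable := hP.ctb.mono (Set.image_subset_range _ _)
  have hm : ∀ A ∈ P '' U, MeasurableSet A := by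
    rintro _ ⟨y, hy, rfl⟩; exact hP.meas y
  have hd : (P '' U).PairwiseDisjoint id := by
    rintro _ ⟨y, hy, rfl⟩ _ ⟨z, hz, rfl⟩ hne
    rw [Function.onFun, id, id, Set.disjoint_left]
    intro x hx hx'
    exact hne ((hP.eq hx).symm.trans (hP.eq hx'))
  rw [hP.biUnion hU, lintegral_biUnion hc hm hd, lintegral_biUnion hc hm hd]
  refine ENNReal.tsum_le_tsum ?_
  rintro ⟨_, ⟨y, hy, rfl⟩⟩
  exact h y hy
end IsPart

/-! stopped partitions -/

open Classical in
def stopLev {X : Type*} [MeasurableSpace X] {μ : Measure X} (G : Grid μ) (n0 : ℤ) (L : ℕ)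
    (st : Set X → Prop) (x : X) : ℕ :=
  Nat.find (p := fun l => l = L ∨ st (G.C (n0 + l) x)) ⟨L, Or.inl rfl⟩

lemma stopLev_spec {X : Type*} [MeasurableSpace X] {μ : Measure X} (G : Grid μ) (n0 : ℤ) (L : ℕ)
    (st : Set X → Prop) (x : X) :
    stopLev G n0 L st x = L ∨ st (G.C (n0 + stopLev G n0 L st x) x) := by
  classical
  exact Nat.find_spec (p := fun l => l = L ∨ st (G.C (n0 + l) x)) ⟨L, Or.inl rfl⟩

lemma stopLev_min {X : Type*} [MeasurableSpace X] {μ : Measure X} (G : Grid μ) (n0 : ℤ) (L : ℕ)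
    (st : Set X → Prop) (x : X) {l : ℕ} (h : l < stopLev G n0 L st x) :
    ¬ st (G.C (n0 + l) x) := by
  classical
  exact fun h2 => Nat.find_min (p := fun l => l = L ∨ st (G.C (n0 + l) x)) ⟨L, Or.inl rfl⟩ h (Or.inr h2)

lemma stopLev_le {X : Type*} [MeasurableSpace X] {μ : Measure X} (G : Grid μ) (n0 : ℤ) (L : ℕ)
    (st : Set X → Prop) (x : X) : stopLev G n0 L st x ≤ L := by
  classical
  exact Nat.find_min' (p := fun l => l = L ∨ st (G.C (n0 + l) x)) ⟨L, Or.inl rfl⟩ (Or.inl rfl)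

lemma stopLev_le_of {X : Type*} [MeasurableSpace X] {μ : Measure X} (G : Grid μ) (n0 : ℤ) (L : ℕ)
    (st : Set X → Prop) (x : X) {l : ℕ} (h : st (G.C (n0 + l) x)) : stopLev G n0 L st x ≤ l := by
  by_contra! h2
  exact stopLev_min G n0 L st x h2 h

def stopP {X : Type*} [MeasurableSpace X] {μ : Measure X} (G : Grid μ) (n0 : ℤ) (L : ℕ)
    (st : Set X → Prop) (x : X) : Set X := G.C (n0 + stopLev G n0 L st x) x

lemma stopLev_eq {X : Type*} [MeasurableSpace X] {μ : Measure X} (G : Grid μ) (n0 : ℤ) (L : ℕ)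
    (st : Set X → Prop) {x y : X} (h : y ∈ stopP G n0 L st x) :
    stopLev G n0 L st y = stopLev G n0 L st x := by
  have h1 : ∀ l ≤ stopLev G n0 L st x, G.C (n0 + l) y = G.C (n0 + l) x := fun l hl =>
    G.eq_of_mem' (by omega) h
  apply le_antisymm
  · rcases stopLev_spec G n0 L st x with h2 | h2
    · rw [h2]; exact stopLev_le _ _ _ _ _
    · rw [← h1 _ le_rfl] at h2
      exact stopLev_le_of _ _ _ _ _ h2
  · by_contra! hlt
    rcases stopLev_spec G n0 L st y with h2 | h2
    · have := stopLev_le G n0 L st x; omega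
    · rw [h1 _ hlt.le] at h2
      exact stopLev_min G n0 L st x hlt h2

lemma stopP_part {X : Type*} [MeasurableSpace X] {μ : Measure X} (G : Grid μ) (n0 : ℤ) (L : ℕ)
    (st : Set X → Prop) : IsPart (stopP G n0 L st) where
  mem x := G.mem _ x
  eq {x y} h := by
    have h1 := stopLev_eq G n0 L st h
    rw [stopP, h1, stopP]
    exact G.eq_of_mem h
  meas x := G.meas _ x
  ctb := by
    refine Set.Countable.mono ?_ (Set.countable_iUnion G.ctb)
    rintro _ ⟨x, rfl⟩
    exact Set.mem_iUnion.2 ⟨_, x, rfl⟩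

/-! facts on averages -/

lemma avgS_pow {X : Type*} [MeasurableSpace X] (μ : Measure X) {r : ℝ} (hr : 0 < r) (F : X → ℝ≥0∞)
    {R : Set X} (h0 : μ R ≠ 0) (ht : μ R ≠ ∞) :
    avgS μ r F R ^ r * μ R = ∫⁻ x in R, F x ^ r ∂μ := by
  rw [avgS, ← ENNReal.rpow_mul, one_div_mul_cancel hr.ne', ENNReal.rpow_one,
    ENNReal.div_mul_cancel h0 ht]

lemma avgS_le_of {X : Type*} [MeasurableSpace X] (μ : Measure X) {r : ℝ} (hr : 0 < r)
    (F H : X → ℝ≥0∞) {R R' : Set X} {c : ℝ≥0∞} (h : (∫⁻ x in R, F x ^ r ∂μ) / μ R ≤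
      c * ((∫⁻ x in R', H x ^ r ∂μ) / μ R')) :
    avgS μ r F R ≤ c ^ (1 / r) * avgS μ r H R' := by
  rw [avgS, avgS, ← ENNReal.mul_rpow_of_nonneg _ _ (by positivity)]
  exact ENNReal.rpow_le_rpow h (by positivity)

lemma avgS_mono_set {X : Type*} [MeasurableSpace X] (μ : Measure X) {r : ℝ} (hr : 0 < r)
    (F : X → ℝ≥0∞) {R R' : Set X} (hRR : R ⊆ R') {c : ℝ≥0∞} (h0 : μ R ≠ 0)
    (hc : c ≠ ∞) (h : μ R' ≤ c * μ R) :
    avgS μ r F R ≤ c ^ (1 / r) * avgS μ r F R' := by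
  refine avgS_le_of μ hr F F ?_
  have hc0 : c ≠ 0 := by
    rintro rfl
    rw [zero_mul] at h
    exact h0 (le_antisymm ((measure_mono hRR).trans h) zero_le)
  calc (∫⁻ x in R, F x ^ r ∂μ) / μ R ≤ (∫⁻ x in R', F x ^ r ∂μ) * (μ R)⁻¹ := by
        rw [div_eq_mul_inv]
        exact mul_le_mul' (lintegral_mono_set hRR) le_rfl
    _ ≤ (∫⁻ x in R', F x ^ r ∂μ) * (c * (μ R')⁻¹) := by
        refine mul_le_mul' le_rfl ?_
        rw [← div_eq_mul_inv, ENNReal.le_div_iff_mul_le (Or.inr hc0) (Or.inr hc)]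
        by_cases ht : μ R = ∞
        · simp [ht]
        calc (μ R)⁻¹ * μ R' ≤ (μ R)⁻¹ * (c * μ R) := mul_le_mul' le_rfl h
          _ = c := by
            rw [mul_comm c, ← mul_assoc, ENNReal.inv_mul_cancel h0 ht, one_mul]
    _ = _ := by rw [div_eq_mul_inv]; ring

lemma avgS_mono {X : Type*} [MeasurableSpace X] (μ : Measure X) {r : ℝ} (hr : 0 < r)
    {F H : X → ℝ≥0∞} (hFH : ∀ x, F x ≤ H x) (R : Set X) : avgS μ r F R ≤ avgS μ r H R := by
  rw [avgS, avgS]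
  refine ENNReal.rpow_le_rpow (ENNReal.div_le_div_right (lintegral_mono fun x => ?_) _) (by positivity)
  exact ENNReal.rpow_le_rpow (hFH x) hr.le

lemma avgS_minkowski {X κ : Type*} [MeasurableSpace X] (μ : Measure X) {r : ℝ} (hr : 0 < r)
    {t : ℝ} (hrt : r ≤ t) (K : Finset κ) (f : κ → X → ℝ≥0∞) (hf : ∀ k, Measurable (f k))
    (F : X → ℝ≥0∞) (h : ∀ x, ∑ k ∈ K, f k x ^ t ≤ F x ^ t) {R : Set X} :
    ∑ k ∈ K, avgS μ r (f k) R ^ t ≤ avgS μ r F R ^ t := by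
  have ht : 0 < t := hr.trans_le hrt
  have hu : 1 ≤ t / r := (one_le_div hr).2 hrt
  have hu0 : 0 < t / r := by positivity
  have key := minkowski_aux (μ.restrict R) K (fun k x => f k x ^ r) (fun k => (hf k).pow_const _) hu
  have key2 : ∑ k ∈ K, (∫⁻ x in R, f k x ^ r ∂μ) ^ (t / r) ≤ (∫⁻ x in R, F x ^ r ∂μ) ^ (t / r) := by
    have h3 : ∫⁻ x in R, (∑ k ∈ K, (f k x ^ r) ^ (t / r)) ^ (1 / (t / r)) ∂μ ≤
        ∫⁻ x in R, F x ^ r ∂μ := by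
      refine lintegral_mono fun x => ?_
      simp only [← ENNReal.rpow_mul, mul_div_cancel₀ _ hr.ne']
      calc _ ≤ (F x ^ t) ^ (1 / (t / r)) := ENNReal.rpow_le_rpow (h x) (by positivity)
        _ = F x ^ r := by rw [← ENNReal.rpow_mul]; congr 1; field_simp
    have h4 := ENNReal.rpow_le_rpow (key.trans h3) hu0.le
    rwa [← ENNReal.rpow_mul, one_div_mul_cancel hu0.ne', ENNReal.rpow_one] at h4
  have e : ∀ G : X → ℝ≥0∞, avgS μ r G R ^ t = (∫⁻ x in R, G x ^ r ∂μ) ^ (t / r) * ((μ R)⁻¹) ^ (t / r) := by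
    intro G
    rw [avgS, ← ENNReal.rpow_mul, one_div_mul_eq_div, div_eq_mul_inv,
      ENNReal.mul_rpow_of_nonneg _ _ hu0.le]
  simp only [e]
  rw [← Finset.sum_mul]
  exact mul_le_mul' key2 le_rfl

/-- vector-valued unweighted sparse bound -/
lemma vec_sparse {X ι κ : Type*} [MeasurableSpace X] (μ : Measure X) [SFinite μ]
    {m : ℕ} (r : Fin m → ℝ) (t : Fin m → ℝ≥0∞) (hr : ∀ j, 0 < r j)
    (hrt : ∀ j, ENNReal.ofReal (r j) < t j) {T q γ : ℝ} (hT : 0 < T) (hq : 0 < q) (hqT : q ≤ T)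
    (hTt : ∑ j, ((t j)⁻¹).toReal = 1 / T)
    (hγ1 : ∀ j, expE r t j / r j ≤ γ) (hγ2 : T / q ≤ γ)
    (K : Finset κ) (I : κ → Finset ι) (R : ι → Set X) (E : κ → ι → Set X)
    (hnest : ∀ k ∈ K, NestedOn (I k) R)
    (hR : ∀ i, MeasurableSet (R i)) (hE : ∀ k ∈ K, ∀ i ∈ I k, MeasurableSet (E k i))
    (hER : ∀ k ∈ K, ∀ i ∈ I k, E k i ⊆ R i)
    (hdisj : ∀ k ∈ K, (I k : Set ι).PairwiseDisjoint (E k))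
    (h0 : ∀ i, μ (R i) ≠ 0) (htop : ∀ i, μ (R i) ≠ ∞)
    {Λ : ℝ≥0∞} (hΛ : Λ ≠ ∞) (hRE : ∀ k ∈ K, ∀ i ∈ I k, μ (R i) ≤ Λ * μ (E k i))
    (g : Fin m → κ → X → ℝ≥0∞) (hg : ∀ j k, Measurable (g j k)) (Q0 : Set X)
    (hQ0 : MeasurableSet Q0) (hQ0t : μ Q0 ≠ ∞)
    (B : Fin m → ℝ≥0∞) (hB : ∀ j, B j ≠ ∞)
    (h1 : ∀ j, t j ≠ ∞ → ∀ x, ∑ k ∈ K, g j k x ^ (t j).toReal ≤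
      Q0.indicator (fun _ => B j ^ (t j).toReal) x)
    (h2 : ∀ j, t j = ∞ → ∀ k ∈ K, ∀ x, g j k x ≤ B j) :
    ∑ k ∈ K, ∫⁻ x, (∑ i ∈ I k, (R i).indicator (fun _ => ∏ j, avgS μ (r j) (g j k) (R i) ^ q) x)
      ^ (T / q) ∂μ ≤ (sC r t T q γ Λ * ∏ j, B j) ^ T * μ Q0 := by
  classical
  have ht0 : ∀ j, t j ≠ 0 := fun j => ne_zero_of_lt (hrt j)
  have htr : ∀ j, t j ≠ ∞ → 0 < (t j).toReal := fun j hj => ENNReal.toReal_pos (ht0 j) hj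
  set N : Fin m → κ → ℝ≥0∞ := fun j k =>
    if t j = ∞ then B j else (∫⁻ x, g j k x ^ (t j).toReal ∂μ) ^ (1 / (t j).toReal) with hN
  have hNpow : ∀ j k, t j ≠ ∞ → N j k ^ (t j).toReal = ∫⁻ x, g j k x ^ (t j).toReal ∂μ := by
    intro j k hj
    simp only [hN, if_neg hj]
    rw [← ENNReal.rpow_mul, one_div_mul_cancel (htr j hj).ne', ENNReal.rpow_one]
  have hsum : ∀ j, t j ≠ ∞ → ∑ k ∈ K, N j k ^ (t j).toReal ≤ B j ^ (t j).toReal * μ Q0 := by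
    intro j hj
    simp only [hNpow j _ hj]
    rw [← lintegral_finsetSum _ (fun k _ => (hg j k).pow_const _)]
    refine (lintegral_mono (h1 j hj)).trans ?_
    rw [lintegral_indicator_const hQ0]
  have hNt : ∀ k ∈ K, ∀ j, N j k ≠ ∞ := by
    intro k hk j
    by_cases hj : t j = ∞
    · simp only [hN, if_pos hj]; exact hB j
    · intro h
      have h3 := (Finset.single_le_sum (f := fun k => N j k ^ (t j).toReal)
        (fun _ _ => zero_le) hk).trans (hsum j hj)
      simp only [h, ENNReal.top_rpow_of_pos (htr j hj), top_le_iff] at h3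
      exact ENNReal.mul_ne_top (ENNReal.rpow_ne_top_of_nonneg (htr j hj).le (hB j)) hQ0t h3
  have step : ∀ k ∈ K, ∫⁻ x, (∑ i ∈ I k, (R i).indicator
      (fun _ => ∏ j, avgS μ (r j) (g j k) (R i) ^ q) x) ^ (T / q) ∂μ ≤
      sC r t T q γ Λ ^ T * ∏ j, N j k ^ T := by
    intro k hk
    have := scalar_sparse μ r t hr hrt hT hq hqT hTt hγ1 hγ2 (I k) R (E k) (hnest k hk)
      (fun i _ => hR i) (hE k hk) (hER k hk) (hdisj k hk) (fun i _ => h0 i) (fun i _ => htop i)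
      hΛ (hRE k hk) (fun _ _ => 1) (fun _ => measurable_const) (by simp) (by simp)
      (fun j i _ => by simpa using htop i) (fun _ => 1) measurable_const (by simp)
      (fun i _ => by simpa using htop i) (by simp) (A := 1) (by simp)
      (fun i _ => by simp [ENNReal.div_self (h0 i) (htop i)])
      (fun j => g j k) (fun j => hg j k) (fun j => N j k) (hNt k hk)
      (fun j hj => by simp [hNpow j k hj])
      (fun j hj => by
        refine Filter.Eventually.of_forall fun x => ?_
        simp only [hN, if_pos hj, ENNReal.one_rpow, mul_one]
        exact h2 j hj k hk x)
    simp only [mul_one, ENNReal.one_rpow] at this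
    rwa [ENNReal.mul_rpow_of_nonneg _ _ hT.le, ← ENNReal.prod_rpow_of_nonneg hT.le] at this
  refine (Finset.sum_le_sum step).trans ?_
  rw [← Finset.mul_sum, ENNReal.mul_rpow_of_nonneg _ _ hT.le, mul_assoc]
  refine mul_le_mul' le_rfl ?_
  refine (holder_bound_finset K t ht0 T hT (by rw [hTt, one_div]) N
    (fun j => B j * μ Q0 ^ ((t j)⁻¹).toReal) ?_ ?_).trans (le_of_eq ?_)
  · intro j hj
    refine (hsum j hj).trans (le_of_eq ?_)
    rw [ENNReal.mul_rpow_of_nonneg _ _ (htr j hj).le, ← ENNReal.rpow_mul, ENNReal.toReal_inv,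
      inv_mul_cancel₀ (htr j hj).ne', ENNReal.rpow_one]
  · intro j hj k _
    simp [hN, hj]
  · simp only [ENNReal.mul_rpow_of_nonneg _ _ hT.le, Finset.prod_mul_distrib,
      ENNReal.prod_rpow_of_nonneg hT.le]
    congr 1
    by_cases hz : μ Q0 = 0
    · have hm : (Finset.univ : Finset (Fin m)).Nonempty := by
        by_contra hne
        rw [Finset.not_nonempty_iff_eq_empty] at hne
        rw [hne] at hTt
        simp at hTt
        linarith
      rw [hz]
      have : ∃ j, 0 < ((t j)⁻¹).toReal := by
        by_contra! hcon
        have : ∑ j, ((t j)⁻¹).toReal ≤ 0 := Finset.sum_nonpos fun j _ => hcon j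
        rw [hTt] at this
        have : 0 < 1 / T := by positivity
        linarith
      obtain ⟨j, hj⟩ := this
      rw [Finset.prod_eq_zero (Finset.mem_univ j) (ENNReal.zero_rpow_of_pos hj),
        ENNReal.zero_rpow_of_pos hT]
    · have hprod : ∏ j, μ Q0 ^ ((t j)⁻¹).toReal = μ Q0 ^ (1 / T) := by
        rw [← hTt]
        obtain ⟨l, hl⟩ := exists_ee hz hQ0t
        rw [hl]
        simp only [ee_rpow, ee_prod, ← Finset.mul_sum]
      rw [hprod, ← ENNReal.rpow_mul, one_div_mul_cancel hT.ne', ENNReal.rpow_one]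

open Classical in
def nJ {X ι κ : Type*} (K : Finset κ) (I : κ → Finset ι) (R : ι → Set X) (b : κ → ι → ℝ≥0∞)
    (s : ℝ) (J : Finset (Set X)) : ℝ≥0∞ :=
  (∑ k ∈ K, (∑ i ∈ (I k).filter (fun i => R i ∈ J), b k i) ^ s) ^ (1 / s)

lemma nJ_mono {X ι κ : Type*} (K : Finset κ) (I : κ → Finset ι) (R : ι → Set X) (b : κ → ι → ℝ≥0∞)
    {s : ℝ} (hs : 1 ≤ s) (J J' : Finset (Set X)) (h : J ⊆ J') :
    nJ K I R b s J ≤ nJ K I R b s J' := by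
  classical
  have hs0 : 0 < s := by linarith
  unfold nJ
  refine ENNReal.rpow_le_rpow (Finset.sum_le_sum fun k _ => ENNReal.rpow_le_rpow ?_ hs0.le) (by positivity)
  refine Finset.sum_le_sum_of_subset fun i hi => ?_
  simp only [Finset.mem_filter] at hi ⊢
  exact ⟨hi.1, h hi.2⟩

open Classical in
lemma nJ_sub {X ι κ : Type*} (K : Finset κ) (I : κ → Finset ι) (R : ι → Set X) (b : κ → ι → ℝ≥0∞)
    {s : ℝ} (hs : 1 ≤ s) (J J' : Finset (Set X)) :
    nJ K I R b s (J ∪ J') ≤ nJ K I R b s J + nJ K I R b s J' := by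
  have hs0 : 0 < s := by linarith
  unfold nJ
  refine le_trans ?_ (ENNReal.Lp_add_le K _ _ hs)
  refine ENNReal.rpow_le_rpow (Finset.sum_le_sum fun k _ => ENNReal.rpow_le_rpow ?_ hs0.le) (by positivity)
  rw [Finset.sum_filter, Finset.sum_filter, Finset.sum_filter, ← Finset.sum_add_distrib]
  refine Finset.sum_le_sum fun i _ => ?_
  by_cases h1 : R i ∈ J <;> by_cases h2 : R i ∈ J' <;> simp [h1, h2]

lemma nJ_empty {X ι κ : Type*} (K : Finset κ) (I : κ → Finset ι) (R : ι → Set X) (b : κ → ι → ℝ≥0∞)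
    {s : ℝ} (hs : 1 ≤ s) : nJ K I R b s ∅ = 0 := by
  have hs0 : 0 < s := by linarith
  have h1 : 0 < s⁻¹ := by positivity
  simp [nJ, hs0, h1]

open Classical in
lemma nJ_fam_pow_le {X ι κ : Type*} (K : Finset κ) (I : κ → Finset ι) (R : ι → Set X)
    (b : κ → ι → ℝ≥0∞) {s : ℝ} (hs : 1 ≤ s) (GG : Finset (Set X)) (Q0 : Set X) (x : X) :
    nJ K I R b s (fam GG Q0 x) ^ s ≤ ∑ k ∈ K, (∑ i ∈ (I k).filter (fun i => R i ⊆ Q0),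
      (R i).indicator (fun _ => b k i) x) ^ s := by
  have hs0 : 0 < s := by linarith
  rw [nJ, ← ENNReal.rpow_mul, one_div_mul_cancel hs0.ne', ENNReal.rpow_one]
  refine Finset.sum_le_sum fun k _ => ENNReal.rpow_le_rpow ?_ hs0.le
  rw [Finset.sum_filter, Finset.sum_filter]
  refine Finset.sum_le_sum fun i _ => ?_
  by_cases h : R i ∈ fam GG Q0 x
  · have := mem_fam.1 h
    simp [h, this.2.1, this.2.2]
  · simp [h]

lemma stopE_meas {X : Type*} [MeasurableSpace X] (GG : Finset (Set X))
    (hG : ∀ Q ∈ GG, MeasurableSet Q) (n : Finset (Set X) → ℝ≥0∞)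
    (A : Set X → ℝ≥0∞) {Q : Set X} (hQ : MeasurableSet Q) : MeasurableSet (stopE GG n A Q) := by
  classical
  have : stopE GG n A Q = Q ∩ ⋃ J ∈ (GG.powerset.filter (fun J => n J ≤ A Q)), {x | fam GG Q x = J} := by
    ext x
    simp only [stopE, Set.mem_setOf_eq, Set.mem_inter_iff, Set.mem_iUnion, Finset.mem_filter,
      Finset.mem_powerset, exists_prop]
    constructor
    · rintro ⟨h1, h2⟩
      exact ⟨h1, _, ⟨fun Q' h => (mem_fam.1 h).1, h2⟩, rfl⟩
    · rintro ⟨h1, J, ⟨-, h2⟩, h3⟩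
      exact ⟨h1, h3 ▸ h2⟩
  rw [this]
  refine hQ.inter (Finset.measurableSet_biUnion _ fun J hJ => ?_)
  have hJ' : J ⊆ GG := by simpa using (Finset.mem_filter.1 hJ).1
  have e : {x | fam GG Q x = J} = ⋂ Q' ∈ GG, {x | (Q' ⊆ Q ∧ x ∈ Q') ↔ Q' ∈ J} := by
    ext x
    simp only [Set.mem_setOf_eq, Set.mem_iInter]
    constructor
    · rintro rfl Q' hQ'
      rw [mem_fam]; tauto
    · intro h
      ext Q'
      rw [mem_fam]
      constructor
      · rintro ⟨h1, h2⟩; exact (h Q' h1).1 h2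
      · intro h1; exact ⟨hJ' h1, (h Q' (hJ' h1)).2 h1⟩
  rw [e]
  refine Finset.measurableSet_biInter _ fun Q' hQ' => ?_
  by_cases h1 : Q' ⊆ Q <;> by_cases h2 : Q' ∈ J <;> simp only [h1, h2, true_and, false_and, iff_true,
    iff_false, false_iff, not_true_eq_false, not_false_eq_true]
  · exact hG Q' hQ'
  · exact (hG Q' hQ').compl
  · simp
  · simp

lemma cheb_aux {X : Type*} [MeasurableSpace X] (μ : Measure X) (n : X → ℝ≥0∞)
    (hn : Measurable n) {s : ℝ} (hs : 0 < s) {c M : ℝ≥0∞} (hc : c ≠ ∞)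
    (h : ∫⁻ x, n x ^ s ∂μ ≤ c ^ s / 4 * M) : μ {x | c < n x} ≤ M / 4 := by
  by_cases hc0 : c = 0
  · subst hc0
    rw [ENNReal.zero_rpow_of_pos hs] at h
    simp only [ENNReal.zero_div, zero_mul, nonpos_iff_eq_zero] at h
    rw [lintegral_eq_zero_iff (hn.pow_const _)] at h
    have : μ {x | 0 < n x} = 0 := by
      refine measure_mono_null ?_ (ae_iff.1 h)
      intro x hx
      simp only [Set.mem_setOf_eq, Pi.zero_apply] at hx ⊢
      intro h2
      rw [ENNReal.rpow_eq_zero_iff_of_pos hs] at h2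
      exact hx.ne' h2
    rw [this]; exact zero_le
  · have hcs0 : c ^ s ≠ 0 := by
      rw [Ne, ENNReal.rpow_eq_zero_iff_of_pos hs]; exact hc0
    have hcst : c ^ s ≠ ∞ := ENNReal.rpow_ne_top_of_nonneg hs.le hc
    have h2 : c ^ s * μ {x | c < n x} ≤ c ^ s * (M / 4) := by
      calc c ^ s * μ {x | c < n x} ≤ c ^ s * μ {x | c ^ s ≤ n x ^ s} := by
            refine mul_le_mul' le_rfl (measure_mono fun x hx => ?_)
            exact ENNReal.rpow_le_rpow (le_of_lt hx) hs.le
        _ ≤ ∫⁻ x, n x ^ s ∂μ := mul_meas_ge_le_lintegral (hn.pow_const _) _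
        _ ≤ _ := h
        _ = _ := by simp only [div_eq_mul_inv]; ring
    rwa [ENNReal.mul_le_mul_iff_right hcs0 hcst] at h2

lemma omega_bound {X : Type*} [MeasurableSpace X] (μ : Measure X) {P : X → Set X} (hP : IsPart P)
    (h0 : ∀ x, μ (P x) ≠ 0) (ht : ∀ x, μ (P x) ≠ ∞) {r : ℝ} (hr : 0 < r) (F : X → ℝ≥0∞)
    {Q0 : Set X} (hQ : ∀ x ∈ Q0, P x ⊆ Q0) (hQ0 : μ Q0 ≠ 0) (hQt : μ Q0 ≠ ∞)
    (hα : avgS μ r F Q0 ≠ ∞) {c : ℝ≥0∞} :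
    c * μ {x | x ∈ Q0 ∧ c ^ (1 / r) * avgS μ r F Q0 < avgS μ r F (P x)} ≤ μ Q0 := by
  set α := avgS μ r F Q0 with hαd
  set Ω := {x | x ∈ Q0 ∧ c ^ (1 / r) * α < avgS μ r F (P x)} with hΩ
  have hΩP : ∀ x ∈ Ω, P x ⊆ Ω := by
    intro x hx y hy
    refine ⟨hQ x hx.1 hy, ?_⟩
    rw [hP.eq hy]; exact hx.2
  have hΩQ : Ω ⊆ Q0 := fun x hx => hx.1
  have hα2 := avgS_pow μ hr F hQ0 hQt
  rw [← hαd] at hα2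
  by_cases hz : α = 0
  · have : Ω = ∅ := by
      rw [Set.eq_empty_iff_forall_notMem]
      intro x hx
      have h1 := avgS_pow μ hr F (h0 x) (ht x)
      have h2 : ∫⁻ y in P x, F y ^ r ∂μ ≤ ∫⁻ y in Q0, F y ^ r ∂μ := lintegral_mono_set (hQ x hx.1)
      rw [← hα2, hz, ENNReal.zero_rpow_of_pos hr, zero_mul, ← h1] at h2
      have h3 : avgS μ r F (P x) ^ r * μ (P x) = 0 := le_antisymm h2 zero_le
      rcases mul_eq_zero.1 h3 with h4 | h4
      · rw [ENNReal.rpow_eq_zero_iff_of_pos hr] at h4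
        have := hx.2
        rw [h4] at this
        exact ENNReal.not_lt_zero this
      · exact h0 x h4
    rw [this]; simp
  · have key := hP.lintegral_le (μ := μ) hΩP (fun _ => c * α ^ r) (fun y => F y ^ r) (by
      intro x hx
      rw [setLIntegral_const, ← avgS_pow μ hr F (h0 x) (ht x)]
      refine mul_le_mul' ?_ le_rfl
      have := ENNReal.rpow_le_rpow hx.2.le hr.le
      rwa [ENNReal.mul_rpow_of_nonneg _ _ hr.le, ← ENNReal.rpow_mul, one_div_mul_cancel hr.ne',
        ENNReal.rpow_one] at this)
    rw [setLIntegral_const] at key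
    have h2 := key.trans (lintegral_mono_set hΩQ)
    rw [← hα2] at h2
    have hα0 : α ^ r ≠ 0 := by rw [Ne, ENNReal.rpow_eq_zero_iff_of_pos hr]; exact hz
    rw [mul_comm c, mul_assoc, ENNReal.mul_le_mul_iff_right hα0 (ENNReal.rpow_ne_top_of_nonneg hr.le hα)] at h2
    exact h2

lemma avg_part_le {X : Type*} [MeasurableSpace X] (μ : Measure X) {P : X → Set X} (hP : IsPart P)
    (h0 : ∀ x, μ (P x) ≠ 0) (ht : ∀ x, μ (P x) ≠ ∞) {r : ℝ} (hr : 0 < r) (f g : X → ℝ≥0∞)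
    {R : Set X} (hR : ∀ x ∈ R, P x ⊆ R) (hg : ∀ x ∈ R, g x = avgS μ r f (P x)) :
    avgS μ r f R ≤ avgS μ r g R := by
  rw [avgS, avgS]
  refine ENNReal.rpow_le_rpow (ENNReal.div_le_div_right ?_ _) (by positivity)
  refine hP.lintegral_le hR _ _ fun x hx => ?_
  have : ∫⁻ y in P x, g y ^ r ∂μ = ∫⁻ y in P x, avgS μ r f (P x) ^ r ∂μ := by
    refine setLIntegral_congr_fun (hP.meas x) fun y hy => ?_
    simp only [hg y (hR x hx hy), hP.eq hy]
  rw [this, setLIntegral_const, avgS_pow μ hr f (h0 x) (ht x)]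

lemma stop_sub {X : Type*} [MeasurableSpace X] {μ : Measure X} (G : Grid μ) (n0 : ℤ) (L : ℕ)
    (st : Set X → Prop) {x : X} (hx : ¬ st (stopP G n0 L st x)) {l : ℕ} (hl : l ≤ L) {y : X}
    (hy : y ∈ G.C (n0 + l) x) : stopP G n0 L st y ⊆ G.C (n0 + l) x := by
  have hL : stopLev G n0 L st x = L := by
    rcases stopLev_spec G n0 L st x with h | h
    · exact h
    · exact absurd h hx
  have h1 : l ≤ stopLev G n0 L st y := by
    by_contra! hlt
    rcases stopLev_spec G n0 L st y with h2 | h2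
    · omega
    · rw [G.eq_of_mem' (n := n0 + stopLev G n0 L st y) (by omega) hy] at h2
      exact stopLev_min G n0 L st x (by omega) h2
  rw [← G.eq_of_mem hy]
  exact G.mono (by omega) y

lemma stop_avg {X : Type*} [MeasurableSpace X] {μ : Measure X} (G : Grid μ) (n0 : ℤ) (L : ℕ)
    (st : Set X → Prop) {x0 x : X} (hx : x ∈ G.C n0 x0) {r : ℝ} (hr : 0 < r) (F : X → ℝ≥0∞)
    {B : ℝ≥0∞} (hB : avgS μ r F (G.C n0 x0) ≤ B) (hst : ∀ R, ¬ st R → avgS μ r F R ≤ B)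
    : avgS μ r F (stopP G n0 L st x) ≤ G.D ^ (1 / r) * B := by
  have hD : 1 ≤ G.D := by
    have h1 := G.doubling n0 x0
    by_contra! hlt
    have h2 : G.D * μ (G.C (n0 + 1) x0) < 1 * μ (G.C (n0 + 1) x0) :=
      ENNReal.mul_lt_mul_left (G.pos _ _) (G.fin _ _) hlt
    rw [one_mul] at h2
    exact absurd (h1.trans_lt h2) (not_lt.2 (measure_mono (G.mono1 _ _)))
  unfold stopP
  generalize hl : stopLev G n0 L st x = l
  rcases l with _ | l
  · have e : G.C (n0 + (0 : ℕ)) x = G.C n0 x0 := by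
      simp only [Nat.cast_zero, add_zero]; exact G.eq_of_mem hx
    rw [e]
    calc _ ≤ 1 * B := by rw [one_mul]; exact hB
      _ ≤ _ := mul_le_mul' (ENNReal.one_le_rpow hD (by positivity)) le_rfl
  · have h2 := hst _ (stopLev_min G n0 L st x (l := l) (by omega))
    have e : n0 + ((l + 1 : ℕ) : ℤ) = n0 + l + 1 := by push_cast; ring
    rw [e]
    refine (avgS_mono_set μ hr F (G.mono1 _ _) (G.pos _ _) G.D_ne (G.doubling _ _)).trans ?_
    exact mul_le_mul' le_rfl h2

def wC {m : ℕ} (r : Fin m → ℝ) (t : Fin m → ℝ≥0∞) (T q γ : ℝ) (Λ D : ℝ≥0∞) : ℝ≥0∞ :=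
  (4 ^ (1 / T) * (sC r t T q γ Λ * ∏ j, (D ^ (1 / r j) * (4 * m) ^ (1 / r j)))) ^ q

lemma wC_ne_top {m : ℕ} (r : Fin m → ℝ) (t : Fin m → ℝ≥0∞) (hr : ∀ j, 0 < r j)
    (hrt : ∀ j, ENNReal.ofReal (r j) < t j) {T q γ : ℝ} {Λ D : ℝ≥0∞} (hT : 0 < T) (hq : 0 < q)
    (hqT : q ≤ T) (hγ2 : T / q ≤ γ) (hΛ : Λ ≠ ∞) (hD : D ≠ ∞) : wC r t T q γ Λ D ≠ ∞ := by
  unfold wC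
  refine ENNReal.rpow_ne_top_of_nonneg hq.le (ENNReal.mul_ne_top ?_ (ENNReal.mul_ne_top ?_ ?_))
  · exact ENNReal.rpow_ne_top_of_nonneg (by positivity) (by simp)
  · exact sC_ne_top r t hr hrt hq hqT hγ2 hΛ
  · refine ENNReal.prod_ne_top fun j _ => ?_
    have : 0 ≤ 1 / r j := (one_div_pos.2 (hr j)).le
    exact ENNReal.mul_ne_top (ENNReal.rpow_ne_top_of_nonneg this hD)
      (ENNReal.rpow_ne_top_of_nonneg this (ENNReal.mul_ne_top (by simp) (by simp)))

lemma weak_type {X ι κ : Type*} [MeasurableSpace X] (μ : Measure X) [SFinite μ] (G : Grid μ)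
    {m : ℕ} (r : Fin m → ℝ) (t : Fin m → ℝ≥0∞) (hr : ∀ j, 0 < r j)
    (hrt : ∀ j, ENNReal.ofReal (r j) < t j) {T q γ : ℝ} (hT : 0 < T) (hq : 0 < q) (hqT : q ≤ T)
    (hTt : ∑ j, ((t j)⁻¹).toReal = 1 / T)
    (hγ1 : ∀ j, expE r t j / r j ≤ γ) (hγ2 : T / q ≤ γ)
    (K : Finset κ) (I : κ → Finset ι) (lev : ι → ℤ) (ctr : ι → X) (R : ι → Set X)
    (hRG : ∀ i, R i = G.C (lev i) (ctr i)) (E : κ → ι → Set X)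
    (hE : ∀ k ∈ K, ∀ i ∈ I k, MeasurableSet (E k i))
    (hER : ∀ k ∈ K, ∀ i ∈ I k, E k i ⊆ R i)
    (hdisj : ∀ k ∈ K, (I k : Set ι).PairwiseDisjoint (E k))
    {Λ : ℝ≥0∞} (hΛ : Λ ≠ ∞) (hRE : ∀ k ∈ K, ∀ i ∈ I k, μ (R i) ≤ Λ * μ (E k i))
    (f : Fin m → κ → X → ℝ≥0∞) (hf : ∀ j k, Measurable (f j k)) (F : Fin m → X → ℝ≥0∞)
    (hF1 : ∀ j, t j ≠ ∞ → ∀ x, ∑ k ∈ K, f j k x ^ (t j).toReal ≤ F j x ^ (t j).toReal)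
    (hF2 : ∀ j, t j = ∞ → ∀ k ∈ K, ∀ x, f j k x ≤ F j x)
    (GG : Finset (Set X)) (n0 : ℤ) (x0 : X) (hα : ∀ j, avgS μ (r j) (F j) (G.C n0 x0) ≠ ∞) :
    μ {x | x ∈ G.C n0 x0 ∧ wC r t T q γ Λ G.D * ∏ j, avgS μ (r j) (F j) (G.C n0 x0) ^ q <
      nJ K I R (fun k i => ∏ j, avgS μ (r j) (f j k) (R i) ^ q) (T / q) (fam GG (G.C n0 x0) x)}
      ≤ μ (G.C n0 x0) / 2 := by
  classical
  have hm : m ≠ 0 := by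
    rintro rfl
    simp at hTt
    linarith
  have hm4 : (4 * m : ℝ≥0∞) ≠ 0 := by simp [hm]
  have hs : 1 ≤ T / q := (one_le_div hq).2 hqT
  have hs0 : 0 < T / q := by positivity
  set Q0 := G.C n0 x0 with hQ0
  set α : Fin m → ℝ≥0∞ := fun j => avgS μ (r j) (F j) Q0 with hαd
  set Kc : Fin m → ℝ≥0∞ := fun j => (4 * m) ^ (1 / r j) with hKc
  set st : Set X → Prop := fun A => ∃ j, Kc j * α j < avgS μ (r j) (F j) A with hst
  set L : ℕ := K.sup fun k => (I k).sup fun i => (max (lev i) n0 - n0).toNat with hL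
  set P := stopP G n0 L st with hPd
  have hP : IsPart P := stopP_part G n0 L st
  have hP0 : ∀ x, μ (P x) ≠ 0 := fun x => G.pos _ _
  have hPt : ∀ x, μ (P x) ≠ ∞ := fun x => G.fin _ _
  have hPQ : ∀ x ∈ Q0, P x ⊆ Q0 := by
    intro x hx
    rw [hQ0, ← G.eq_of_mem hx]
    exact G.mono (by omega) x
  set g : Fin m → κ → X → ℝ≥0∞ := fun j k x => Q0.indicator (fun y => avgS μ (r j) (f j k) (P y)) x with hgd
  have hgm : ∀ j k, Measurable (g j k) := fun j k =>
    (hP.measurable_of (fun A => avgS μ (r j) (f j k) A)).indicator (G.meas _ _)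
  set B : Fin m → ℝ≥0∞ := fun j => G.D ^ (1 / r j) * (Kc j * α j) with hBd
  have hri : ∀ j, 0 < 1 / r j := fun j => one_div_pos.2 (hr j)
  have hKt : ∀ j, Kc j ≠ ∞ := fun j => ENNReal.rpow_ne_top_of_nonneg (hri j).le
    (ENNReal.mul_ne_top (by simp) (by simp))
  have hBt : ∀ j, B j ≠ ∞ := fun j => ENNReal.mul_ne_top
    (ENNReal.rpow_ne_top_of_nonneg (hri j).le G.D_ne) (ENNReal.mul_ne_top (hKt j) (hα j))
  have hK1 : ∀ j, 1 ≤ Kc j := by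
    intro j
    refine ENNReal.one_le_rpow ?_ (hri j)
    have : (1 : ℝ≥0∞) ≤ ((4 * m : ℕ) : ℝ≥0∞) := by exact_mod_cast (by omega)
    simpa using this
  have hFP : ∀ j, ∀ x ∈ Q0, avgS μ (r j) (F j) (P x) ≤ B j := by
    intro j x hx
    refine stop_avg G n0 L st hx (hr j) (F j) ?_ ?_
    · calc α j = 1 * α j := (one_mul _).symm
        _ ≤ _ := mul_le_mul' (hK1 j) le_rfl
    · intro A hA
      by_contra! h
      exact hA ⟨j, h⟩
  -- vector bound for g
  have hVS := vec_sparse μ r t hr hrt hT hq hqT hTt hγ1 hγ2 K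
    (fun k => (I k).filter (fun i => R i ⊆ Q0)) R E
    (by
      intro k hk i _ i' _
      rw [hRG i, hRG i']
      exact G.nest _ _ _ _)
    (fun i => by rw [hRG]; exact G.meas _ _)
    (fun k hk i hi => hE k hk i (Finset.mem_filter.1 hi).1)
    (fun k hk i hi => hER k hk i (Finset.mem_filter.1 hi).1)
    (fun k hk => (hdisj k hk).subset (by
      intro i hi; exact (Finset.mem_filter.1 hi).1))
    (fun i => by rw [hRG]; exact G.pos _ _) (fun i => by rw [hRG]; exact G.fin _ _) hΛ
    (fun k hk i hi => hRE k hk i (Finset.mem_filter.1 hi).1)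
    g hgm Q0 (G.meas _ _) (G.fin _ _) B hBt
    (by
      intro j hj x
      have htr : 0 < (t j).toReal := ENNReal.toReal_pos (ne_zero_of_lt (hrt j)) hj
      by_cases hx : x ∈ Q0
      · simp only [hgd, Set.indicator_of_mem hx]
        refine (avgS_minkowski μ (hr j) ?_ K (f j) (hf j) (F j) (hF1 j hj)).trans ?_
        · have := u_gt r t hr hrt j hj
          rw [one_lt_div (hr j)] at this
          exact this.le
        · exact ENNReal.rpow_le_rpow (hFP j x hx) htr.le
      · simp only [hgd, Set.indicator_of_notMem hx, ENNReal.zero_rpow_of_pos htr]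
        simp)
    (by
      intro j hj k hk x
      by_cases hx : x ∈ Q0
      · simp only [hgd, Set.indicator_of_mem hx]
        exact (avgS_mono μ (hr j) (hF2 j hj k hk) _).trans (hFP j x hx)
      · simp only [hgd, Set.indicator_of_notMem hx]
        exact zero_le)
  set nn' : X → ℝ≥0∞ := fun x => (∑ k ∈ K, (∑ i ∈ (I k).filter (fun i => R i ⊆ Q0),
    (R i).indicator (fun _ => ∏ j, avgS μ (r j) (g j k) (R i) ^ q) x) ^ (T / q)) ^ (1 / (T / q)) with hnn
  have hinner : ∀ k, Measurable (fun x => (∑ i ∈ (I k).filter (fun i => R i ⊆ Q0),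
      (R i).indicator (fun _ => ∏ j, avgS μ (r j) (g j k) (R i) ^ q) x) ^ (T / q)) := by
    intro k
    refine Measurable.pow_const (Finset.measurable_sum _ fun i _ => ?_) _
    exact measurable_const.indicator (by rw [hRG]; exact G.meas _ _)
  have hnm : Measurable nn' := (Finset.measurable_sum _ fun k _ => hinner k).pow_const _
  have hnpow : ∀ x, nn' x ^ (T / q) = ∑ k ∈ K, (∑ i ∈ (I k).filter (fun i => R i ⊆ Q0),
      (R i).indicator (fun _ => ∏ j, avgS μ (r j) (g j k) (R i) ^ q) x) ^ (T / q) := by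
    intro x
    simp only [hnn]
    rw [← ENNReal.rpow_mul, one_div_mul_cancel hs0.ne', ENNReal.rpow_one]
  set c := wC r t T q γ Λ G.D * ∏ j, α j ^ q with hc
  have hct : c ≠ ∞ := ENNReal.mul_ne_top (wC_ne_top r t hr hrt hT hq hqT hγ2 hΛ G.D_ne)
    (ENNReal.prod_ne_top fun j _ => ENNReal.rpow_ne_top_of_nonneg hq.le (hα j))
  have hcpow : c ^ (T / q) = 4 * (sC r t T q γ Λ * ∏ j, B j) ^ T := by
    rw [hc, wC, ENNReal.prod_rpow_of_nonneg hq.le, ← ENNReal.mul_rpow_of_nonneg _ _ hq.le,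
      ← ENNReal.rpow_mul, mul_div_cancel₀ _ hq.ne']
    have : 4 ^ (1 / T) * (sC r t T q γ Λ * ∏ j, (G.D ^ (1 / r j) * (4 * m) ^ (1 / r j))) * ∏ j, α j
        = 4 ^ (1 / T) * (sC r t T q γ Λ * ∏ j, B j) := by
      simp only [hBd, hKc, Finset.prod_mul_distrib]; ring
    rw [this, ENNReal.mul_rpow_of_nonneg _ _ hT.le, ← ENNReal.rpow_mul, one_div_mul_cancel hT.ne',
      ENNReal.rpow_one]
  have hcheb : μ {x | c < nn' x} ≤ μ Q0 / 4 := by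
    refine cheb_aux μ nn' hnm hs0 hct ?_
    simp only [hnpow]
    rw [lintegral_finsetSum _ fun k _ => hinner k]
    refine hVS.trans (le_of_eq ?_)
    rw [hcpow, mul_comm (4 : ℝ≥0∞), ENNReal.mul_div_cancel_right (by simp) (by simp)]
  have hΩ : ∀ j, μ {x | x ∈ Q0 ∧ Kc j * α j < avgS μ (r j) (F j) (P x)} ≤ μ Q0 / (4 * m) := by
    intro j
    have := omega_bound μ hP hP0 hPt (hr j) (F j) hPQ (G.pos _ _) (G.fin _ _) (hα j) (c := 4 * m)
    rw [ENNReal.le_div_iff_mul_le (Or.inl hm4) (Or.inl (ENNReal.mul_ne_top (by simp) (by simp))), mul_comm]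
    exact this
  have hsub : {x | x ∈ Q0 ∧ c < nJ K I R (fun k i => ∏ j, avgS μ (r j) (f j k) (R i) ^ q) (T / q)
      (fam GG Q0 x)} ⊆ (⋃ j, {x | x ∈ Q0 ∧ Kc j * α j < avgS μ (r j) (F j) (P x)}) ∪ {x | c < nn' x} := by
    rintro x ⟨hxQ, hxc⟩
    by_cases hxs : st (P x)
    · left
      obtain ⟨j, hj⟩ := hxs
      exact Set.mem_iUnion.2 ⟨j, hxQ, hj⟩
    · right
      refine lt_of_lt_of_le hxc ?_
      have h1 := nJ_fam_pow_le K I R (fun k i => ∏ j, avgS μ (r j) (f j k) (R i) ^ q) hs GG Q0 x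
      have h2 := ENNReal.rpow_le_rpow h1 (z := 1 / (T / q)) (by positivity)
      rw [← ENNReal.rpow_mul, mul_one_div_cancel hs0.ne', ENNReal.rpow_one] at h2
      refine h2.trans (ENNReal.rpow_le_rpow (Finset.sum_le_sum fun k hk =>
        ENNReal.rpow_le_rpow (Finset.sum_le_sum fun i hi => ?_) hs0.le) (by positivity))
      obtain ⟨hi1, hi2⟩ := Finset.mem_filter.1 hi
      by_cases hxi : x ∈ R i
      · simp only [Set.indicator_of_mem hxi]
        refine Finset.prod_le_prod' fun j _ => ENNReal.rpow_le_rpow ?_ hq.le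
        refine avg_part_le μ hP hP0 hPt (hr j) _ _ ?_ ?_
        · intro y hy
          have e : R i = G.C (n0 + (max (lev i) n0 - n0).toNat) x := by
            rw [hRG i] at hi2 hxi ⊢
            rw [← G.eq_of_mem hxi] at hi2 ⊢
            rw [G.level hi2]
            congr 1
            omega
          rw [e] at hy ⊢
          refine stop_sub G n0 L st hxs ?_ hy
          calc (max (lev i) n0 - n0).toNat ≤ (I k).sup fun i => (max (lev i) n0 - n0).toNat :=
                Finset.le_sup (f := fun i => (max (lev i) n0 - n0).toNat) hi1
            _ ≤ L := Finset.le_sup (f := fun k => (I k).sup fun i => (max (lev i) n0 - n0).toNat) hk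
        · intro y hy
          simp only [hgd, Set.indicator_of_mem (hi2 hy)]
      · simp [hxi]
  calc _ ≤ _ := measure_mono hsub
    _ ≤ _ := measure_union_le _ _
    _ ≤ ∑ j : Fin m, μ Q0 / (4 * m) + μ Q0 / 4 := by
      refine add_le_add ((measure_iUnion_fintype_le _ _).trans (Finset.sum_le_sum fun j _ => hΩ j)) hcheb
    _ = μ Q0 / 2 := by
      have e1 : ∑ j : Fin m, μ Q0 / (4 * m) = μ Q0 / 4 := by
        rw [Finset.sum_const, Finset.card_univ, Fintype.card_fin, nsmul_eq_mul, div_eq_mul_inv,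
          ENNReal.mul_inv (Or.inl (by simp)) (Or.inl (by simp)), div_eq_mul_inv]
        calc (m : ℝ≥0∞) * (μ Q0 * (4⁻¹ * (m : ℝ≥0∞)⁻¹)) = μ Q0 * 4⁻¹ * (m * (m : ℝ≥0∞)⁻¹) := by ring
          _ = _ := by rw [ENNReal.mul_inv_cancel (by simp [hm]) (by simp), mul_one]
      rw [e1, ← two_mul, ← mul_div_assoc]
      rw [show (4 : ℝ≥0∞) = 2 * 2 by norm_num]
      exact ENNReal.mul_div_mul_left _ _ (by simp) (by simp)

lemma avg_fin {X : Type*} [MeasurableSpace X] (μ : Measure X) [SFinite μ] {R : Set X}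
    (hR : MeasurableSet R) (hR0 : μ R ≠ 0)
    {r : ℝ} (hr : 0 < r) {p : ℝ≥0∞} (hrp : ENNReal.ofReal r < p) {e : ℝ} (he : 0 < e)
    (hre : 1 / r = 1 / e + (p⁻¹).toReal)
    (v : X → ℝ≥0∞) (hv : Measurable v) (hv0 : ∀ x, v x ≠ 0) (hvt : ∀ x, v x ≠ ∞)
    (hVt : ∫⁻ x in R, v x ∂μ ≠ ∞)
    (F : X → ℝ≥0∞) (hF : Measurable F) (N : ℝ≥0∞) (hN : N ≠ ∞)
    (h1 : p ≠ ∞ → ∫⁻ x, (F x * v x ^ (-(1 / e))) ^ p.toReal ∂μ ≤ N ^ p.toReal)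
    (h2 : p = ∞ → ∀ᵐ x ∂μ, F x * v x ^ (-(1 / e)) ≤ N) : avgS μ r F R ≠ ∞ := by
  have hV0 : ∫⁻ x in R, v x ∂μ ≠ 0 := by
    intro h
    rw [lintegral_eq_zero_iff hv] at h
    have : (μ.restrict R) Set.univ = 0 := by
      have h' : ∀ᵐ x ∂(μ.restrict R), False := by
        filter_upwards [h] with x hx; exact hv0 x hx
      simpa [ae_iff] using h'
    rw [Measure.restrict_apply_univ] at this
    exact hR0 this
  have key := phi_bound μ ({()} : Finset Unit) (fun _ => R) (fun _ => R)
    (fun i _ j _ => Or.inl subset_rfl) (fun _ _ => hR) (fun _ _ => hR) (fun _ _ => subset_rfl)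
    (by simp) hr hrp he hre v hv hv0 hvt (fun _ _ => hVt) (fun _ _ => hV0) F hF N h1 h2
  have hD : Dj r p ≠ ∞ := Dj_ne_top (m := 1) (fun _ => r) (fun _ => p) (fun _ => hr) (fun _ => hrp) 0
  have hpt : ((∫⁻ x in R, F x ^ r ∂μ) / ∫⁻ x in R, v x ∂μ) ^ (1 / r) *
      (∫⁻ x in R, v x ∂μ) ^ (p⁻¹).toReal ≠ ∞ := by
    by_cases hp : p = ∞
    · exact ne_top_of_le_ne_top (ENNReal.mul_ne_top hD hN) (key.2 hp () (by simp))
    · have hp0 : 0 < p.toReal := ENNReal.toReal_pos (ne_zero_of_lt hrp) hp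
      have h3 := key.1 hp
      rw [Finset.sum_singleton] at h3
      rw [ENNReal.rpow_le_rpow_iff hp0] at h3
      exact ne_top_of_le_ne_top (ENNReal.mul_ne_top hD hN) h3
  have h4 : (∫⁻ x in R, F x ^ r ∂μ) ≠ ∞ := by
    intro h
    apply hpt
    rw [h, ENNReal.top_div_of_ne_top hVt, ENNReal.top_rpow_of_pos (by positivity), ENNReal.top_mul]
    exact (ENNReal.rpow_pos (pos_iff_ne_zero.2 hV0) hVt).ne'
  rw [avgS]
  exact ENNReal.rpow_ne_top_of_nonneg (by positivity) (ENNReal.div_ne_top h4 hR0)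

theorem grid_bound {X ι κ : Type*} [MeasurableSpace X] (μ : Measure X) [SFinite μ] (G : Grid μ)
    {m : ℕ} (r : Fin m → ℝ) (p t : Fin m → ℝ≥0∞) (hr : ∀ j, 0 < r j)
    (hrp : ∀ j, ENNReal.ofReal (r j) < p j)
    (hrt : ∀ j, ENNReal.ofReal (r j) < t j) {P T q γ γt : ℝ} (hP : 0 < P) (hqP : q ≤ P)
    (hPp : ∑ j, ((p j)⁻¹).toReal = 1 / P)
    (hγ1 : ∀ j, expE r p j / r j ≤ γ) (hγ2 : P / q ≤ γ)
    (hT : 0 < T) (hq : 0 < q) (hqT : q ≤ T)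
    (hTt : ∑ j, ((t j)⁻¹).toReal = 1 / T)
    (hγt1 : ∀ j, expE r t j / r j ≤ γt) (hγt2 : T / q ≤ γt)
    (K : Finset κ) (I : κ → Finset ι) (lev : ι → ℤ) (ctr : ι → X) (R : ι → Set X)
    (hRG : ∀ i, R i = G.C (lev i) (ctr i)) (E : κ → ι → Set X)
    (hE : ∀ k ∈ K, ∀ i ∈ I k, MeasurableSet (E k i))
    (hER : ∀ k ∈ K, ∀ i ∈ I k, E k i ⊆ R i)
    (hdisj : ∀ k ∈ K, (I k : Set ι).PairwiseDisjoint (E k))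
    {Λ : ℝ≥0∞} (hΛ : Λ ≠ ∞) (hRE : ∀ k ∈ K, ∀ i ∈ I k, μ (R i) ≤ Λ * μ (E k i))
    (f : Fin m → κ → X → ℝ≥0∞) (hf : ∀ j k, Measurable (f j k))
    (v : Fin m → X → ℝ≥0∞) (hv : ∀ j, Measurable (v j)) (hv0 : ∀ j x, v j x ≠ 0)
    (hvt : ∀ j x, v j x ≠ ∞) (hVt : ∀ j i, ∫⁻ x in R i, v j x ∂μ ≠ ∞)
    (W : X → ℝ≥0∞) (hW : Measurable W) (hW0 : ∀ x, W x ≠ 0)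
    (hWt : ∀ i, ∫⁻ x in R i, W x ∂μ ≠ ∞)
    (hvW : ∀ x, (∏ j, v j x ^ (1 / expE r p j)) * W x ^ (1 / P) = 1)
    {A : ℝ≥0∞} (hAt : A ≠ ∞)
    (hA : ∀ i, (∏ j, ((∫⁻ x in R i, v j x ∂μ) / μ (R i)) ^ (1 / expE r p j)) *
      ((∫⁻ x in R i, W x ∂μ) / μ (R i)) ^ (1 / P) ≤ A)
    (F : Fin m → X → ℝ≥0∞) (hF : ∀ j, Measurable (F j)) (N : Fin m → ℝ≥0∞) (hN : ∀ j, N j ≠ ∞)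
    (h1 : ∀ j, p j ≠ ∞ → ∫⁻ x, (F j x * v j x ^ (-(1 / expE r p j))) ^ (p j).toReal ∂μ ≤
      N j ^ (p j).toReal)
    (h2 : ∀ j, p j = ∞ → ∀ᵐ x ∂μ, F j x * v j x ^ (-(1 / expE r p j)) ≤ N j)
    (hF1 : ∀ j, t j ≠ ∞ → ∀ x, ∑ k ∈ K, f j k x ^ (t j).toReal ≤ F j x ^ (t j).toReal)
    (hF2 : ∀ j, t j = ∞ → ∀ k ∈ K, ∀ x, f j k x ≤ F j x) :
    ∫⁻ x, (∑ k ∈ K, (∑ i ∈ I k, (R i).indicator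
        (fun _ => ∏ j, avgS μ (r j) (f j k) (R i) ^ q) x) ^ (T / q)) ^ (P / T) * W x ∂μ
      ≤ wC r t T q γt Λ G.D ^ (P / q) * (sC r p P q γ 2 * A ^ γ * ∏ j, N j) ^ P := by
  classical
  have hs : 1 ≤ T / q := (one_le_div hq).2 hqT
  have hs0 : 0 < T / q := by positivity
  have hfin : ∀ j i, avgS μ (r j) (F j) (R i) ≠ ∞ := fun j i =>
    avg_fin μ (by rw [hRG]; exact G.meas _ _) (by rw [hRG]; exact G.pos _ _) (hr j) (hrp j)
      (expE_pos r p hr hrp j) (expE_eq r p j) (v j) (hv j) (hv0 j) (hvt j) (hVt j i) (F j) (hF j)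
      (N j) (hN j) (h1 j) (h2 j)
  set b : κ → ι → ℝ≥0∞ := fun k i => ∏ j, avgS μ (r j) (f j k) (R i) ^ q with hb
  set n := nJ K I R b (T / q) with hn
  set GG : Finset (Set X) := K.biUnion fun k => (I k).image R with hGG
  have hGGm : ∀ Q ∈ GG, ∃ i, Q = R i := by
    intro Q hQ
    simp only [hGG, Finset.mem_biUnion, Finset.mem_image] at hQ
    obtain ⟨k, _, i, _, h⟩ := hQ
    exact ⟨i, h.symm⟩
  set w := wC r t T q γt Λ G.D with hw
  set AA : Set X → ℝ≥0∞ := fun Q => w * ∏ j, avgS μ (r j) (F j) Q ^ q with hAA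
  have hGmeas : ∀ Q ∈ GG, MeasurableSet Q := by
    intro Q hQ
    obtain ⟨i, rfl⟩ := hGGm Q hQ
    rw [hRG]; exact G.meas _ _
  have hGpos : ∀ Q ∈ GG, μ Q ≠ 0 := by
    intro Q hQ
    obtain ⟨i, rfl⟩ := hGGm Q hQ
    rw [hRG]; exact G.pos _ _
  have hGfin : ∀ Q ∈ GG, μ Q ≠ ∞ := by
    intro Q hQ
    obtain ⟨i, rfl⟩ := hGGm Q hQ
    rw [hRG]; exact G.fin _ _
  have hnest : ∀ Q ∈ GG, ∀ Q' ∈ GG, Q ⊆ Q' ∨ Q' ⊆ Q ∨ Disjoint Q Q' := by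
    intro Q hQ Q' hQ'
    obtain ⟨i, rfl⟩ := hGGm Q hQ
    obtain ⟨i', rfl⟩ := hGGm Q' hQ'
    rw [hRG i, hRG i']; exact G.nest _ _ _ _
  have hhalf : ∀ Q ∈ GG, μ Q ≤ 2 * μ (stopE GG n AA Q) := by
    intro Q hQ
    obtain ⟨i, hi⟩ := hGGm Q hQ
    have hwk := weak_type μ G r t hr hrt hT hq hqT hTt hγt1 hγt2 K I lev ctr R hRG E hE hER hdisj
      hΛ hRE f hf F hF1 hF2 GG (lev i) (ctr i) (by rw [← hRG]; exact fun j => hfin j i)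
    rw [← hRG, ← hi] at hwk
    have hcov : Q ⊆ {x | x ∈ Q ∧ w * ∏ j, avgS μ (r j) (F j) Q ^ q < n (fam GG Q x)} ∪ stopE GG n AA Q := by
      intro x hx
      by_cases h : n (fam GG Q x) ≤ AA Q
      · right; exact ⟨hx, h⟩
      · left; exact ⟨hx, not_le.1 h⟩
    have h3 : μ Q ≤ μ Q / 2 + μ (stopE GG n AA Q) :=
      (measure_mono hcov).trans ((measure_union_le _ _).trans (add_le_add hwk le_rfl))
    have h4 : μ Q / 2 ≤ μ (stopE GG n AA Q) := by
      have : μ Q / 2 + μ Q / 2 ≤ μ Q / 2 + μ (stopE GG n AA Q) := by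
        rw [ENNReal.add_halves]; exact h3
      exact (ENNReal.add_le_add_iff_left (ENNReal.div_ne_top (hGfin Q hQ) (by simp))).1 this
    calc μ Q = 2 * (μ Q / 2) := (ENNReal.mul_div_cancel (by simp) (by simp)).symm
      _ ≤ _ := mul_le_mul' le_rfl h4
  have hne : ∀ Q ∈ GG, (stopE GG n AA Q).Nonempty := by
    intro Q hQ
    rw [Set.nonempty_iff_ne_empty]
    intro h
    have := hhalf Q hQ
    rw [h] at this
    simp at this
    exact hGpos Q hQ this
  obtain ⟨S, hSG, hSd, hSn⟩ := stopping GG hnest n (fun J J' h => nJ_mono K I R b hs J J' h)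
    (fun J J' => nJ_sub K I R b hs J J') (nJ_empty K I R b hs) AA hne
  have hss := scalar_sparse μ r p hr hrp hP hq hqP hPp hγ1 hγ2 S (fun Q => Q) (stopE GG n AA)
    (fun Q hQ Q' hQ' => hnest Q (hSG hQ) Q' (hSG hQ')) (fun Q hQ => hGmeas Q (hSG hQ))
    (fun Q hQ => stopE_meas GG hGmeas n AA (hGmeas Q (hSG hQ))) (fun Q hQ x hx => hx.1) hSd
    (fun Q hQ => hGpos Q (hSG hQ)) (fun Q hQ => hGfin Q (hSG hQ)) (Λ := 2) (by simp)
    (fun Q hQ => hhalf Q (hSG hQ)) v hv hv0 hvt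
    (fun j Q hQ => by obtain ⟨i, rfl⟩ := hGGm Q (hSG hQ); exact hVt j i) W hW hW0
    (fun Q hQ => by obtain ⟨i, rfl⟩ := hGGm Q (hSG hQ); exact hWt i) hvW hAt
    (fun Q hQ => by obtain ⟨i, rfl⟩ := hGGm Q (hSG hQ); exact hA i) F hF N hN h1 h2
  have hpt : ∀ x, (∑ k ∈ K, (∑ i ∈ I k, (R i).indicator (fun _ => b k i) x) ^ (T / q)) ^ (P / T)
      ≤ w ^ (P / q) * (∑ Q ∈ S, Q.indicator (fun _ => ∏ j, avgS μ (r j) (F j) Q ^ q) x) ^ (P / q) := by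
    intro x
    have e1 : (∑ k ∈ K, (∑ i ∈ I k, (R i).indicator (fun _ => b k i) x) ^ (T / q)) ^ (P / T) =
        n (fam GG Set.univ x) ^ (P / q) := by
      rw [hn, nJ, ← ENNReal.rpow_mul]
      congr 1
      · refine Finset.sum_congr rfl fun k hk => ?_
        congr 1
        rw [Finset.sum_filter]
        refine Finset.sum_congr rfl fun i hi => ?_
        have : R i ∈ fam GG Set.univ x ↔ x ∈ R i := by
          rw [mem_fam]
          constructor
          · exact fun h => h.2.2
          · intro h
            refine ⟨?_, Set.subset_univ _, h⟩
            simp only [hGG, Finset.mem_biUnion, Finset.mem_image]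
            exact ⟨k, hk, i, hi, rfl⟩
        by_cases hx : x ∈ R i
        · simp [this, hx]
        · simp [this, hx]
      · field_simp
    rw [e1, ← ENNReal.mul_rpow_of_nonneg _ _ (by positivity)]
    refine ENNReal.rpow_le_rpow ((hSn x).trans (le_of_eq ?_)) (by positivity)
    rw [Finset.mul_sum]
    refine Finset.sum_congr rfl fun Q _ => ?_
    by_cases hx : x ∈ Q
    · simp [hx, hAA]
    · simp [hx]
  have hmeasS : Measurable (fun x => (∑ Q ∈ S, Q.indicator (fun _ => ∏ j, avgS μ (r j) (F j) Q ^ q) x) ^ (P / q) * W x) := by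
    refine Measurable.mul (Measurable.pow_const (Finset.measurable_sum _ fun Q hQ => ?_) _) hW
    exact measurable_const.indicator (hGmeas Q (hSG hQ))
  calc _ ≤ ∫⁻ x, w ^ (P / q) * ((∑ Q ∈ S, Q.indicator (fun _ => ∏ j, avgS μ (r j) (F j) Q ^ q) x) ^ (P / q) * W x) ∂μ := by
        refine lintegral_mono fun x => ?_
        rw [← mul_assoc]
        exact mul_le_mul' (hpt x) le_rfl
    _ = w ^ (P / q) * ∫⁻ x, (∑ Q ∈ S, Q.indicator (fun _ => ∏ j, avgS μ (r j) (F j) Q ^ q) x) ^ (P / q) * W x ∂μ :=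
        lintegral_const_mul _ hmeasS
    _ ≤ _ := mul_le_mul' le_rfl hss

lemma Cube.set_eq {d : ℕ} (Q : Cube d) :
    Q.set = Set.univ.pi fun i => Set.Ico (Q.corner i) (Q.corner i + Q.side) := by
  ext x; simp [Cube.set, Set.mem_pi]

lemma Cube.meas {d : ℕ} (Q : Cube d) : MeasurableSet Q.set := by
  rw [Q.set_eq]; exact MeasurableSet.univ_pi fun i => measurableSet_Ico

lemma Cube.vol_eq {d : ℕ} (Q : Cube d) : volume Q.set = ENNReal.ofReal Q.side ^ d := by
  rw [Q.set_eq, Real.volume_pi_Ico]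
  simp

lemma Cube.vol_pos {d : ℕ} (Q : Cube d) : volume Q.set ≠ 0 := by
  rw [Q.vol_eq]; exact pow_ne_zero _ (by simp [Q.side_pos])

lemma Cube.vol_fin {d : ℕ} (Q : Cube d) : volume Q.set ≠ ∞ := by
  rw [Q.vol_eq]; exact ENNReal.pow_ne_top (by simp)

def gsh {d : ℕ} (α : Fin d → Bool) (n : ℤ) (i : Fin d) : ℤ :=
  if α i then (if Even n then 1 else -1) else 0

lemma gsh_succ {d : ℕ} (α : Fin d → Bool) (n : ℤ) (i : Fin d) : gsh α (n + 1) i = - gsh α n i := by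
  unfold gsh
  by_cases h : Even n <;> by_cases h2 : α i <;> simp [h, h2]

def gidx {d : ℕ} (α : Fin d → Bool) (n : ℤ) (x : Fin d → ℝ) (i : Fin d) : ℤ :=
  ⌊(2 : ℝ) ^ n * x i - (gsh α n i : ℝ) / 3⌋

lemma gidx_succ {d : ℕ} (α : Fin d → Bool) (n : ℤ) (x : Fin d → ℝ) (i : Fin d) :
    gidx α n x i = (gidx α (n + 1) x i - gsh α n i) / 2 := by
  unfold gidx
  rw [gsh_succ, ← Int.floor_sub_intCast]
  have := Int.floor_div_natCast ((2 : ℝ) ^ (n + 1) * x i - ((-gsh α n i : ℤ) : ℝ) / 3 - (gsh α n i : ℝ)) 2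
  rw [Nat.cast_ofNat, Nat.cast_ofNat] at this
  rw [← this]
  congr 1
  rw [zpow_add_one₀ (by norm_num)]
  push_cast
  ring

def cellCube {d : ℕ} (α : Fin d → Bool) (n : ℤ) (x : Fin d → ℝ) : Cube d where
  corner i := ((gidx α n x i : ℝ) + (gsh α n i : ℝ) / 3) * ((2 : ℝ) ^ n)⁻¹
  side := ((2 : ℝ) ^ n)⁻¹
  side_pos := by positivity

lemma mem_cell {d : ℕ} (α : Fin d → Bool) (n : ℤ) (x y : Fin d → ℝ) :
    y ∈ (cellCube α n x).set ↔ gidx α n y = gidx α n x := by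
  have h2 : (0 : ℝ) < 2 ^ n := by positivity
  rw [funext_iff]
  refine forall_congr' fun i => ?_
  simp only [cellCube]
  rw [show gidx α n y i = ⌊(2 : ℝ) ^ n * y i - (gsh α n i : ℝ) / 3⌋ from rfl, Int.floor_eq_iff, ← add_one_mul, ← div_eq_mul_inv, ← div_eq_mul_inv, div_le_iff₀ h2, lt_div_iff₀ h2]
  constructor
  · rintro ⟨h, h'⟩; constructor <;> linarith
  · rintro ⟨h, h'⟩; constructor <;> linarith

def dGrid {d : ℕ} (α : Fin d → Bool) : Grid (volume : Measure (Fin d → ℝ)) where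
  C n x := (cellCube α n x).set
  mem n x := (mem_cell α n x x).2 rfl
  eq_of_mem {n x y} h := by
    ext z
    rw [mem_cell, mem_cell, (mem_cell α n x y).1 h]
  mono1 n x := by
    intro y hy
    rw [mem_cell] at hy ⊢
    funext i
    rw [gidx_succ α n y, gidx_succ α n x, hy]
  meas n x := Cube.meas _
  pos n x := Cube.vol_pos _
  fin n x := Cube.vol_fin _
  D := 2 ^ d
  D_ne := by simp
  doubling n x := by
    rw [Cube.vol_eq, Cube.vol_eq, ← mul_pow]
    refine le_of_eq ?_
    congr 1
    simp only [cellCube]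
    rw [show (2 : ℝ≥0∞) = ENNReal.ofReal 2 by simp, ← ENNReal.ofReal_mul (by norm_num)]
    congr 1
    rw [zpow_add_one₀ (by norm_num)]
    field_simp
  ctb n := by
    have : Set.range (fun x => (cellCube α n x).set) ⊆
        Set.range (fun k : Fin d → ℤ => {y | gidx α n y = k}) := by
      rintro _ ⟨x, rfl⟩
      refine ⟨gidx α n x, ?_⟩
      ext y
      rw [mem_cell]; rfl
    exact (Set.countable_range _).mono this

lemma cover {d : ℕ} (Q : Cube d) : ∃ (α : Fin d → Bool) (n : ℤ) (x : Fin d → ℝ),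
    Q.set ⊆ (cellCube α n x).set ∧ volume (cellCube α n x).set ≤ 6 ^ d * volume Q.set := by
  have hl := Q.side_pos
  obtain ⟨n, hn1, hn2⟩ := exists_mem_Ioc_zpow (x := 1 / (3 * Q.side)) (y := (2 : ℝ)) (by positivity) (by norm_num)
  have h2 : (0 : ℝ) < 2 ^ n := by positivity
  rw [zpow_add_one₀ (by norm_num), div_le_iff₀ (by positivity)] at hn2
  rw [lt_div_iff₀ (by positivity)] at hn1
  have hx : ∀ i, ∃ b : Bool, ∀ y : ℝ, Q.corner i ≤ y → y < Q.corner i + Q.side →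
      ⌊(2 : ℝ) ^ n * y - ((if b then (if Even n then 1 else -1) else 0 : ℤ) : ℝ) / 3⌋ =
      ⌊(2 : ℝ) ^ n * Q.corner i - ((if b then (if Even n then 1 else -1) else 0 : ℤ) : ℝ) / 3⌋ := by
    intro i
    have hy : ∀ y : ℝ, Q.corner i ≤ y → y < Q.corner i + Q.side →
        2 ^ n * Q.corner i ≤ 2 ^ n * y ∧ 2 ^ n * y < 2 ^ n * Q.corner i + 2 ^ n * Q.side := by
      intro y h1 h3
      constructor
      · exact mul_le_mul_of_nonneg_left h1 h2.le
      · rw [← mul_add]; exact mul_lt_mul_of_pos_left h3 h2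
    set a := (2 : ℝ) ^ n * Q.corner i
    set δ := (2 : ℝ) ^ n * Q.side with hδ
    have hδ3 : 3 * δ < 1 := by rw [hδ]; linarith
    have hδ0 : 0 < δ := by positivity
    have ha1 := Int.floor_le a
    have ha2 := Int.lt_floor_add_one a
    by_cases hc : a + δ ≤ ⌊a⌋ + 1
    · refine ⟨false, fun y h1 h3 => ?_⟩
      obtain ⟨h4, h5⟩ := hy y h1 h3
      simp only [Bool.false_eq_true, if_false, Int.cast_zero, zero_div, sub_zero]
      rw [Int.floor_eq_iff]
      constructor <;> linarith
    · push Not at hc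
      refine ⟨true, fun y h1 h3 => ?_⟩
      obtain ⟨h4, h5⟩ := hy y h1 h3
      by_cases he : Even n
      · simp only [he, if_true, Int.cast_one]
        have e1 : ⌊a - 1 / 3⌋ = ⌊a⌋ := by
          rw [Int.floor_eq_iff]; constructor <;> linarith
        rw [e1, Int.floor_eq_iff]
        constructor <;> linarith
      · simp only [he, if_true, if_false, Int.cast_neg, Int.cast_one]
        have e1 : ⌊a - -1 / 3⌋ = ⌊a⌋ + 1 := by
          rw [Int.floor_eq_iff]; push_cast; constructor <;> linarith
        rw [e1, Int.floor_eq_iff]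
        push_cast
        constructor <;> linarith
  choose α hα using hx
  refine ⟨α, n, Q.corner, ?_, ?_⟩
  · intro y hy
    rw [mem_cell]
    funext i
    exact hα i (y i) (hy i).1 (hy i).2
  · rw [Cube.vol_eq, Cube.vol_eq, ← mul_pow]
    refine pow_le_pow_left' ?_ d
    rw [show (6 : ℝ≥0∞) = ENNReal.ofReal 6 by simp, ← ENNReal.ofReal_mul (by norm_num)]
    refine ENNReal.ofReal_le_ofReal ?_
    simp only [cellCube]
    rw [inv_le_iff_one_le_mul₀ h2]
    linarith

lemma split_aux {κ β : Type*} [Fintype β] (K : Finset κ) (Y : κ → β → ℝ≥0∞) {s u : ℝ}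
    (hs : 0 < s) (hu : 0 < u) :
    (∑ k ∈ K, (∑ a, Y k a) ^ s) ^ u ≤
      ((Fintype.card β : ℝ≥0∞) ^ s) ^ u * (Fintype.card β : ℝ≥0∞) ^ u * ∑ a, (∑ k ∈ K, Y k a ^ s) ^ u := by
  have h1 : ∑ k ∈ K, (∑ a, Y k a) ^ s ≤ (Fintype.card β : ℝ≥0∞) ^ s * ∑ a, ∑ k ∈ K, Y k a ^ s := by
    rw [Finset.sum_comm, Finset.mul_sum]
    refine Finset.sum_le_sum fun k _ => ?_
    exact sum_rpow_crude Finset.univ (fun a => Y k a) hs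
  refine (ENNReal.rpow_le_rpow h1 hu.le).trans ?_
  rw [ENNReal.mul_rpow_of_nonneg _ _ hu.le, mul_assoc]
  refine mul_le_mul' le_rfl ?_
  exact sum_rpow_crude Finset.univ (fun a => ∑ k ∈ K, Y k a ^ s) hu

/-- total constant -/
def tC {m : ℕ} (d : ℕ) (r : Fin m → ℝ) (p t : Fin m → ℝ≥0∞) (P T q γ γt : ℝ) : ℝ≥0∞ :=
  (∏ j, ((6 ^ d) ^ (1 / r j)) ^ q) ^ (P / q) *
  ((((Fintype.card (Fin d → Bool) : ℝ≥0∞) ^ (T / q)) ^ (P / T) * (Fintype.card (Fin d → Bool) : ℝ≥0∞) ^ (P / T)) *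
  ((Fintype.card (Fin d → Bool) : ℝ≥0∞) * (wC r t T q γt (6 ^ d * 2) (2 ^ d) ^ (P / q) * (sC r p P q γ 2) ^ P)))

lemma tC_ne_top {m : ℕ} (d : ℕ) (r : Fin m → ℝ) (p t : Fin m → ℝ≥0∞) (hr : ∀ j, 0 < r j)
    (hrp : ∀ j, ENNReal.ofReal (r j) < p j)
    (hrt : ∀ j, ENNReal.ofReal (r j) < t j) {P T q γ γt : ℝ} (hP : 0 < P) (hqP : q ≤ P)
    (hγ2 : P / q ≤ γ) (hT : 0 < T) (hq : 0 < q) (hqT : q ≤ T) (hγt2 : T / q ≤ γt) :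
    tC d r p t P T q γ γt ≠ ∞ := by
  have hri : ∀ j, 0 < 1 / r j := fun j => one_div_pos.2 (hr j)
  have hc : (Fintype.card (Fin d → Bool) : ℝ≥0∞) ≠ ∞ := ENNReal.natCast_ne_top _
  unfold tC
  refine ENNReal.mul_ne_top ?_ (ENNReal.mul_ne_top (ENNReal.mul_ne_top ?_ ?_) (ENNReal.mul_ne_top hc
    (ENNReal.mul_ne_top ?_ ?_)))
  · exact ENNReal.rpow_ne_top_of_nonneg (by positivity) (ENNReal.prod_ne_top fun j _ =>
      ENNReal.rpow_ne_top_of_nonneg hq.le (ENNReal.rpow_ne_top_of_nonneg (hri j).le (by simp)))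
  · exact ENNReal.rpow_ne_top_of_nonneg (by positivity) (ENNReal.rpow_ne_top_of_nonneg (by positivity) hc)
  · exact ENNReal.rpow_ne_top_of_nonneg (by positivity) hc
  · exact ENNReal.rpow_ne_top_of_nonneg (by positivity) (wC_ne_top r t hr hrt hT hq hqT hγt2
      (ENNReal.mul_ne_top (by simp) (by simp)) (by simp))
  · exact ENNReal.rpow_ne_top_of_nonneg hP.le (sC_ne_top r p hr hrp hq hqP hγ2 (by simp))

theorem fin_bound {κ : Type*} {d : ℕ}
    {m : ℕ} (r : Fin m → ℝ) (p t : Fin m → ℝ≥0∞) (hr : ∀ j, 0 < r j)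
    (hrp : ∀ j, ENNReal.ofReal (r j) < p j)
    (hrt : ∀ j, ENNReal.ofReal (r j) < t j) {P T q γ γt : ℝ} (hP : 0 < P) (hqP : q ≤ P)
    (hPp : ∑ j, ((p j)⁻¹).toReal = 1 / P)
    (hγ1 : ∀ j, expE r p j / r j ≤ γ) (hγ2 : P / q ≤ γ)
    (hT : 0 < T) (hq : 0 < q) (hqT : q ≤ T)
    (hTt : ∑ j, ((t j)⁻¹).toReal = 1 / T)
    (hγt1 : ∀ j, expE r t j / r j ≤ γt) (hγt2 : T / q ≤ γt)
    (K : Finset κ) (J : κ → Finset (Cube d)) (E : κ → Cube d → Set (Fin d → ℝ))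
    (hE : ∀ k ∈ K, ∀ i ∈ J k, MeasurableSet (E k i))
    (hER : ∀ k ∈ K, ∀ i ∈ J k, E k i ⊆ i.set)
    (hdisj : ∀ k ∈ K, (J k : Set (Cube d)).PairwiseDisjoint (E k))
    (hRE : ∀ k ∈ K, ∀ i ∈ J k, volume i.set ≤ 2 * volume (E k i))
    (f : Fin m → κ → (Fin d → ℝ) → ℝ≥0∞) (hf : ∀ j k, Measurable (f j k))
    (v : Fin m → (Fin d → ℝ) → ℝ≥0∞) (hv : ∀ j, Measurable (v j)) (hv0 : ∀ j x, v j x ≠ 0)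
    (hvt : ∀ j x, v j x ≠ ∞) (hVt : ∀ j, ∀ i : Cube d, ∫⁻ x in i.set, v j x ≠ ∞)
    (W : (Fin d → ℝ) → ℝ≥0∞) (hW : Measurable W) (hW0 : ∀ x, W x ≠ 0)
    (hWt : ∀ i : Cube d, ∫⁻ x in i.set, W x ≠ ∞)
    (hvW : ∀ x, (∏ j, v j x ^ (1 / expE r p j)) * W x ^ (1 / P) = 1)
    {A : ℝ≥0∞} (hAt : A ≠ ∞)
    (hA : ∀ i : Cube d, (∏ j, ((∫⁻ x in i.set, v j x) / volume i.set) ^ (1 / expE r p j)) *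
      ((∫⁻ x in i.set, W x) / volume i.set) ^ (1 / P) ≤ A)
    (F : Fin m → (Fin d → ℝ) → ℝ≥0∞) (hF : ∀ j, Measurable (F j)) (N : Fin m → ℝ≥0∞) (hN : ∀ j, N j ≠ ∞)
    (h1 : ∀ j, p j ≠ ∞ → ∫⁻ x, (F j x * v j x ^ (-(1 / expE r p j))) ^ (p j).toReal ≤
      N j ^ (p j).toReal)
    (h2 : ∀ j, p j = ∞ → ∀ᵐ x, F j x * v j x ^ (-(1 / expE r p j)) ≤ N j)
    (hF1 : ∀ j, t j ≠ ∞ → ∀ x, ∑ k ∈ K, f j k x ^ (t j).toReal ≤ F j x ^ (t j).toReal)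
    (hF2 : ∀ j, t j = ∞ → ∀ k ∈ K, ∀ x, f j k x ≤ F j x) :
    ∫⁻ x, (∑ k ∈ K, (∑ i ∈ J k, (i.set).indicator
        (fun _ => ∏ j, avgS volume (r j) (f j k) i.set ^ q) x) ^ (T / q)) ^ (P / T) * W x
      ≤ tC d r p t P T q γ γt * (A ^ γ * ∏ j, N j) ^ P := by
  classical
  choose ca cn cx hcs hcv using cover (d := d)
  set Cd : ℝ≥0∞ := 6 ^ d with hCd
  set c : ℝ≥0∞ := ∏ j, (Cd ^ (1 / r j)) ^ q with hc
  have hCdt : Cd ≠ ∞ := by simp [hCd]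
  set R : (Fin d → Bool) → Cube d → Set (Fin d → ℝ) := fun a Q => (cellCube a (cn Q) (cx Q)).set with hR
  set Jf : (Fin d → Bool) → κ → Finset (Cube d) := fun a k => (J k).filter (fun Q => ca Q = a) with hJf
  have hsub : ∀ a k, ∀ i ∈ Jf a k, i ∈ J k ∧ i.set ⊆ R a i ∧ volume (R a i) ≤ Cd * volume i.set := by
    intro a k i hi
    obtain ⟨h3, h4⟩ := Finset.mem_filter.1 hi
    refine ⟨h3, ?_, ?_⟩
    · rw [← h4]; exact hcs i
    · rw [← h4]; exact hcv i
  set Y : (Fin d → ℝ) → κ → (Fin d → Bool) → ℝ≥0∞ := fun x k a => ∑ i ∈ Jf a k, (R a i).indicator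
    (fun _ => ∏ j, avgS volume (r j) (f j k) (R a i) ^ q) x with hY
  have hgb : ∀ a, ∫⁻ x, (∑ k ∈ K, (Y x k a) ^ (T / q)) ^ (P / T) * W x ≤
      wC r t T q γt (6 ^ d * 2) (2 ^ d) ^ (P / q) * (sC r p P q γ 2 * A ^ γ * ∏ j, N j) ^ P := by
    intro a
    refine grid_bound volume (dGrid a) r p t hr hrp hrt hP hqP hPp hγ1 hγ2 hT hq hqT hTt hγt1 hγt2 K
      (Jf a) cn cx (R a) (fun i => rfl) E (fun k hk i hi => hE k hk i (hsub a k i hi).1)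
      (fun k hk i hi => (hER k hk i (hsub a k i hi).1).trans (hsub a k i hi).2.1)
      (fun k hk => (hdisj k hk).subset fun i hi => (hsub a k i hi).1)
      (Λ := 6 ^ d * 2) (ENNReal.mul_ne_top hCdt (by simp)) ?_ f hf v hv hv0 hvt (fun j i => hVt j _) W hW hW0
      (fun i => hWt _) hvW hAt (fun i => hA _) F hF N hN h1 h2 hF1 hF2
    intro k hk i hi
    refine (hsub a k i hi).2.2.trans ?_
    rw [mul_assoc]
    exact mul_le_mul' le_rfl (hRE k hk i (hsub a k i hi).1)
  have hpt : ∀ x, ∀ k, ∑ i ∈ J k, (i.set).indicator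
      (fun _ => ∏ j, avgS volume (r j) (f j k) i.set ^ q) x ≤ ∑ a, c * Y x k a := by
    intro x k
    rw [← Finset.sum_fiberwise (J k) ca]
    refine Finset.sum_le_sum fun a _ => ?_
    rw [hY, Finset.mul_sum]
    refine Finset.sum_le_sum fun i hi => ?_
    obtain ⟨_, h4, h5⟩ := hsub a k i hi
    by_cases hx : x ∈ i.set
    · rw [Set.indicator_of_mem hx, Set.indicator_of_mem (h4 hx), hc, ← Finset.prod_mul_distrib]
      refine Finset.prod_le_prod' fun j _ => ?_
      rw [← ENNReal.mul_rpow_of_nonneg _ _ hq.le]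
      exact ENNReal.rpow_le_rpow (avgS_mono_set volume (hr j) _ h4 i.vol_pos hCdt h5) hq.le
    · rw [Set.indicator_of_notMem hx]; exact zero_le
  have hYm : ∀ a, Measurable (fun x => (∑ k ∈ K, (Y x k a) ^ (T / q)) ^ (P / T) * W x) := by
    intro a
    refine Measurable.mul (Measurable.pow_const (Finset.measurable_sum _ fun k _ =>
      Measurable.pow_const (Finset.measurable_sum _ fun i _ => ?_) _) _) hW
    exact measurable_const.indicator (Cube.meas _)
  set M : ℝ≥0∞ := ((Fintype.card (Fin d → Bool) : ℝ≥0∞) ^ (T / q)) ^ (P / T) *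
    (Fintype.card (Fin d → Bool) : ℝ≥0∞) ^ (P / T) with hM
  have hpt2 : ∀ x, (∑ k ∈ K, (∑ i ∈ J k, (i.set).indicator
        (fun _ => ∏ j, avgS volume (r j) (f j k) i.set ^ q) x) ^ (T / q)) ^ (P / T) * W x ≤
      c ^ (P / q) * M * ∑ a, (∑ k ∈ K, (Y x k a) ^ (T / q)) ^ (P / T) * W x := by
    intro x
    have e1 : (∑ k ∈ K, (∑ i ∈ J k, (i.set).indicator
        (fun _ => ∏ j, avgS volume (r j) (f j k) i.set ^ q) x) ^ (T / q)) ^ (P / T) ≤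
        c ^ (P / q) * (∑ k ∈ K, (∑ a, Y x k a) ^ (T / q)) ^ (P / T) := by
      have : ∑ k ∈ K, (∑ i ∈ J k, (i.set).indicator
        (fun _ => ∏ j, avgS volume (r j) (f j k) i.set ^ q) x) ^ (T / q) ≤
          c ^ (T / q) * ∑ k ∈ K, (∑ a, Y x k a) ^ (T / q) := by
        rw [Finset.mul_sum]
        refine Finset.sum_le_sum fun k _ => ?_
        rw [← ENNReal.mul_rpow_of_nonneg _ _ (by positivity), Finset.mul_sum]
        exact ENNReal.rpow_le_rpow (hpt x k) (by positivity)
      refine (ENNReal.rpow_le_rpow this (by positivity)).trans (le_of_eq ?_)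
      rw [ENNReal.mul_rpow_of_nonneg _ _ (by positivity), ← ENNReal.rpow_mul]
      congr 2
      field_simp
    have e2 := split_aux K (Y x) (s := T / q) (u := P / T) (by positivity) (by positivity)
    rw [← Finset.sum_mul, ← mul_assoc, mul_assoc (c ^ (P / q))]
    refine mul_le_mul' (e1.trans (mul_le_mul' le_rfl ?_)) le_rfl
    exact e2
  calc _ ≤ ∫⁻ x, c ^ (P / q) * M * ∑ a, (∑ k ∈ K, (Y x k a) ^ (T / q)) ^ (P / T) * W x := lintegral_mono hpt2
    _ = c ^ (P / q) * M * ∑ a, ∫⁻ x, (∑ k ∈ K, (Y x k a) ^ (T / q)) ^ (P / T) * W x := by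
      rw [lintegral_const_mul _ (Finset.measurable_sum _ fun a _ => hYm a), lintegral_finsetSum _ fun a _ => hYm a]
    _ ≤ c ^ (P / q) * M * ∑ a : Fin d → Bool, wC r t T q γt (6 ^ d * 2) (2 ^ d) ^ (P / q) * (sC r p P q γ 2 * A ^ γ * ∏ j, N j) ^ P :=
      mul_le_mul' le_rfl (Finset.sum_le_sum fun a _ => hgb a)
    _ = _ := by
      rw [Finset.sum_const, nsmul_eq_mul, Finset.card_univ, tC, mul_assoc (sC r p P q γ 2),
        ENNReal.mul_rpow_of_nonneg _ _ hP.le, ← hM, ← hCd, ← hc]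
      ring

lemma rpow_iSup_aux {ι : Type*} (a : ι → ℝ≥0∞) {u : ℝ} (hu : 0 < u) :
    (⨆ i, a i) ^ u = ⨆ i, a i ^ u :=
  (ENNReal.orderIsoRpow u hu).map_iSup a

lemma exists_exhaust {ι : Type*} (S : Set ι) (hS : S.Countable) :
    ∃ s : ℕ → Finset S, Monotone s ∧ ∀ t : Finset S, ∃ n, t ⊆ s n := by
  have := hS.to_subtype
  obtain ⟨g, hg⟩ := exists_injective_nat S
  have hfin : ∀ n, {Q : S | g Q < n}.Finite := fun n =>
    Set.Finite.preimage hg.injOn (Set.finite_Iio n)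
  refine ⟨fun n => (hfin n).toFinset, ?_, ?_⟩
  · intro n n' h Q hQ
    simp only [Set.Finite.mem_toFinset, Set.mem_setOf_eq] at hQ ⊢
    omega
  · intro t
    refine ⟨t.sup g + 1, fun Q hQ => ?_⟩
    simp only [Set.Finite.mem_toFinset, Set.mem_setOf_eq]
    have := Finset.le_sup (f := g) hQ
    omega

lemma mct_aux {X ι : Type*} [MeasurableSpace X] (μ : Measure X) (h : ℕ → ι → X → ℝ≥0∞)
    (hm : ∀ k i, Measurable (h k i)) (W : X → ℝ≥0∞) (hW : Measurable W) (S : ℕ → Set ι)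
    (hS : ∀ k, (S k).Countable) {s u : ℝ} (hs : 0 < s) (hu : 0 < u) {M : ℝ≥0∞}
    (hM : ∀ (K : Finset ℕ) (J : ℕ → Finset ι), (∀ k, ∀ i ∈ J k, i ∈ S k) →
      ∫⁻ x, (∑ k ∈ K, (∑ i ∈ J k, h k i x) ^ s) ^ u * W x ∂μ ≤ M) :
    ∫⁻ x, (∑' k, (∑' i : S k, h k i x) ^ s) ^ u * W x ∂μ ≤ M := by
  classical
  choose e he1 he2 using fun k => exists_exhaust (S k) (hS k)
  have hts : ∀ k x, ∑' i : S k, h k i x = ⨆ n, ∑ i ∈ e k n, h k i x := fun k x =>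
    ENNReal.tsum_eq_iSup_sum' (e k) (he2 k)
  have hin : ∀ k, Monotone fun n => fun x => (∑ i ∈ e k n, h k i x) ^ s := by
    intro k n n' hn x
    exact ENNReal.rpow_le_rpow (Finset.sum_le_sum_of_subset (he1 k hn)) hs.le
  have step1 : ∀ K : Finset ℕ, ∫⁻ x, (∑ k ∈ K, (∑' i : S k, h k i x) ^ s) ^ u * W x ∂μ ≤ M := by
    intro K
    have e1 : ∀ x, (∑ k ∈ K, (∑' i : S k, h k i x) ^ s) ^ u * W x =
        ⨆ n, (∑ k ∈ K, (∑ i ∈ e k n, h k i x) ^ s) ^ u * W x := by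
      intro x
      rw [← ENNReal.iSup_mul, ← rpow_iSup_aux _ hu]
      congr 2
      simp only [hts, rpow_iSup_aux _ hs]
      exact ENNReal.finsetSum_iSup_of_monotone fun k n n' hn => hin k hn x
    simp only [e1]
    rw [lintegral_iSup]
    · refine iSup_le fun n => ?_
      have := hM K (fun k => (e k n).map (Function.Embedding.subtype _)) (by
        intro k i hi
        simp only [Finset.mem_map, Function.Embedding.subtype_apply] at hi
        obtain ⟨a, _, rfl⟩ := hi
        exact a.2)
      simpa only [Finset.sum_map, Function.Embedding.subtype_apply] using this
    · intro n
      have a1 : ∀ k, Measurable (fun x => ∑ i ∈ e k n, h k i x) := fun k =>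
        Finset.measurable_sum _ fun (i : S k) _ => hm k i
      have a2 : Measurable (fun x => ∑ k ∈ K, (∑ i ∈ e k n, h k i x) ^ s) :=
        Finset.measurable_sum _ fun k _ => (a1 k).pow_const s
      exact (a2.pow_const u).mul hW
    · intro n n' hn x
      refine mul_le_mul' (ENNReal.rpow_le_rpow (Finset.sum_le_sum fun k _ => hin k hn x) hu.le) le_rfl
  have e2 : ∀ x, (∑' k, (∑' i : S k, h k i x) ^ s) ^ u * W x =
      ⨆ n, (∑ k ∈ Finset.range n, (∑' i : S k, h k i x) ^ s) ^ u * W x := by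
    intro x
    rw [← ENNReal.iSup_mul, ← rpow_iSup_aux _ hu, ENNReal.tsum_eq_iSup_nat]
  simp only [e2]
  rw [lintegral_iSup]
  · exact iSup_le fun n => step1 _
  · intro n
    have a1 : ∀ k, Measurable (fun x => ∑' i : S k, h k i x) := by
      intro k
      simp only [hts]
      exact Measurable.iSup fun n => Finset.measurable_sum _ fun (i : S k) _ => hm k i
    have a2 : Measurable (fun x => ∑ k ∈ Finset.range n, (∑' i : S k, h k i x) ^ s) :=
      Finset.measurable_sum _ fun k _ => (a1 k).pow_const s
    exact (a2.pow_const u).mul hW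
  · intro n n' hn x
    refine mul_le_mul' (ENNReal.rpow_le_rpow (Finset.sum_le_sum_of_subset ?_) hu.le) le_rfl
    exact Finset.range_mono hn

lemma sparse_ctb {d : ℕ} (S : Set (Cube d)) (E : Cube d → Set (Fin d → ℝ))
    (hE : ∀ Q ∈ S, MeasurableSet (E Q) ∧ E Q ⊆ Q.set ∧ Q.vol ≤ 2 * volume (E Q))
    (hd : S.PairwiseDisjoint E) : S.Countable := by
  have h := Measure.countable_meas_pos_of_disjoint_iUnion (μ := (volume : Measure (Fin d → ℝ)))
    (As := fun Q : S => E Q) (fun Q => (hE Q Q.2).1) (by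
      intro Q Q' hne
      exact hd Q.2 Q'.2 (fun h => hne (Subtype.ext h)))
  have : {i : S | 0 < volume (E i)} = Set.univ := by
    rw [Set.eq_univ_iff_forall]
    intro Q
    have h1 := (hE Q Q.2).2.2
    rw [Set.mem_setOf_eq, pos_iff_ne_zero]
    intro h2
    rw [h2, mul_zero] at h1
    exact Q.1.vol_pos (le_antisymm h1 zero_le)
  rw [this, Set.countable_univ_iff] at h
  exact Set.countable_coe_iff.1 h

lemma ofReal_rr {m : ℕ} {r p : Fin m → ℝ≥0∞} (hr : ∀ j, 0 < r j ∧ r j ≠ ∞)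
    (hrp : ∀ j, r j < p j) (j : Fin m) : ENNReal.ofReal (r j).toReal < p j := by
  rw [ENNReal.ofReal_toReal (hr j).2]; exact hrp j

lemma rr_pos {m : ℕ} {r : Fin m → ℝ≥0∞} (hr : ∀ j, 0 < r j ∧ r j ≠ ∞) (j : Fin m) :
    0 < (r j).toReal := ENNReal.toReal_pos (hr j).1.ne' (hr j).2

lemma pinv_ne_top {m : ℕ} {r p : Fin m → ℝ≥0∞} (hr : ∀ j, 0 < r j ∧ r j ≠ ∞)
    (hrp : ∀ j, r j < p j) (j : Fin m) : (p j)⁻¹ ≠ ∞ := by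
  have := (hr j).1.trans (hrp j)
  simp [this.ne']

lemma diff_toReal {m : ℕ} {r p : Fin m → ℝ≥0∞} (hr : ∀ j, 0 < r j ∧ r j ≠ ∞)
    (hrp : ∀ j, r j < p j) (j : Fin m) : ((r j)⁻¹ - (p j)⁻¹).toReal =
      1 / (r j).toReal - ((p j)⁻¹).toReal := by
  rw [ENNReal.toReal_sub_of_le, ENNReal.toReal_inv, one_div]
  · exact ENNReal.inv_le_inv.2 (hrp j).le
  · simp [(hr j).1.ne']

lemma diff_pos {m : ℕ} {r p : Fin m → ℝ≥0∞} (hrp : ∀ j, r j < p j) (j : Fin m) :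
    (r j)⁻¹ - (p j)⁻¹ ≠ 0 := by
  rw [← pos_iff_ne_zero, tsub_pos_iff_lt]
  exact ENNReal.inv_lt_inv.2 (hrp j)

lemma diff_ne_top {m : ℕ} {r p : Fin m → ℝ≥0∞} (hr : ∀ j, 0 < r j ∧ r j ≠ ∞) (j : Fin m) :
    (r j)⁻¹ - (p j)⁻¹ ≠ ∞ := by
  apply ENNReal.sub_ne_top; simp [(hr j).1.ne']

lemma expE_toReal {m : ℕ} {r p : Fin m → ℝ≥0∞} (hr : ∀ j, 0 < r j ∧ r j ≠ ∞)
    (hrp : ∀ j, r j < p j) (j : Fin m) : (((r j)⁻¹ - (p j)⁻¹)⁻¹).toReal =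
      expE (fun j => (r j).toReal) p j := by
  rw [ENNReal.toReal_inv, diff_toReal hr hrp, expE]

lemma quot_toReal {m : ℕ} {r p : Fin m → ℝ≥0∞} (hr : ∀ j, 0 < r j ∧ r j ≠ ∞)
    (hrp : ∀ j, r j < p j) (j : Fin m) : ((r j)⁻¹ / ((r j)⁻¹ - (p j)⁻¹)).toReal =
      expE (fun j => (r j).toReal) p j / (r j).toReal := by
  rw [div_eq_mul_inv, ENNReal.toReal_mul, expE_toReal hr hrp, ENNReal.toReal_inv]
  ring

lemma quot_ne_top {m : ℕ} {r p : Fin m → ℝ≥0∞} (hr : ∀ j, 0 < r j ∧ r j ≠ ∞)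
    (hrp : ∀ j, r j < p j) (j : Fin m) : ((r j)⁻¹ / ((r j)⁻¹ - (p j)⁻¹)) ≠ ∞ := by
  apply ENNReal.div_ne_top
  · simp [(hr j).1.ne']
  · exact diff_pos hrp j

lemma isup_ne_top {m : ℕ} {r p : Fin m → ℝ≥0∞} (hr : ∀ j, 0 < r j ∧ r j ≠ ∞)
    (hrp : ∀ j, r j < p j) : (⨆ j, (r j)⁻¹ / ((r j)⁻¹ - (p j)⁻¹)) ≠ ∞ := by
  refine ne_top_of_le_ne_top (b := ∑ j, (r j)⁻¹ / ((r j)⁻¹ - (p j)⁻¹)) ?_ ?_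
  · exact ENNReal.sum_ne_top.2 fun j _ => quot_ne_top hr hrp j
  · exact iSup_le fun j => Finset.single_le_sum (f := fun j => (r j)⁻¹ / ((r j)⁻¹ - (p j)⁻¹)) (fun _ _ => zero_le) (Finset.mem_univ j)

lemma pE_pos {m : ℕ} {r p : Fin m → ℝ≥0∞} (hr : ∀ j, 0 < r j ∧ r j ≠ ∞)
    (hrp : ∀ j, r j < p j) (hp : (∑ j, (p j)⁻¹)⁻¹ ≠ ∞) : 0 < ((∑ j, (p j)⁻¹)⁻¹).toReal := by
  refine ENNReal.toReal_pos ?_ hp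
  rw [ENNReal.inv_ne_zero]
  exact ENNReal.sum_ne_top.2 fun j _ => pinv_ne_top hr hrp j

lemma pE_sum {m : ℕ} {r p : Fin m → ℝ≥0∞} (hr : ∀ j, 0 < r j ∧ r j ≠ ∞)
    (hrp : ∀ j, r j < p j) : ∑ j, ((p j)⁻¹).toReal = 1 / ((∑ j, (p j)⁻¹)⁻¹).toReal := by
  rw [ENNReal.toReal_inv, one_div, inv_inv, ENNReal.toReal_sum]
  exact fun j _ => pinv_ne_top hr hrp j

def gam {m : ℕ} (r p : Fin m → ℝ≥0∞) (qE : ℝ≥0∞) : ℝ :=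
  (max (⨆ j, (r j)⁻¹ / ((r j)⁻¹ - (p j)⁻¹)) ((∑ j, (p j)⁻¹)⁻¹ / qE)).toReal

lemma gam_ne_top {m : ℕ} {r p : Fin m → ℝ≥0∞} (hr : ∀ j, 0 < r j ∧ r j ≠ ∞)
    (hrp : ∀ j, r j < p j) (hp : (∑ j, (p j)⁻¹)⁻¹ ≠ ∞) {qE : ℝ≥0∞} (hq : 0 < qE) :
    (max (⨆ j, (r j)⁻¹ / ((r j)⁻¹ - (p j)⁻¹)) ((∑ j, (p j)⁻¹)⁻¹ / qE)) ≠ ∞ := by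
  rw [ne_eq, max_eq_top, not_or]
  exact ⟨isup_ne_top hr hrp, ENNReal.div_ne_top hp hq.ne'⟩

lemma gam1 {m : ℕ} {r p : Fin m → ℝ≥0∞} (hr : ∀ j, 0 < r j ∧ r j ≠ ∞)
    (hrp : ∀ j, r j < p j) (hp : (∑ j, (p j)⁻¹)⁻¹ ≠ ∞) {qE : ℝ≥0∞} (hq : 0 < qE) (j : Fin m) :
    expE (fun j => (r j).toReal) p j / (r j).toReal ≤ gam r p qE := by
  rw [← quot_toReal hr hrp, gam]
  refine ENNReal.toReal_mono (gam_ne_top hr hrp hp hq) (le_trans ?_ (le_max_left _ _))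
  exact le_iSup (fun j => (r j)⁻¹ / ((r j)⁻¹ - (p j)⁻¹)) j

lemma gam2 {m : ℕ} (hm : 1 ≤ m) {r p : Fin m → ℝ≥0∞} (hr : ∀ j, 0 < r j ∧ r j ≠ ∞)
    (hrp : ∀ j, r j < p j) (hp : (∑ j, (p j)⁻¹)⁻¹ ≠ ∞) {qE : ℝ≥0∞} (hq : 0 < qE) :
    ((∑ j, (p j)⁻¹)⁻¹).toReal / (min qE.toReal ((∑ j, (p j)⁻¹)⁻¹).toReal) ≤ gam r p qE := by
  have hP := pE_pos hr hrp hp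
  rcases min_choice qE.toReal ((∑ j, (p j)⁻¹)⁻¹).toReal with h | h
  · rw [h, gam, ← ENNReal.toReal_div]
    exact ENNReal.toReal_mono (gam_ne_top hr hrp hp hq) (le_max_right _ _)
  · rw [h, div_self hP.ne']
    refine le_trans ?_ (gam1 hr hrp hp hq ⟨0, hm⟩)
    rw [one_le_div (rr_pos hr _)]
    have h1 := expE_pos (fun j => (r j).toReal) p (rr_pos hr) (ofReal_rr hr hrp) ⟨0, hm⟩
    have h2 := expE_eq (fun j => (r j).toReal) p ⟨0, hm⟩
    have h3 : 0 ≤ ((p ⟨0, hm⟩)⁻¹).toReal := ENNReal.toReal_nonneg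
    rw [← one_div_le_one_div h1 (rr_pos hr _)]
    linarith

lemma avg_eq {d : ℕ} {r : ℝ≥0∞} (hr : r ≠ ∞) (F : (Fin d → ℝ) → ℝ≥0∞) (Q : Cube d) :
    avg r F Q = avgS volume r.toReal F Q.set := by
  rw [avg, if_neg hr, avgS, Cube.vol]

lemma prod_eq_top_aux {ι : Type*} (s : Finset ι) (a : ι → ℝ≥0∞) (h0 : ∀ i ∈ s, a i ≠ 0)
    {i : ι} (hi : i ∈ s) (ht : a i = ∞) : ∏ j ∈ s, a j = ∞ := by
  classical
  rw [← Finset.mul_prod_erase s a hi, ht, ENNReal.top_mul]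
  exact Finset.prod_ne_zero_iff.2 fun j hj => h0 j (Finset.mem_of_mem_erase hj)

def vW {d m : ℕ} (r p : Fin m → ℝ≥0∞) (w : Fin m → (Fin d → ℝ) → ℝ) (j : Fin m) (x : Fin d → ℝ) : ℝ≥0∞ :=
  ENNReal.ofReal (w j x)⁻¹ ^ expE (fun j => (r j).toReal) p j

def WW {d m : ℕ} (p : Fin m → ℝ≥0∞) (w : Fin m → (Fin d → ℝ) → ℝ) (x : Fin d → ℝ) : ℝ≥0∞ :=
  ENNReal.ofReal (∏ j, w j x) ^ ((∑ j, (p j)⁻¹)⁻¹).toReal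

section
variable {d m : ℕ} {r p : Fin m → ℝ≥0∞} (hr : ∀ j, 0 < r j ∧ r j ≠ ∞)
    (hrp : ∀ j, r j < p j) (hp : (∑ j, (p j)⁻¹)⁻¹ ≠ ∞)
    {w : Fin m → (Fin d → ℝ) → ℝ} (hwm : ∀ j, Measurable (w j)) (hw : ∀ j x, 0 < w j x)

lemma ee_pos {m : ℕ} {r p : Fin m → ℝ≥0∞} (hr : ∀ j, 0 < r j ∧ r j ≠ ∞)
    (hrp : ∀ j, r j < p j) (j : Fin m) : 0 < expE (fun j => (r j).toReal) p j :=
  expE_pos _ p (rr_pos hr) (ofReal_rr hr hrp) j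

lemma vW_meas (hwm : ∀ j, Measurable (w j)) (j : Fin m) : Measurable (vW r p w j) := by
  have a1 : Measurable (fun x => ENNReal.ofReal (w j x)⁻¹) := (hwm j).inv.ennreal_ofReal
  exact a1.pow_const _

lemma WW_meas (hwm : ∀ j, Measurable (w j)) : Measurable (WW p w) := by
  have a0 : Measurable (fun x => ∏ j, w j x) := Finset.measurable_prod _ fun j _ => hwm j
  exact a0.ennreal_ofReal.pow_const _

lemma vW_ne_zero (hw : ∀ j x, 0 < w j x) (j : Fin m) (x) : vW r p w j x ≠ 0 := by
  rw [vW, ← pos_iff_ne_zero]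
  exact ENNReal.rpow_pos (by simp [hw]) (by simp)

lemma vW_ne_top (hr : ∀ j, 0 < r j ∧ r j ≠ ∞)
    (hrp : ∀ j, r j < p j) (j : Fin m) (x) : vW r p w j x ≠ ∞ :=
  ENNReal.rpow_ne_top_of_nonneg (ee_pos hr hrp j).le (by simp)

lemma WW_ne_zero (hw : ∀ j x, 0 < w j x) (x) : WW p w x ≠ 0 := by
  rw [WW, ← pos_iff_ne_zero]
  refine ENNReal.rpow_pos ?_ (by simp)
  simpa using Finset.prod_pos fun j _ => hw j x

lemma vW_inv (hr : ∀ j, 0 < r j ∧ r j ≠ ∞)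
    (hrp : ∀ j, r j < p j) (j : Fin m) (x) :
    vW r p w j x ^ (1 / expE (fun j => (r j).toReal) p j) = ENNReal.ofReal (w j x)⁻¹ := by
  rw [vW, ← ENNReal.rpow_mul, mul_one_div, div_self (ee_pos hr hrp j).ne', ENNReal.rpow_one]

lemma vW_neg (hr : ∀ j, 0 < r j ∧ r j ≠ ∞)
    (hrp : ∀ j, r j < p j) (hw : ∀ j x, 0 < w j x) (j : Fin m) (x) :
    vW r p w j x ^ (-(1 / expE (fun j => (r j).toReal) p j)) = ENNReal.ofReal (w j x) := by
  rw [ENNReal.rpow_neg, vW_inv hr hrp, ENNReal.ofReal_inv_of_pos (hw j x), inv_inv]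

lemma vW_WW (hr : ∀ j, 0 < r j ∧ r j ≠ ∞)
    (hrp : ∀ j, r j < p j) (hp : (∑ j, (p j)⁻¹)⁻¹ ≠ ∞) (hw : ∀ j x, 0 < w j x) (x) :
    (∏ j, vW r p w j x ^ (1 / expE (fun j => (r j).toReal) p j)) *
      WW p w x ^ (1 / ((∑ j, (p j)⁻¹)⁻¹).toReal) = 1 := by
  rw [WW, ← ENNReal.rpow_mul, mul_one_div, div_self (pE_pos hr hrp hp).ne', ENNReal.rpow_one,
    ENNReal.ofReal_prod_of_nonneg (fun j _ => (hw j x).le), ← Finset.prod_mul_distrib]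
  refine Finset.prod_eq_one fun j _ => ?_
  rw [vW_inv hr hrp, ENNReal.ofReal_inv_of_pos (hw j x), ENNReal.inv_mul_cancel] <;> simp [hw]

lemma aC_le (hr : ∀ j, 0 < r j ∧ r j ≠ ∞)
    (hrp : ∀ j, r j < p j) (hp : (∑ j, (p j)⁻¹)⁻¹ ≠ ∞) (i : Cube d) :
    (∏ j, ((∫⁻ x in i.set, vW r p w j x) / volume i.set) ^ (1 / expE (fun j => (r j).toReal) p j)) *
      ((∫⁻ x in i.set, WW p w x) / volume i.set) ^ (1 / ((∑ j, (p j)⁻¹)⁻¹).toReal) ≤ aConst p r ∞ w := by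
  unfold aConst
  refine le_trans (le_of_eq ?_) (le_iSup _ i)
  have h1 : (∑ j, (p j)⁻¹) - (∞ : ℝ≥0∞)⁻¹ = ∑ j, (p j)⁻¹ := by simp
  rw [h1, avg_eq hp]
  congr 1
  refine Finset.prod_congr rfl fun j _ => ?_
  rw [avg_eq, expE_toReal hr hrp]
  · rfl
  · simpa using diff_pos hrp j

lemma int_ne_zero {u : (Fin d → ℝ) → ℝ≥0∞} (hu : Measurable u) (h0 : ∀ x, u x ≠ 0) (i : Cube d) :
    ∫⁻ x in i.set, u x ≠ 0 := by
  intro h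
  rw [lintegral_eq_zero_iff hu] at h
  have : volume.restrict i.set = 0 := by
    rw [← ae_eq_bot, ← Filter.eventually_false_iff_eq_bot]
    filter_upwards [h] with x hx
    exact h0 x hx
  rw [Measure.restrict_eq_zero] at this
  exact i.vol_pos this

lemma av_ne_zero {u : (Fin d → ℝ) → ℝ≥0∞} (hu : Measurable u) (h0 : ∀ x, u x ≠ 0) (i : Cube d) {e : ℝ}
    (he : 0 < e) : ((∫⁻ x in i.set, u x) / volume i.set) ^ e ≠ 0 := by
  rw [ne_eq, ENNReal.rpow_eq_zero_iff_of_pos he, ENNReal.div_eq_zero_iff, not_or]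
  exact ⟨int_ne_zero hu h0 i, i.vol_fin⟩

lemma av_eq_top {u : (Fin d → ℝ) → ℝ≥0∞} (i : Cube d) {e : ℝ}
    (he : 0 < e) (h : ∫⁻ x in i.set, u x = ∞) : ((∫⁻ x in i.set, u x) / volume i.set) ^ e = ∞ := by
  rw [h, ENNReal.top_div_of_ne_top i.vol_fin, ENNReal.top_rpow_of_pos he]

lemma aC_ne_zero (hr : ∀ j, 0 < r j ∧ r j ≠ ∞)
    (hrp : ∀ j, r j < p j) (hp : (∑ j, (p j)⁻¹)⁻¹ ≠ ∞)
    (hwm : ∀ j, Measurable (w j)) (hw : ∀ j x, 0 < w j x) : aConst p r ∞ w ≠ 0 := by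
  intro h
  have := aC_le (w := w) hr hrp hp ⟨0, 1, one_pos⟩
  rw [h, nonpos_iff_eq_zero, mul_eq_zero, Finset.prod_eq_zero_iff] at this
  rcases this with ⟨j, _, h1⟩ | h1
  · exact av_ne_zero (vW_meas hwm j) (vW_ne_zero hw j) _ (one_div_pos.2 (ee_pos hr hrp j)) h1
  · exact av_ne_zero (WW_meas hwm) (WW_ne_zero hw) _ (one_div_pos.2 (pE_pos hr hrp hp)) h1

lemma vW_fin (hr : ∀ j, 0 < r j ∧ r j ≠ ∞)
    (hrp : ∀ j, r j < p j) (hp : (∑ j, (p j)⁻¹)⁻¹ ≠ ∞)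
    (hwm : ∀ j, Measurable (w j)) (hw : ∀ j x, 0 < w j x) (hA : aConst p r ∞ w ≠ ∞) (j : Fin m)
    (i : Cube d) : ∫⁻ x in i.set, vW r p w j x ≠ ∞ := by
  intro h
  refine hA (top_le_iff.1 (le_trans (le_of_eq ?_) (aC_le (w := w) hr hrp hp i)))
  rw [prod_eq_top_aux (i := j) _ _ _ (Finset.mem_univ j), ENNReal.top_mul]
  · exact av_ne_zero (WW_meas hwm) (WW_ne_zero hw) _ (one_div_pos.2 (pE_pos hr hrp hp))
  · exact av_eq_top i (one_div_pos.2 (ee_pos hr hrp j)) h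
  · exact fun j _ => av_ne_zero (vW_meas hwm j) (vW_ne_zero hw j) _ (one_div_pos.2 (ee_pos hr hrp j))

lemma WW_fin (hr : ∀ j, 0 < r j ∧ r j ≠ ∞)
    (hrp : ∀ j, r j < p j) (hp : (∑ j, (p j)⁻¹)⁻¹ ≠ ∞)
    (hwm : ∀ j, Measurable (w j)) (hw : ∀ j x, 0 < w j x) (hA : aConst p r ∞ w ≠ ∞)
    (i : Cube d) : ∫⁻ x in i.set, WW p w x ≠ ∞ := by
  intro h
  refine hA (top_le_iff.1 (le_trans (le_of_eq ?_) (aC_le (w := w) hr hrp hp i)))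
  rw [av_eq_top (u := WW p w) i (one_div_pos.2 (pE_pos hr hrp hp)) h, ENNReal.mul_top]
  exact Finset.prod_ne_zero_iff.2 fun j _ => av_ne_zero (vW_meas hwm j) (vW_ne_zero hw j) _ (one_div_pos.2 (ee_pos hr hrp j))

end

/-! functions -/

lemma vs_slice {d : ℕ} {f : (Fin d → ℝ) → ℕ → ℂ} (hf : VecSimple f) (k : ℕ) :
    MemLinftyC (fun x => f x k) := by
  obtain ⟨N, A, ξ, hA, hb, hξ, ⟨M, hM⟩, he⟩ := hf
  have e : (fun x => f x k) = fun x => ∑ i, (A i).indicator (fun _ => ξ i k) x := funext fun x => he x k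
  rw [e]
  refine ⟨?_, ⟨∑ i : Fin N, |M|, ?_⟩, ?_⟩
  · exact Finset.measurable_sum _ fun i _ => measurable_const.indicator (hA i)
  · intro x
    refine (norm_sum_le _ _).trans (Finset.sum_le_sum fun i _ => ?_)
    by_cases h : x ∈ A i
    · simpa [h] using (hM i k).trans (le_abs_self M)
    · simp [h]
  · refine Bornology.IsBounded.subset (t := ⋃ i, A i) ?_ ?_
    · exact (Bornology.isBounded_iUnion).2 hb
    · intro x hx
      rw [Function.mem_support] at hx
      obtain ⟨i, _, hi⟩ := Finset.exists_ne_zero_of_sum_ne_zero hx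
      exact Set.mem_iUnion.2 ⟨i, by by_contra h; simp [h] at hi⟩

lemma eN_top (G : ℕ → ℝ≥0∞) : eNorm ∞ Measure.count G = ⨆ k, G k := by
  rw [eNorm, if_pos rfl, essSup_count]

lemma eN_fin (G : ℕ → ℝ≥0∞) {t : ℝ≥0∞} (ht : t ≠ ∞) : eNorm t Measure.count G = (∑' k, G k ^ t.toReal) ^ (1 / t.toReal) := by
  rw [eNorm, if_neg ht, lintegral_count]

lemma eN_meas {d : ℕ} (g : (Fin d → ℝ) → ℕ → ℝ≥0∞) (hg : ∀ k, Measurable (fun x => g x k)) (t : ℝ≥0∞) :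
    Measurable (fun x => eNorm t Measure.count (g x)) := by
  by_cases h : t = ∞
  · subst h
    simp only [eN_top]
    exact Measurable.iSup hg
  · simp only [eN_fin _ h]
    have a1 : Measurable (fun x => ∑' k, g x k ^ t.toReal) := Measurable.tsum fun k => (hg k).pow_const _
    exact a1.pow_const _

lemma eN_ge {t : ℝ≥0∞} (h0 : 0 < t) (G : ℕ → ℝ≥0∞) (k : ℕ) : G k ≤ eNorm t Measure.count G := by
  by_cases h : t = ∞
  · subst h
    rw [eN_top]; exact le_iSup G k
  · have ht := ENNReal.toReal_pos h0.ne' h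
    rw [eN_fin _ h, one_div, ENNReal.le_rpow_inv_iff ht]
    exact ENNReal.le_tsum (f := fun k => G k ^ t.toReal) k

lemma Zh_meas {d m : ℕ} (rr : Fin m → ℝ) (f : Fin m → (Fin d → ℝ) → ℕ → ℂ) (q : ℝ) (k : ℕ) (Q : Cube d) :
    Measurable (Q.set.indicator
        (fun _ => ∏ j, avgS volume (rr j) (fun y => nn (f j y) k) Q.set ^ q)) :=
  measurable_const.indicator Q.meas

lemma f_meas {d : ℕ} {f : (Fin d → ℝ) → ℕ → ℂ} (hf : VecSimple f) (k : ℕ) :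
    Measurable (fun y => nn (f y) k) := by
  have := (vs_slice hf k).1
  exact this.nnnorm.coe_nnreal_ennreal

lemma Z_bound {d m : ℕ} {r p t : Fin m → ℝ≥0∞} (hr : ∀ j, 0 < r j ∧ r j ≠ ∞)
    (hrp : ∀ j, r j < p j) (hrt : ∀ j, r j < t j) (hp : (∑ j, (p j)⁻¹)⁻¹ ≠ ∞)
    (ht : (∑ j, (t j)⁻¹)⁻¹ ≠ ∞)
    {w : Fin m → (Fin d → ℝ) → ℝ} (hwm : ∀ j, Measurable (w j)) (hw : ∀ j x, 0 < w j x)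
    (hA : aConst p r ∞ w ≠ ∞) {q γ γt : ℝ} (hq : 0 < q) (hqP : q ≤ ((∑ j, (p j)⁻¹)⁻¹).toReal)
    (hqT : q ≤ ((∑ j, (t j)⁻¹)⁻¹).toReal)
    (hγ1 : ∀ j, expE (fun j => (r j).toReal) p j / (r j).toReal ≤ γ)
    (hγ2 : ((∑ j, (p j)⁻¹)⁻¹).toReal / q ≤ γ)
    (hγt1 : ∀ j, expE (fun j => (r j).toReal) t j / (r j).toReal ≤ γt)
    (hγt2 : ((∑ j, (t j)⁻¹)⁻¹).toReal / q ≤ γt)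
    (f : Fin m → (Fin d → ℝ) → ℕ → ℂ) (hf : ∀ j, VecSimple (f j))
    (S : ℕ → Set (Cube d)) (E : ℕ → Cube d → Set (Fin d → ℝ))
    (hE : ∀ k, ∀ Q ∈ S k, MeasurableSet (E k Q) ∧ E k Q ⊆ Q.set ∧ Q.vol ≤ 2 * volume (E k Q))
    (hd : ∀ k, (S k).PairwiseDisjoint (E k))
    (hN : ∀ j, wNorm (p j) (w j) (fun x => eNorm (t j) Measure.count (nn (f j x))) ≠ ∞) :
    ∫⁻ x, (∑' k, (∑' Q : S k, (Q : Cube d).set.indicator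
        (fun _ => ∏ j, avgS volume (r j).toReal (fun y => nn (f j y) k) (Q : Cube d).set ^ q) x) ^
          (((∑ j, (t j)⁻¹)⁻¹).toReal / q)) ^ (((∑ j, (p j)⁻¹)⁻¹).toReal / ((∑ j, (t j)⁻¹)⁻¹).toReal) * WW p w x
      ≤ tC d (fun j => (r j).toReal) p t ((∑ j, (p j)⁻¹)⁻¹).toReal ((∑ j, (t j)⁻¹)⁻¹).toReal q γ γt *
        (aConst p r ∞ w ^ γ * ∏ j, wNorm (p j) (w j) (fun x => eNorm (t j) Measure.count (nn (f j x)))) ^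
          ((∑ j, (p j)⁻¹)⁻¹).toReal := by
  have hP := pE_pos hr hrp hp
  have hT := pE_pos hr hrt ht
  refine mct_aux volume (fun k (Q : Cube d) => Q.set.indicator
        (fun _ => ∏ j, avgS volume (r j).toReal (fun y => nn (f j y) k) Q.set ^ q))
    (Zh_meas _ f q) (WW p w) (WW_meas hwm) S (fun k => sparse_ctb (S k) (E k) (hE k) (hd k))
    (by positivity) (by positivity) ?_
  intro K J hJ
  have hFm : ∀ j, Measurable (fun x => eNorm (t j) Measure.count (nn (f j x))) := fun j =>
    eN_meas _ (f_meas (hf j)) _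
  refine fin_bound (fun j => (r j).toReal) p t (rr_pos hr) (ofReal_rr hr hrp) (ofReal_rr hr hrt) hP hqP
    (pE_sum hr hrp) hγ1 hγ2 hT hq hqT (pE_sum hr hrt) hγt1 hγt2 K J E
    (fun k _ i hi => (hE k i (hJ k i hi)).1) (fun k _ i hi => (hE k i (hJ k i hi)).2.1)
    (fun k _ => (hd k).subset (hJ k)) (fun k _ i hi => (hE k i (hJ k i hi)).2.2)
    (fun j k y => nn (f j y) k) (fun j k => f_meas (hf j) k) (vW r p w) (vW_meas hwm)
    (vW_ne_zero hw) (vW_ne_top hr hrp) (vW_fin hr hrp hp hwm hw hA) (WW p w) (WW_meas hwm)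
    (WW_ne_zero hw) (WW_fin hr hrp hp hwm hw hA) (vW_WW hr hrp hp hw) hA (aC_le hr hrp hp)
    (fun j x => eNorm (t j) Measure.count (nn (f j x))) hFm
    (fun j => wNorm (p j) (w j) (fun x => eNorm (t j) Measure.count (nn (f j x)))) hN ?_ ?_ ?_ ?_
  · intro j hj
    have hp0 : 0 < (p j).toReal := ENNReal.toReal_pos ((hr j).1.trans (hrp j)).ne' hj
    simp only [vW_neg hr hrp hw]
    rw [wNorm, eNorm, if_neg hj, ← ENNReal.rpow_mul, one_div, inv_mul_cancel₀ hp0.ne', ENNReal.rpow_one]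
  · intro j hj
    simp only [vW_neg hr hrp hw]
    rw [wNorm, eNorm, if_pos hj]
    exact ENNReal.ae_le_essSup _
  · intro j hj x
    have ht0 : 0 < (t j).toReal := ENNReal.toReal_pos ((hr j).1.trans (hrt j)).ne' hj
    rw [eN_fin _ hj, ← ENNReal.rpow_mul, one_div, inv_mul_cancel₀ ht0.ne', ENNReal.rpow_one]
    exact ENNReal.sum_le_tsum K
  · intro j _ k _ x
    exact eN_ge ((hr j).1.trans (hrt j)) (nn (f j x)) k

lemma wN_zero {d : ℕ} {p : ℝ≥0∞} (hp : 0 < p) {w : (Fin d → ℝ) → ℝ} (hwm : Measurable w) (hw : ∀ x, 0 < w x)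
    {F : (Fin d → ℝ) → ℝ≥0∞} (hF : Measurable F) (h : wNorm p w F = 0) : ∀ᵐ x, F x = 0 := by
  have a1 : Measurable (fun x => F x * ENNReal.ofReal (w x)) := hF.mul hwm.ennreal_ofReal
  have key : ∀ᵐ x, F x * ENNReal.ofReal (w x) = 0 := by
    by_cases hp' : p = ∞
    · rw [wNorm, eNorm, if_pos hp', ENNReal.essSup_eq_zero_iff] at h
      exact h
    · have hp0 := ENNReal.toReal_pos hp.ne' hp'
      rw [wNorm, eNorm, if_neg hp', ENNReal.rpow_eq_zero_iff_of_pos (by positivity),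
        lintegral_eq_zero_iff (a1.pow_const _)] at h
      filter_upwards [h] with x hx
      simpa [ENNReal.rpow_eq_zero_iff_of_pos hp0, -mul_eq_zero] using hx
  filter_upwards [key] with x hx
  rcases mul_eq_zero.1 hx with h1 | h1
  · exact h1
  · simp [(hw x).not_ge] at h1

lemma Z_zero {d m : ℕ} {r p t : Fin m → ℝ≥0∞} (hr : ∀ j, 0 < r j ∧ r j ≠ ∞)
    (hrp : ∀ j, r j < p j) (hrt : ∀ j, r j < t j) (hp : (∑ j, (p j)⁻¹)⁻¹ ≠ ∞)
    (ht : (∑ j, (t j)⁻¹)⁻¹ ≠ ∞)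
    {w : Fin m → (Fin d → ℝ) → ℝ} (hwm : ∀ j, Measurable (w j)) (hw : ∀ j x, 0 < w j x)
    {q : ℝ} (hq : 0 < q)
    (f : Fin m → (Fin d → ℝ) → ℕ → ℂ) (hf : ∀ j, VecSimple (f j))
    (S : ℕ → Set (Cube d)) {i : Fin m}
    (hN : wNorm (p i) (w i) (fun x => eNorm (t i) Measure.count (nn (f i x))) = 0) :
    ∫⁻ x, (∑' k, (∑' Q : S k, (Q : Cube d).set.indicator
        (fun _ => ∏ j, avgS volume (r j).toReal (fun y => nn (f j y) k) (Q : Cube d).set ^ q) x) ^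
          (((∑ j, (t j)⁻¹)⁻¹).toReal / q)) ^ (((∑ j, (p j)⁻¹)⁻¹).toReal / ((∑ j, (t j)⁻¹)⁻¹).toReal) * WW p w x
      = 0 := by
  have hP := pE_pos hr hrp hp
  have hT := pE_pos hr hrt ht
  have hri := rr_pos hr i
  have hFm : Measurable (fun x => eNorm (t i) Measure.count (nn (f i x))) := eN_meas _ (f_meas (hf i)) _
  have h1 := wN_zero ((hr i).1.trans (hrp i)) (hwm i) (hw i) hFm hN
  have h2 : ∀ k (Q : Cube d), avgS volume (r i).toReal (fun y => nn (f i y) k) Q.set = 0 := by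
    intro k Q
    have : ∫⁻ x in Q.set, (nn (f i x) k) ^ (r i).toReal = 0 := by
      rw [← lintegral_zero (μ := volume.restrict Q.set)]
      refine lintegral_congr_ae (ae_restrict_of_ae ?_)
      filter_upwards [h1] with x hx
      have h3 := eN_ge ((hr i).1.trans (hrt i)) (nn (f i x)) k
      rw [hx, nonpos_iff_eq_zero] at h3
      rw [h3, ENNReal.zero_rpow_of_pos hri]
    rw [avgS, this, ENNReal.zero_div, ENNReal.zero_rpow_of_pos (by positivity)]
  have h3 : ∀ k (Q : Cube d), ∏ j, avgS volume (r j).toReal (fun y => nn (f j y) k) Q.set ^ q = 0 := by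
    intro k Q
    refine Finset.prod_eq_zero (Finset.mem_univ i) ?_
    rw [h2, ENNReal.zero_rpow_of_pos hq]
  have e1 : 0 < ((∑ j, (t j)⁻¹)⁻¹).toReal / q := by positivity
  have e2 : 0 < ((∑ j, (p j)⁻¹)⁻¹).toReal / ((∑ j, (t j)⁻¹)⁻¹).toReal := by positivity
  simp only [h3, Set.indicator_zero, tsum_zero, ENNReal.zero_rpow_of_pos e1, ENNReal.zero_rpow_of_pos e2,
    zero_mul, lintegral_zero]

lemma ind_embed {d : ℕ} (S : Set (Cube d)) (a : Cube d → ℝ≥0∞) {q q₀ : ℝ} (hq : 0 < q) (h : q ≤ q₀)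
    (x : Fin d → ℝ) :
    (∑' Q : S, (Q : Cube d).set.indicator (fun _ => a Q ^ q₀) x) ^ (1 / q₀) ≤
      (∑' Q : S, (Q : Cube d).set.indicator (fun _ => a Q ^ q) x) ^ (1 / q) := by
  have e : ∀ (s : ℝ), 0 < s → ∀ Q : S, (Q : Cube d).set.indicator (fun _ => a Q ^ s) x =
      ((Q : Cube d).set.indicator (fun _ => a Q) x) ^ s := by
    intro s hs Q
    by_cases hx : x ∈ (Q : Cube d).set
    · simp [hx]
    · simp [hx, hs]
  simp only [e q hq, e q₀ (hq.trans_le h)]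
  exact lq_embedding _ hq h

lemma core (d m : ℕ) (hm : 1 ≤ m)
    (r : Fin m → ℝ≥0∞) (hr : ∀ j, 0 < r j ∧ r j ≠ ∞)
    (q₀ qE : ℝ≥0∞) (hq₀' : q₀ ≠ ∞) (hqE : 0 < qE) 
    (p t : Fin m → ℝ≥0∞) (hrp : ∀ j, r j < p j) (hrt : ∀ j, r j < t j)
    (hpfin : (∑ j, (p j)⁻¹)⁻¹ ≠ ∞) (htfin : (∑ j, (t j)⁻¹)⁻¹ ≠ ∞) 
    (hqq : qE ≤ q₀) (hqt : qE ≤ (∑ j, (t j)⁻¹)⁻¹) :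
    ∃ C : ℝ≥0∞, 0 < C ∧ C ≠ ∞ ∧
      ∀ (T : (Fin m → ((Fin d → ℝ) → ℂ)) → ((Fin d → ℝ) → ℂ)) (C_T : ℝ≥0∞),
        (∀ f, (∀ j, MemLinftyC (f j)) →
          ∃ S : Set (Cube d), IsSparse S ∧
            ∀ᵐ x, nn (T f) x ≤ C_T *
              (∑' Q : S, (Q : Cube d).set.indicator
                  (fun _ => (∏ j, avg (r j) (nn (f j)) (Q : Cube d)) ^ q₀.toReal) x)
                ^ (1 / q₀.toReal)) →
        ∀ (w : Fin m → (Fin d → ℝ) → ℝ),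
          (∀ j, Measurable (w j)) → (∀ j x, 0 < w j x) →
          aConst p r ∞ w ≠ ∞ →
        ∀ (f : Fin m → (Fin d → ℝ) → ℕ → ℂ), (∀ j, VecSimple (f j)) →
            wNorm (∑ j, (p j)⁻¹)⁻¹ (fun x => ∏ j, w j x)
                (fun x => eNorm (∑ j, (t j)⁻¹)⁻¹ Measure.count
                  (fun k => (‖T (fun j y => f j y k) x‖₊ : ℝ≥0∞))) ≤
              C * C_T * aConst p r ∞ w ^ gam r p qE *
                ∏ j, wNorm (p j) (w j)
                  (fun x => eNorm (t j) Measure.count (nn (f j x))) := by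
  set PP := ((∑ j, (p j)⁻¹)⁻¹).toReal with hPPd
  set TT := ((∑ j, (t j)⁻¹)⁻¹).toReal with hTTd
  have hP : 0 < PP := pE_pos hr hrp hpfin
  have hT : 0 < TT := pE_pos hr hrt htfin
  have hqEt : qE ≠ ∞ := ne_top_of_le_ne_top htfin hqt
  have hqE' : 0 < qE.toReal := ENNReal.toReal_pos hqE.ne' hqEt
  set q := min qE.toReal PP with hqd
  have hq : 0 < q := lt_min hqE' hP
  have hqP : q ≤ PP := min_le_right _ _
  have hqT : q ≤ TT := (min_le_left _ _).trans (ENNReal.toReal_mono htfin hqt)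
  have hqq0 : q ≤ q₀.toReal := (min_le_left _ _).trans (ENNReal.toReal_mono hq₀' hqq)
  set γt := ∑ j, |expE (fun j => (r j).toReal) t j / (r j).toReal| + TT / q with hγtd
  have hγt1 : ∀ j, expE (fun j => (r j).toReal) t j / (r j).toReal ≤ γt := by
    intro j
    have h1 := Finset.single_le_sum (f := fun j => |expE (fun j => (r j).toReal) t j / (r j).toReal|)
      (fun _ _ => abs_nonneg _) (Finset.mem_univ j)
    have h2 : 0 ≤ TT / q := by positivity
    have h3 := le_abs_self (expE (fun j => (r j).toReal) t j / (r j).toReal)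
    linarith
  have hγt2 : TT / q ≤ γt := by
    have : 0 ≤ ∑ j, |expE (fun j => (r j).toReal) t j / (r j).toReal| :=
      Finset.sum_nonneg fun _ _ => abs_nonneg _
    linarith
  have hγ1 : ∀ j, expE (fun j => (r j).toReal) p j / (r j).toReal ≤ gam r p qE := gam1 hr hrp hpfin hqE
  have hγ2 : PP / q ≤ gam r p qE := gam2 hm hr hrp hpfin hqE
  have hC := tC_ne_top d (fun j => (r j).toReal) p t (rr_pos hr) (ofReal_rr hr hrp) (ofReal_rr hr hrt)
    hP hqP hγ2 hT hq hqT hγt2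
  set D := tC d (fun j => (r j).toReal) p t PP TT q (gam r p qE) γt with hD
  refine ⟨D ^ (1 / PP) + 1, by positivity, ?_, ?_⟩
  · exact ENNReal.add_ne_top.2 ⟨ENNReal.rpow_ne_top_of_nonneg (by positivity) hC, by simp⟩
  intro T C_T hS w hwm hw hA f hf
  choose S hSp hSb using fun k : ℕ => hS (fun j y => f j y k) (fun j => vs_slice (hf j) k)
  choose E hE hd using hSp
  have hSc : ∀ k, Countable (S k) := fun k => (sparse_ctb (S k) (E k) (hE k) (hd k)).to_subtype
  set h : ℕ → Cube d → (Fin d → ℝ) → ℝ≥0∞ := fun k Q => Q.set.indicator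
        (fun _ => ∏ j, avgS volume (r j).toReal (fun y => nn (f j y) k) Q.set ^ q) with hh
  set Y : (Fin d → ℝ) → ℝ≥0∞ := fun x => ∑' k, (∑' Q : S k, h k Q x) ^ (TT / q) with hY
  have hYm : Measurable Y := by
    have a1 : ∀ k, Measurable (fun x => ∑' Q : S k, h k Q x) := fun k =>
      Measurable.tsum fun Q : S k => Zh_meas _ f q k Q
    exact Measurable.tsum fun k => (a1 k).pow_const _
  set Z := ∫⁻ x, Y x ^ (PP / TT) * WW p w x with hZ
  have hpt : ∀ᵐ x, ∀ k, (‖T (fun j y => f j y k) x‖₊ : ℝ≥0∞) ≤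
      C_T * (∑' Q : S k, h k Q x) ^ (1 / q) := by
    rw [ae_all_iff]
    intro k
    filter_upwards [hSb k] with x hx
    refine hx.trans (mul_le_mul' le_rfl ?_)
    refine (ind_embed (S k) (fun Q => ∏ j, avg (r j) (nn (fun y => f j y k)) Q) hq hqq0 x).trans (le_of_eq ?_)
    congr 1
    refine tsum_congr fun Q => ?_
    rw [hh]
    simp only
    congr 1
    funext _
    rw [← ENNReal.prod_rpow_of_nonneg hq.le]
    refine Finset.prod_congr rfl fun j _ => ?_
    rw [avg_eq (hr j).2]
    rfl
  have hL : wNorm (∑ j, (p j)⁻¹)⁻¹ (fun x => ∏ j, w j x)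
                (fun x => eNorm (∑ j, (t j)⁻¹)⁻¹ Measure.count
                  (fun k => (‖T (fun j y => f j y k) x‖₊ : ℝ≥0∞))) ≤ C_T * Z ^ (1 / PP) := by
    rw [wNorm, eNorm, if_neg hpfin, ← hPPd]
    have b1 : ∫⁻ x, (eNorm (∑ j, (t j)⁻¹)⁻¹ Measure.count
        (fun k => (‖T (fun j y => f j y k) x‖₊ : ℝ≥0∞)) * ENNReal.ofReal (∏ j, w j x)) ^ PP ≤ C_T ^ PP * Z := by
      have a1 : Measurable (fun x => Y x ^ (PP / TT) * WW p w x) := (hYm.pow_const _).mul (WW_meas hwm)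
      rw [hZ, ← lintegral_const_mul _ a1]
      refine lintegral_mono_ae ?_
      filter_upwards [hpt] with x hx
      have c1 : eNorm (∑ j, (t j)⁻¹)⁻¹ Measure.count (fun k => (‖T (fun j y => f j y k) x‖₊ : ℝ≥0∞)) ≤
          C_T * Y x ^ (1 / TT) := by
        rw [eN_fin _ htfin, ← hTTd]
        calc (∑' k, (‖T (fun j y => f j y k) x‖₊ : ℝ≥0∞) ^ TT) ^ (1 / TT)
            ≤ (∑' k, (C_T * (∑' Q : S k, h k Q x) ^ (1 / q)) ^ TT) ^ (1 / TT) :=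
              ENNReal.rpow_le_rpow (ENNReal.tsum_le_tsum fun k => ENNReal.rpow_le_rpow (hx k) hT.le)
                (by positivity)
          _ = (C_T ^ TT * Y x) ^ (1 / TT) := by
              rw [hY]
              simp only
              rw [← ENNReal.tsum_mul_left]
              congr 1
              refine tsum_congr fun k => ?_
              rw [ENNReal.mul_rpow_of_nonneg _ _ hT.le, ← ENNReal.rpow_mul]
              congr 2
              ring
          _ = C_T * Y x ^ (1 / TT) := by
              rw [ENNReal.mul_rpow_of_nonneg _ _ (by positivity), ← ENNReal.rpow_mul, mul_one_div,
                div_self hT.ne', ENNReal.rpow_one]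
      calc _ ≤ (C_T * Y x ^ (1 / TT) * ENNReal.ofReal (∏ j, w j x)) ^ PP :=
            ENNReal.rpow_le_rpow (mul_le_mul' c1 le_rfl) hP.le
        _ = C_T ^ PP * (Y x ^ (PP / TT) * WW p w x) := by
            rw [ENNReal.mul_rpow_of_nonneg _ _ hP.le, ENNReal.mul_rpow_of_nonneg _ _ hP.le,
              ← ENNReal.rpow_mul, WW, mul_assoc]
            congr 3
            ring
    calc _ ≤ (C_T ^ PP * Z) ^ (1 / PP) := ENNReal.rpow_le_rpow b1 (by positivity)
      _ = C_T * Z ^ (1 / PP) := by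
        rw [ENNReal.mul_rpow_of_nonneg _ _ (by positivity), ← ENNReal.rpow_mul, mul_one_div,
                div_self hP.ne', ENNReal.rpow_one]
  refine hL.trans ?_
  set N : Fin m → ℝ≥0∞ := fun j => wNorm (p j) (w j) (fun x => eNorm (t j) Measure.count (nn (f j x))) with hNd
  have hZb : Z ^ (1 / PP) ≤ (D ^ (1 / PP) + 1) * (aConst p r ∞ w ^ gam r p qE * ∏ j, N j) := by
    by_cases h0 : ∃ i, N i = 0
    · obtain ⟨i, hi⟩ := h0
      have : Z = 0 := Z_zero hr hrp hrt hpfin htfin hwm hw hq f hf S hi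
      rw [this, ENNReal.zero_rpow_of_pos (by positivity)]
      exact zero_le
    by_cases h1 : ∃ i, N i = ∞
    · obtain ⟨i, hi⟩ := h1
      push Not at h0
      rw [prod_eq_top_aux _ N (fun j _ => h0 j) (Finset.mem_univ i) hi, ENNReal.mul_top, ENNReal.mul_top]
      · exact le_top
      · exact (by positivity : (0 : ℝ≥0∞) < D ^ (1 / PP) + 1).ne'
      · have := aC_ne_zero hr hrp hpfin hwm hw
        exact (ENNReal.rpow_pos (pos_iff_ne_zero.2 this) hA).ne'
    · push Not at h1
      have := Z_bound hr hrp hrt hpfin htfin hwm hw hA hq hqP hqT hγ1 hγ2 hγt1 hγt2 f hf S E hE hd h1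
      calc Z ^ (1 / PP) ≤ (D * (aConst p r ∞ w ^ gam r p qE * ∏ j, N j) ^ PP) ^ (1 / PP) :=
            ENNReal.rpow_le_rpow this (by positivity)
        _ = D ^ (1 / PP) * (aConst p r ∞ w ^ gam r p qE * ∏ j, N j) := by
          rw [ENNReal.mul_rpow_of_nonneg _ _ (by positivity), ← ENNReal.rpow_mul, mul_one_div,
                div_self hP.ne', ENNReal.rpow_one]
        _ ≤ _ := mul_le_mul' le_self_add le_rfl
  calc C_T * Z ^ (1 / PP) ≤ C_T * ((D ^ (1 / PP) + 1) * (aConst p r ∞ w ^ gam r p qE * ∏ j, N j)) :=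
        mul_le_mul' le_rfl hZb
    _ = _ := by ring

/-- weighted `ℓ^t`-valued bounds for an m-linear operator satisfying
pointwise sparse domination of `ℓ^{q₀}`-type, in both the Banach and quasi-Banach
ranges. -/
theorem statement17 (d m : ℕ) (hd : 1 ≤ d) (hm : 1 ≤ m)
    (r : Fin m → ℝ≥0∞) (hr : ∀ j, 0 < r j ∧ r j ≠ ∞)
    (q₀ : ℝ≥0∞) (hq₀ : 0 < q₀) (hq₀' : q₀ ≠ ∞)
    (p t : Fin m → ℝ≥0∞) (hrp : ∀ j, r j < p j) (hrt : ∀ j, r j < t j)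
    (hpfin : (∑ j, (p j)⁻¹)⁻¹ ≠ ∞) (htfin : (∑ j, (t j)⁻¹)⁻¹ ≠ ∞) :
    ∃ C : ℝ≥0∞, 0 < C ∧ C ≠ ∞ ∧
      ∀ (T : (Fin m → ((Fin d → ℝ) → ℂ)) → ((Fin d → ℝ) → ℂ)) (C_T : ℝ≥0∞),
        -- T maps tuples of functions in L^∞_c to measurable functions
        (∀ f, (∀ j, MemLinftyC (f j)) → Measurable (T f)) →
        -- T is m-linear
        (∀ (f : Fin m → ((Fin d → ℝ) → ℂ)) (j : Fin m) (g : (Fin d → ℝ) → ℂ),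
          (∀ k, MemLinftyC (f k)) → MemLinftyC g →
          T (Function.update f j (f j + g)) = T f + T (Function.update f j g)) →
        (∀ (f : Fin m → ((Fin d → ℝ) → ℂ)) (j : Fin m) (c : ℂ),
          (∀ k, MemLinftyC (f k)) →
          T (Function.update f j (c • f j)) = c • T f) →
        -- pointwise sparse domination of ℓ^{q₀}-type
        (∀ f, (∀ j, MemLinftyC (f j)) →
          ∃ S : Set (Cube d), IsSparse S ∧
            ∀ᵐ x, nn (T f) x ≤ C_T *
              (∑' Q : S, (Q : Cube d).set.indicator
                  (fun _ => (∏ j, avg (r j) (nn (f j)) (Q : Cube d)) ^ q₀.toReal) x)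
                ^ (1 / q₀.toReal)) →
        ∀ (w : Fin m → (Fin d → ℝ) → ℝ),
          (∀ j, Measurable (w j)) → (∀ j x, 0 < w j x) →
          aConst p r ∞ w ≠ ∞ →
        ∀ (f : Fin m → (Fin d → ℝ) → ℕ → ℂ), (∀ j, VecSimple (f j)) →
          -- case t ∈ [q₀, ∞)
          ((q₀ ≤ (∑ j, (t j)⁻¹)⁻¹ →
            wNorm (∑ j, (p j)⁻¹)⁻¹ (fun x => ∏ j, w j x)
                (fun x => eNorm (∑ j, (t j)⁻¹)⁻¹ Measure.count
                  (fun k => (‖T (fun j y => f j y k) x‖₊ : ℝ≥0∞))) ≤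
              C * C_T * aConst p r ∞ w ^
                  ((max (⨆ j, (r j)⁻¹ / ((r j)⁻¹ - (p j)⁻¹))
                    ((∑ j, (p j)⁻¹)⁻¹ / q₀)).toReal) *
                ∏ j, wNorm (p j) (w j)
                  (fun x => eNorm (t j) Measure.count (nn (f j x)))) ∧
          -- case t ∈ (r, q₀]
          ((∑ j, (t j)⁻¹)⁻¹ ≤ q₀ →
            wNorm (∑ j, (p j)⁻¹)⁻¹ (fun x => ∏ j, w j x)
                (fun x => eNorm (∑ j, (t j)⁻¹)⁻¹ Measure.count
                  (fun k => (‖T (fun j y => f j y k) x‖₊ : ℝ≥0∞))) ≤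
              C * C_T * aConst p r ∞ w ^
                  ((max (⨆ j, (r j)⁻¹ / ((r j)⁻¹ - (p j)⁻¹))
                    ((∑ j, (p j)⁻¹)⁻¹ / (∑ j, (t j)⁻¹)⁻¹)).toReal) *
                ∏ j, wNorm (p j) (w j)
                  (fun x => eNorm (t j) Measure.count (nn (f j x))))) := by
  rcases le_total q₀ (∑ j, (t j)⁻¹)⁻¹ with hc | hc
  · obtain ⟨C, h0, h1, h2⟩ := core d m hm r hr q₀ q₀ hq₀' hq₀ p t hrp hrt hpfin htfin le_rfl hc
    refine ⟨C, h0, h1, ?_⟩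
    intro T C_T _ _ _ hS w hwm hw hA f hf
    have h3 := h2 T C_T hS w hwm hw hA f hf
    rw [gam] at h3
    refine ⟨fun _ => h3, fun hc' => ?_⟩
    have he : q₀ = (∑ j, (t j)⁻¹)⁻¹ := le_antisymm hc hc'
    rwa [he] at h3
  · have hT : 0 < (∑ j, (t j)⁻¹)⁻¹ := by
      have := pE_pos hr hrt htfin
      exact (ENNReal.toReal_pos_iff.1 this).1
    obtain ⟨C, h0, h1, h2⟩ := core d m hm r hr q₀ (∑ j, (t j)⁻¹)⁻¹ hq₀' hT p t hrp hrt hpfin htfin hc le_rfl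
    refine ⟨C, h0, h1, ?_⟩
    intro T C_T _ _ _ hS w hwm hw hA f hf
    have h3 := h2 T C_T hS w hwm hw hA f hf
    rw [gam] at h3
    refine ⟨fun hc' => ?_, fun _ => h3⟩
    have he : q₀ = (∑ j, (t j)⁻¹)⁻¹ := le_antisymm hc' hc
    rw [he]
    exact h3

end
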